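/- arXiv:1507.00952 — 2 statements merged into one kernel-verified Lean document; each statement's English description precedes it below -/
import Mathlib

section
/- (Injectivity of the θ⁽⁴⁾ map on the open set where no theta constant vanishes.) Let τ and τ' be points of the Siegel upper half-space H_3 such that θ_m(τ) ≠ 0 and θ_m(τ') ≠ 0 for every even characteristic m ∈ {0,1}³ × {0,1}³. If there exists c ∈ ℂ, c ≠ 0, such that θ_m(τ')⁴ = c · θ_m(τ)⁴ for all even characteristics m (i.e. τ and τ' have the same image under the map τ ↦ [θ_{m_1}⁴(τ) : … : θ_{m_{36}}⁴(τ)] ∈ ℙ³⁵), then there exists γ = (a b; c d) ∈ Sp(6, ℤ) with γ ≡ I₆ mod 2 such that τ' = (aτ + b)(cτ + d)⁻¹. -/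
open scoped BigOperators
open Complex Matrix

noncomputable section

/-- The Siegel upper half-space: complex symmetric `g × g` matrices with
positive definite imaginary part. -/
def IsSiegel {g : ℕ} (τ : Matrix (Fin g) (Fin g) ℂ) : Prop :=
  τ.IsSymm ∧ Matrix.PosDef (Matrix.of fun i j => (τ i j).im)

/-- The `p`-th term of the Riemann theta series with characteristic `m`. -/
def thetaTerm {g : ℕ} (m : (Fin g → ℤ) × (Fin g → ℤ))
    (τ : Matrix (Fin g) (Fin g) ℂ) (z : Fin g → ℂ) (p : Fin g → ℤ) : ℂ :=
  Complex.exp ((Real.pi : ℂ) * Complex.I *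
      (∑ i, ∑ j, ((p i : ℂ) + (m.1 i : ℂ) / 2) * τ i j * ((p j : ℂ) + (m.1 j : ℂ) / 2))
    + 2 * (Real.pi : ℂ) * Complex.I *
      (∑ i, ((p i : ℂ) + (m.1 i : ℂ) / 2) * (z i + (m.2 i : ℂ) / 2)))

/-- The Riemann theta function with characteristic `m`. -/
def theta {g : ℕ} (m : (Fin g → ℤ) × (Fin g → ℤ))
    (τ : Matrix (Fin g) (Fin g) ℂ) (z : Fin g → ℂ) : ℂ :=
  ∑' p : Fin g → ℤ, thetaTerm m τ z p

/-- The gradient `grad_z θ_m(τ, z)|_{z = 0}`. -/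
def thetaGrad {g : ℕ} (m : (Fin g → ℤ) × (Fin g → ℤ))
    (τ : Matrix (Fin g) (Fin g) ℂ) : Fin g → ℂ :=
  fun j => fderiv ℂ (fun z => theta m τ z) 0 (Pi.single j 1)

/-- The Jacobian determinant `D(n₁, …, n_g)(τ)`. -/
def jacDet {g : ℕ} (n : Fin g → (Fin g → ℤ) × (Fin g → ℤ))
    (τ : Matrix (Fin g) (Fin g) ℂ) : ℂ :=
  ((Real.pi : ℂ) ^ g)⁻¹ * Matrix.det (Matrix.of fun i j => thetaGrad (n i) τ j)

/-- A characteristic mod 2 in genus `g`. -/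
abbrev ThetaChar (g : ℕ) := (Fin g → ZMod 2) × (Fin g → ZMod 2)

/-- Lift of a mod-2 characteristic to the integer representative with entries in `{0,1}`. -/
def charLift {g : ℕ} (m : ThetaChar g) : (Fin g → ℤ) × (Fin g → ℤ) :=
  (fun i => ((m.1 i).val : ℤ), fun i => ((m.2 i).val : ℤ))

/-- `m'·m''` computed on the `{0,1}` representatives. -/
def charDot {g : ℕ} (m : ThetaChar g) : ℕ := ∑ i, (m.1 i).val * (m.2 i).val

/-- The parity `e(m) = (-1)^{m'·m''}` of a characteristic. -/
def charParity {g : ℕ} (m : ThetaChar g) : ℤ := (-1) ^ charDot m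

def IsOddChar {g : ℕ} (m : ThetaChar g) : Prop := charParity m = -1

def IsEvenChar {g : ℕ} (m : ThetaChar g) : Prop := charParity m = 1

/-- A tuple of characteristics is azygetic if
`e(nᵢ)e(nⱼ)e(nₖ)e(nᵢ+nⱼ+nₖ) = -1` for all `i < j < k`. -/
def Azygetic {g k : ℕ} (n : Fin k → ThetaChar g) : Prop :=
  ∀ i j l : Fin k, i < j → j < l →
    charParity (n i) * charParity (n j) * charParity (n l) *
      charParity (n i + n j + n l) = -1

/-- An Aronhold set in genus 3: seven pairwise distinct odd characteristics such
that, together with their sum, they form an azygetic 8-tuple. -/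
def IsAronhold (n : Fin 7 → ThetaChar 3) : Prop :=
  Function.Injective n ∧ (∀ i, IsOddChar (n i)) ∧
    Azygetic (Fin.snoc n (∑ i, n i) : Fin 8 → ThetaChar 3)

/-- The standard symplectic form matrix `J = (0 I; -I 0)` over a ring. -/
def Jmat (g : ℕ) (R : Type*) [Ring R] :
    Matrix (Fin g ⊕ Fin g) (Fin g ⊕ Fin g) R :=
  Matrix.fromBlocks 0 1 (-1) 0

/-- The blocks `(a b; c d)` form a symplectic matrix over `R`. -/
def IsSymplectic {g : ℕ} {R : Type*} [Ring R]
    (a b c d : Matrix (Fin g) (Fin g) R) : Prop :=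
  (Matrix.fromBlocks a b c d)ᵀ * Jmat g R * Matrix.fromBlocks a b c d = Jmat g R

/-- The action of `Sp(2g, ℤ)` on mod-2 characteristics. -/
def charAction {g : ℕ} (a b c d : Matrix (Fin g) (Fin g) ℤ) (m : ThetaChar g) : ThetaChar g :=
  (fun i => (∑ j, ((d i j : ZMod 2)) * m.1 j) - (∑ j, ((c i j : ZMod 2)) * m.2 j)
      + (((c * dᵀ) i i : ℤ) : ZMod 2),
   fun i => -(∑ j, ((b i j : ZMod 2)) * m.1 j) + (∑ j, ((a i j : ZMod 2)) * m.2 j)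
      + (((a * bᵀ) i i : ℤ) : ZMod 2))

/-- The Jacobian determinant in genus 3, for three mod-2 odd characteristics. -/
def D3 (n1 n2 n3 : ThetaChar 3) (τ : Matrix (Fin 3) (Fin 3) ℂ) : ℂ :=
  jacDet ![charLift n1, charLift n2, charLift n3] τ

end

lemma summable_exp_neg_abs_int : Summable fun n : ℤ => Real.exp (-|(n : ℝ)|) := by
  apply Summable.of_nat_of_neg
  · simpa using Real.summable_exp_neg_nat
  · simpa using Real.summable_exp_neg_nat

lemma summable_exp_neg_sum_abs :
    Summable fun X : Fin 3 → ℤ => Real.exp (-∑ i, |(X i : ℝ)|) := by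
  have h := summable_exp_neg_abs_int
  have h2 := h.mul_of_nonneg h (fun _ => (Real.exp_pos _).le) (fun _ => (Real.exp_pos _).le)
  have h3 := h.mul_of_nonneg h2 (fun _ => (Real.exp_pos _).le)
    (fun _ => mul_nonneg (Real.exp_pos _).le (Real.exp_pos _).le)
  have hinj : Function.Injective fun X : Fin 3 → ℤ => (X 0, X 1, X 2) := by
    intro X Y hXY
    simp only [Prod.mk.injEq] at hXY
    funext i
    fin_cases i
    exacts [hXY.1, hXY.2.1, hXY.2.2]
  refine (h3.comp_injective hinj).congr fun X => ?_
  simp only [Function.comp, Fin.sum_univ_three, ← Real.exp_add]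
  congr 1
  ring

lemma exists_quadratic_lower_bound {Y : Matrix (Fin 3) (Fin 3) ℝ} (hY : Y.PosDef) :
    ∃ c > 0, ∀ x : Fin 3 → ℝ, c * ‖x‖ ^ 2 ≤ ∑ i, ∑ j, x i * Y i j * x j := by
  have hcont : Continuous fun x : Fin 3 → ℝ => ∑ i, ∑ j, x i * Y i j * x j := by fun_prop
  have hpos : ∀ x : Fin 3 → ℝ, x ≠ 0 → 0 < ∑ i, ∑ j, x i * Y i j * x j := by
    intro x hx
    have := hY.dotProduct_mulVec_pos hx
    simpa [dotProduct, mulVec, Finset.mul_sum, mul_assoc] using this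
  have hne : (Metric.sphere (0 : Fin 3 → ℝ) 1).Nonempty := NormedSpace.sphere_nonempty.2 zero_le_one
  obtain ⟨u, hu, hmin⟩ := (isCompact_sphere (0 : Fin 3 → ℝ) 1).exists_isMinOn hne hcont.continuousOn
  have hu0 : u ≠ 0 := by
    rintro rfl
    simp at hu
  refine ⟨_, hpos u hu0, fun x => ?_⟩
  rcases eq_or_ne x 0 with rfl | hx
  · simp
  have hn : 0 < ‖x‖ := norm_pos_iff.2 hx
  have hs : (‖x‖⁻¹ • x) ∈ Metric.sphere (0 : Fin 3 → ℝ) 1 := by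
    simp [norm_smul, hn.ne']
  have := hmin hs
  simp only [Set.mem_ofPred_eq, Pi.smul_apply, smul_eq_mul] at this
  have e : ∑ i, ∑ j, ‖x‖⁻¹ * x i * Y i j * (‖x‖⁻¹ * x j)
      = (‖x‖ ^ 2)⁻¹ * ∑ i, ∑ j, x i * Y i j * x j := by
    rw [Finset.mul_sum]
    refine Finset.sum_congr rfl fun i _ => ?_
    rw [Finset.mul_sum]
    refine Finset.sum_congr rfl fun j _ => ?_
    field_simp
  rw [e, inv_mul_eq_div, le_div_iff₀ (by positivity)] at this
  exact this

/-- The exponential attached to the lattice point `X / 2`. -/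
noncomputable def latticeTerm (τ : Matrix (Fin 3) (Fin 3) ℂ) (z : Fin 3 → ℂ) (X : Fin 3 → ℤ) : ℂ :=
  cexp ((Real.pi : ℂ) * I / 4 * (∑ i, ∑ j, (X i : ℂ) * τ i j * X j)
    + (Real.pi : ℂ) * I * ∑ i, (X i : ℂ) * z i)

lemma norm_latticeTerm (τ : Matrix (Fin 3) (Fin 3) ℂ) (z : Fin 3 → ℂ) (X : Fin 3 → ℤ) :
    ‖latticeTerm τ z X‖ = Real.exp (-(Real.pi / 4) * (∑ i, ∑ j, (X i : ℝ) * (τ i j).im * X j)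
      - Real.pi * ∑ i, (X i : ℝ) * (z i).im) := by
  rw [latticeTerm, Complex.norm_exp]
  congr 1
  simp only [Fin.sum_univ_three]
  simp [Complex.add_re, Complex.mul_re, Complex.mul_im]
  ring

lemma exists_norm_latticeTerm_le {τ : Matrix (Fin 3) (Fin 3) ℂ} (hτ : IsSiegel τ) (R : ℝ) :
    ∃ K : ℝ, ∀ z : Fin 3 → ℂ, ‖z‖ ≤ R → ∀ X : Fin 3 → ℤ,
      ‖latticeTerm τ z X‖ ≤ K * Real.exp (-(2 * ∑ i, |(X i : ℝ)|)) := by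
  obtain ⟨c, hc, hq⟩ := exists_quadratic_lower_bound hτ.2
  set α := Real.pi / 4 * c with hα
  have hαp : 0 < α := by positivity
  set β := 3 * Real.pi * R + 6 with hβ
  refine ⟨Real.exp (β ^ 2 / (4 * α)), fun z hz X => ?_⟩
  rw [norm_latticeTerm, ← Real.exp_add]
  apply Real.exp_le_exp.2
  set x : Fin 3 → ℝ := fun i => (X i : ℝ) with hx
  have h1 := hq x
  simp only [Matrix.of_apply] at h1
  have hxi : ∀ i, |(X i : ℝ)| ≤ ‖x‖ := fun i => norm_le_pi_norm x i
  have hsum : ∑ i, |(X i : ℝ)| ≤ 3 * ‖x‖ := by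
    rw [Fin.sum_univ_three]
    linarith [hxi 0, hxi 1, hxi 2]
  have hzi : ∀ i, -((X i : ℝ) * (z i).im) ≤ ‖x‖ * R := by
    intro i
    calc -((X i : ℝ) * (z i).im) ≤ |(X i : ℝ) * (z i).im| := neg_le_abs _
      _ = |(X i : ℝ)| * |(z i).im| := abs_mul _ _
      _ ≤ ‖x‖ * R := by
        refine mul_le_mul (hxi i) ?_ (abs_nonneg _) (norm_nonneg _)
        exact (Complex.abs_im_le_norm _).trans ((norm_le_pi_norm z i).trans hz)
  have hz2 : -∑ i, (X i : ℝ) * (z i).im ≤ 3 * (‖x‖ * R) := by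
    rw [Fin.sum_univ_three]
    linarith [hzi 0, hzi 1, hzi 2]
  have h2 : -α * ‖x‖ ^ 2 + β * ‖x‖ ≤ β ^ 2 / (4 * α) := by
    rw [le_div_iff₀ (by positivity)]
    nlinarith [sq_nonneg (2 * α * ‖x‖ - β)]
  have h3 : Real.pi / 4 * (c * ‖x‖ ^ 2) ≤
      Real.pi / 4 * ∑ i, ∑ j, (X i : ℝ) * (τ i j).im * X j :=
    mul_le_mul_of_nonneg_left h1 (by positivity)
  have h4 := mul_le_mul_of_nonneg_left hz2 Real.pi_pos.le
  simp only [hα, hβ] at h2 ⊢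
  linarith

lemma summable_norm_latticeTerm {τ : Matrix (Fin 3) (Fin 3) ℂ} (hτ : IsSiegel τ) (z : Fin 3 → ℂ) :
    Summable fun X => ‖latticeTerm τ z X‖ := by
  obtain ⟨K, hK⟩ := exists_norm_latticeTerm_le hτ ‖z‖
  refine Summable.of_nonneg_of_le (fun _ => norm_nonneg _) (fun X => ?_)
    (summable_exp_neg_sum_abs.mul_left |K|)
  refine (hK z le_rfl X).trans (mul_le_mul (le_abs_self K) ?_ (Real.exp_pos _).le (abs_nonneg _))
  apply Real.exp_le_exp.2
  have : 0 ≤ ∑ i, |(X i : ℝ)| := Finset.sum_nonneg fun _ _ => abs_nonneg _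
  linarith

/-- A theta series with weights `W` on the half-integral lattice. -/
noncomputable def weightedTheta (W : (Fin 3 → ℤ) → ℂ) (τ : Matrix (Fin 3) (Fin 3) ℂ)
    (z : Fin 3 → ℂ) : ℂ :=
  ∑' X, W X * latticeTerm τ z X

lemma summable_norm_weighted {τ : Matrix (Fin 3) (Fin 3) ℂ} (hτ : IsSiegel τ)
    {W : (Fin 3 → ℤ) → ℂ} (hW : ∀ X, ‖W X‖ ≤ 1) (z : Fin 3 → ℂ) :
    Summable fun X => ‖W X * latticeTerm τ z X‖ := by
  refine Summable.of_nonneg_of_le (fun _ => norm_nonneg _) (fun X => ?_)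
    (summable_norm_latticeTerm hτ z)
  rw [norm_mul]
  exact mul_le_of_le_one_left (norm_nonneg _) (hW X)

lemma differentiable_weightedTheta {τ : Matrix (Fin 3) (Fin 3) ℂ} (hτ : IsSiegel τ)
    {W : (Fin 3 → ℤ) → ℂ} (hW : ∀ X, ‖W X‖ ≤ 1) : Differentiable ℂ (weightedTheta W τ) := by
  intro z₀
  obtain ⟨K, hK⟩ := exists_norm_latticeTerm_le hτ (‖z₀‖ + 1)
  let D : (Fin 3 → ℤ) → (Fin 3 → ℂ) → (Fin 3 → ℂ) →L[ℂ] ℂ := fun X z =>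
    (W X * latticeTerm τ z X) • ((Real.pi : ℂ) * I) •
      ∑ i, (X i : ℂ) • ContinuousLinearMap.proj (R := ℂ) (φ := fun _ : Fin 3 => ℂ) i
  have hD : ∀ X z, HasFDerivAt (fun z => W X * latticeTerm τ z X) (D X z) z := by
    intro X z
    have h1 : HasFDerivAt (fun z : Fin 3 → ℂ => ∑ i, (X i : ℂ) * z i)
        (∑ i, (X i : ℂ) • ContinuousLinearMap.proj (R := ℂ) (φ := fun _ : Fin 3 => ℂ) i) z := by
      apply HasFDerivAt.fun_sum
      intro i _
      exact (ContinuousLinearMap.proj (R := ℂ) (φ := fun _ : Fin 3 => ℂ) i).hasFDerivAt.const_mul _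
    have h2 := (((h1.const_mul ((Real.pi : ℂ) * I)).const_add
      ((Real.pi : ℂ) * I / 4 * (∑ i, ∑ j, (X i : ℂ) * τ i j * X j))).cexp).const_mul (W X)
    refine h2.congr_fderiv ?_
    simp only [D, latticeTerm, smul_smul, mul_assoc]
  have hDn : ∀ X, ∀ z ∈ Metric.ball z₀ 1,
      ‖D X z‖ ≤ Real.pi * |K| * Real.exp (-∑ i, |(X i : ℝ)|) := by
    intro X z hz
    have hz' : ‖z‖ ≤ ‖z₀‖ + 1 := by
      have := norm_sub_norm_le z z₀
      rw [mem_ball_iff_norm] at hz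
      linarith
    have hS : ‖∑ i, (X i : ℂ) • ContinuousLinearMap.proj (R := ℂ) (φ := fun _ : Fin 3 => ℂ) i‖
        ≤ ∑ i, |(X i : ℝ)| := by
      refine (norm_sum_le _ _).trans (Finset.sum_le_sum fun i _ => ?_)
      rw [norm_smul]
      have hp : ‖ContinuousLinearMap.proj (R := ℂ) (φ := fun _ : Fin 3 => ℂ) i‖ ≤ 1 :=
        ContinuousLinearMap.opNorm_le_bound _ zero_le_one fun v => by
          simpa using norm_le_pi_norm v i
      simpa using mul_le_mul_of_nonneg_left hp (norm_nonneg (X i : ℂ))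
    have hs0 : 0 ≤ ∑ i, |(X i : ℝ)| := Finset.sum_nonneg fun _ _ => abs_nonneg _
    calc ‖D X z‖ = ‖W X‖ * ‖latticeTerm τ z X‖ * (Real.pi *
          ‖∑ i, (X i : ℂ) • ContinuousLinearMap.proj (R := ℂ) (φ := fun _ : Fin 3 => ℂ) i‖) := by
          simp only [D, norm_smul, norm_mul]
          simp [abs_of_pos Real.pi_pos]
      _ ≤ 1 * (|K| * Real.exp (-(2 * ∑ i, |(X i : ℝ)|))) *
          (Real.pi * Real.exp (∑ i, |(X i : ℝ)|)) := by
          gcongr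
          · exact hW X
          · exact (hK z hz' X).trans
              (mul_le_mul_of_nonneg_right (le_abs_self K) (Real.exp_pos _).le)
          · exact hS.trans (by linarith [Real.add_one_le_exp (∑ i, |(X i : ℝ)|)])
      _ = Real.pi * |K| * (Real.exp (-(2 * ∑ i, |(X i : ℝ)|)) * Real.exp (∑ i, |(X i : ℝ)|)) := by
          ring
      _ = _ := by
          rw [← Real.exp_add]
          congr 2
          ring
  have := hasFDerivAt_tsum_of_isPreconnected (f := fun X z => W X * latticeTerm τ z X)
    (f' := D) (s := Metric.ball z₀ 1)
    (summable_exp_neg_sum_abs.mul_left (Real.pi * |K|)) Metric.isOpen_ball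
    (convex_ball z₀ 1).isPreconnected (fun X z _ => hD X z) hDn (Metric.mem_ball_self one_pos)
    (summable_norm_weighted hτ hW z₀).of_norm (Metric.mem_ball_self one_pos)
  exact this.differentiableAt

/-- The sign in Riemann's formula, for one coordinate of the characteristics. -/
def coordSign (m n d e : Bool × Bool) : Bool :=
  (m.2 && n.1) ^^ (m.1 && n.2) ^^ ((m.1 ^^ n.1) && (d.2 || e.2)) ^^
    ((m.2 ^^ n.2) && ((d.2 && e.1) ^^ (d.1 && e.2)))

/-- Componentwise sum of characteristics in one coordinate. -/
def badd (m d : Bool × Bool) : Bool × Bool := (m.1 ^^ d.1, m.2 ^^ d.2)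

/-- `[x ≡ a mod 2] · i ^ (x b)` for a coordinate `c = (a, b)` of a characteristic. -/
noncomputable def coordWeight (c : Bool × Bool) (x : ℤ) : ℂ :=
  if x % 2 = c.1.toNat then (if c.2 then I ^ x else 1) else 0

/-- The exponent of `i` in a product of four coordinate weights, or `none` if the product is
zero. -/
def quadExp (c1 c2 c3 c4 : Bool × Bool) (x1 x2 x3 x4 : ℕ) : Option ℕ :=
  if x1 % 2 == c1.1.toNat && x2 % 2 == c2.1.toNat && x3 % 2 == c3.1.toNat && x4 % 2 == c4.1.toNat
  then some ((c1.2.toNat * x1 + c2.2.toNat * x2 + c3.2.toNat * x3 + c4.2.toNat * x4) % 4)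
  else none

/-- Real and imaginary part of `i ^ k`. -/
def gaussPow : Option ℕ → ℤ × ℤ
  | some 0 => (1, 0)
  | some 1 => (0, 1)
  | some 2 => (-1, 0)
  | some 3 => (0, -1)
  | _ => (0, 0)

def quadGauss (n d e : Bool × Bool) (x1 x2 x3 x4 : ℕ) : ℤ × ℤ :=
  gaussPow (quadExp n (badd n d) (badd n e) (badd (badd n d) e) x1 x2 x3 x4)

def boolSign (b : Bool) : ℤ := if b then -1 else 1

def coordTable (m d e : Bool × Bool) (x1 x2 x3 t : Fin 4) : Bool :=
  let x1 := x1.val; let x2 := x2.val; let x3 := x3.val; let t := t.val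
  let l := quadGauss m d e x1 x2 x3 (2 * t + 12 - x1 - x2 - x3)
  let g := fun n => quadGauss n d e t (x1 + x2 + 4 - t) (x1 + x3 + 4 - t) (t + 8 - x2 - x3)
  let f := fun n => boolSign (coordSign m n d e)
  let g0 := g (false, false); let g1 := g (false, true)
  let g2 := g (true, false); let g3 := g (true, true)
  (2 * l.1 == f (false, false) * g0.1 + f (false, true) * g1.1 + f (true, false) * g2.1
      + f (true, true) * g3.1) &&
  (2 * l.2 == f (false, false) * g0.2 + f (false, true) * g1.2 + f (true, false) * g2.2
      + f (true, true) * g3.2)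

set_option maxRecDepth 100000 in
lemma coordTable_all : ∀ m d e : Bool × Bool, ∀ x1 x2 x3 t : Fin 4,
    coordTable m d e x1 x2 x3 t = true := by
  decide +kernel

lemma I_zpow_emod (x : ℤ) (y : ℕ) (h : ((x - y : ℤ) : ℤ) % 4 = 0) : I ^ x = I ^ y := by
  obtain ⟨k, hk⟩ := Int.dvd_of_emod_eq_zero h
  have : x = y + 4 * k := by omega
  rw [this, zpow_add₀ I_ne_zero, _root_.zpow_mul]
  have : (I : ℂ) ^ (4 : ℤ) = 1 := by
    exact_mod_cast I_pow_four
  rw [this]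
  simp

lemma coordWeight_congr (c : Bool × Bool) {x : ℤ} {y : ℕ} (h : (x - y) % 4 = 0) :
    coordWeight c x = if y % 2 == c.1.toNat then I ^ (c.2.toNat * y) else 0 := by
  have h2 : (x % 2 = c.1.toNat) ↔ (y % 2 = c.1.toNat) := by omega
  rw [coordWeight, I_zpow_emod x y h]
  simp only [h2, beq_iff_eq]
  cases c.2 <;> simp

def gaussToComplex (p : ℤ × ℤ) : ℂ := p.1 + p.2 * I

lemma gaussPow_some (k : ℕ) : gaussToComplex (gaussPow (some (k % 4))) = I ^ k := by
  have h : I ^ k = I ^ (k % 4) := by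
    conv_lhs => rw [← Nat.div_add_mod k 4, pow_add, pow_mul, I_pow_four, one_pow, one_mul]
  rw [h]
  have : k % 4 < 4 := Nat.mod_lt _ (by norm_num)
  interval_cases k % 4 <;> simp [gaussPow, gaussToComplex, I_pow_three]

lemma coordWeight_prod (c1 c2 c3 c4 : Bool × Bool) {x1 x2 x3 x4 : ℤ} {y1 y2 y3 y4 : ℕ}
    (h1 : (x1 - y1) % 4 = 0) (h2 : (x2 - y2) % 4 = 0) (h3 : (x3 - y3) % 4 = 0)
    (h4 : (x4 - y4) % 4 = 0) :
    coordWeight c1 x1 * coordWeight c2 x2 * (coordWeight c3 x3 * coordWeight c4 x4)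
      = gaussToComplex (gaussPow (quadExp c1 c2 c3 c4 y1 y2 y3 y4)) := by
  rw [coordWeight_congr c1 h1, coordWeight_congr c2 h2, coordWeight_congr c3 h3,
    coordWeight_congr c4 h4, quadExp]
  have h0 : gaussToComplex (gaussPow none) = 0 := by simp [gaussPow, gaussToComplex]
  by_cases e1 : (y1 % 2 == c1.1.toNat) = true <;> by_cases e2 : (y2 % 2 == c2.1.toNat) = true <;>
    by_cases e3 : (y3 % 2 == c3.1.toNat) = true <;> by_cases e4 : (y4 % 2 == c4.1.toNat) = true <;>
    simp only [e1, e2, e3, e4, if_true, if_false, Bool.and_true, Bool.and_false, Bool.false_eq_true,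
      mul_zero, zero_mul, h0, gaussPow_some]
  ring

/-- The product of the weights of the characteristics `n, n + d, n + e, n + d + e`. -/
noncomputable def quadWeight (n d e : Bool × Bool) (x1 x2 x3 x4 : ℤ) : ℂ :=
  coordWeight n x1 * coordWeight (badd n d) x2 *
    (coordWeight (badd n e) x3 * coordWeight (badd (badd n d) e) x4)

lemma two_mul_quadWeight (m d e : Bool × Bool) (x1 x2 x3 x4 t : ℤ) (h : x1 + x2 + x3 + x4 = 2 * t) :
    2 * quadWeight m d e x1 x2 x3 x4 =
      ∑ n : Bool × Bool, (boolSign (coordSign m n d e) : ℂ) *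
        quadWeight n d e t (x1 + x2 - t) (x1 + x3 - t) (t - x2 - x3) := by
  have red : ∀ x : ℤ, ∃ y : Fin 4, (x - (y.val : ℕ)) % 4 = 0 := fun x =>
    ⟨⟨(x % 4).toNat, by omega⟩, by simp only; omega⟩
  obtain ⟨y1, h1⟩ := red x1
  obtain ⟨y2, h2⟩ := red x2
  obtain ⟨y3, h3⟩ := red x3
  obtain ⟨s, hs⟩ := red t
  have b1 := y1.isLt; have b2 := y2.isLt; have b3 := y3.isLt; have b4 := s.isLt
  have key := coordTable_all m d e y1 y2 y3 s
  have hl : quadWeight m d e x1 x2 x3 x4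
      = gaussToComplex (quadGauss m d e y1 y2 y3 (2 * s + 12 - y1 - y2 - y3)) :=
    coordWeight_prod _ _ _ _ h1 h2 h3 (by omega)
  have hr : ∀ n, quadWeight n d e t (x1 + x2 - t) (x1 + x3 - t) (t - x2 - x3)
      = gaussToComplex (quadGauss n d e s (y1 + y2 + 4 - s) (y1 + y3 + 4 - s) (s + 8 - y2 - y3)) :=
    fun n => coordWeight_prod _ _ _ _ hs (by omega) (by omega) (by omega)
  simp only [hl, hr]
  simp only [coordTable, Bool.and_eq_true, beq_iff_eq] at key
  obtain ⟨k1, k2⟩ := key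
  have k1' := congrArg (fun z : ℤ => (z : ℂ)) k1
  have k2' := congrArg (fun z : ℤ => (z : ℂ)) k2
  push_cast at k1' k2'
  simp only [Fintype.sum_prod_type, Fintype.sum_bool, gaussToComplex]
  linear_combination k1' + I * k2'

/-- The `i`-th coordinate `(m'ᵢ, m''ᵢ)` of the characteristic encoded by the bits of `k`. -/
def coordOf (k : ℕ) (i : Fin 3) : Bool × Bool := (k.testBit i, k.testBit (3 + i))

/-- The weight of a lattice point in the theta series with characteristic `k`. -/
noncomputable def charWeight (k : ℕ) (X : Fin 3 → ℤ) : ℂ := ∏ i, coordWeight (coordOf k i) (X i)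

/-- The theta function whose characteristic is encoded by the bits of `k`. -/
noncomputable def thetaN (τ : Matrix (Fin 3) (Fin 3) ℂ) (k : ℕ) : (Fin 3 → ℂ) → ℂ :=
  weightedTheta (charWeight k) τ

lemma norm_coordWeight_le (c : Bool × Bool) (x : ℤ) : ‖coordWeight c x‖ ≤ 1 := by
  rw [coordWeight]
  split_ifs <;> simp

lemma norm_charWeight_le (k : ℕ) (X : Fin 3 → ℤ) : ‖charWeight k X‖ ≤ 1 := by
  rw [charWeight, norm_prod]
  exact Finset.prod_le_one (fun _ _ => norm_nonneg _) fun _ _ => norm_coordWeight_le _ _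

lemma differentiable_thetaN {τ : Matrix (Fin 3) (Fin 3) ℂ} (hτ : IsSiegel τ) (k : ℕ) :
    Differentiable ℂ (thetaN τ k) :=
  differentiable_weightedTheta hτ (norm_charWeight_le k)

/-- Parity of a word of three bits. -/
def parity3 (w : ℕ) : Bool := (w ^^^ (w >>> 1) ^^^ (w >>> 2)).testBit 0

/-- The parity `m'·m''` of a characteristic. -/
def oddN (k : ℕ) : Bool := parity3 (k &&& (k >>> 3))

/-- The sign in Riemann's formula. -/
def riemannSign (m n d e : ℕ) : Bool :=
  parity3 (((m >>> 3) &&& n) ^^^ (m &&& (n >>> 3)) ^^^ ((m ^^^ n) &&& ((d >>> 3) ||| (e >>> 3))) ^^^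
    (((m ^^^ n) >>> 3) &&& (((d >>> 3) &&& e) ^^^ (d &&& (e >>> 3)))))

lemma boolSign_xor (a b : Bool) : boolSign (a ^^ b) = boolSign a * boolSign b := by
  cases a <;> cases b <;> rfl

lemma boolSign_parity3 (w : ℕ) : boolSign (parity3 w) = ∏ i : Fin 3, boolSign (w.testBit i) := by
  simp only [parity3, Nat.testBit_xor, Nat.testBit_shiftRight, boolSign_xor, Fin.prod_univ_three]
  rfl

lemma boolSign_riemannSign (m n d e : ℕ) :
    boolSign (riemannSign m n d e)
      = ∏ i, boolSign (coordSign (coordOf m i) (coordOf n i) (coordOf d i) (coordOf e i)) := by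
  rw [riemannSign, boolSign_parity3]
  refine Finset.prod_congr rfl fun i _ => ?_
  simp only [Nat.testBit_xor, Nat.testBit_and, Nat.testBit_or, Nat.testBit_shiftRight, coordSign,
    coordOf]

lemma coordOf_xor (m d : ℕ) (i : Fin 3) :
    coordOf (m ^^^ d) i = badd (coordOf m i) (coordOf d i) := by
  simp [coordOf, badd, Nat.testBit_xor]

/-- The bits of a characteristic, read off from its coordinates. -/
def encode (f : Fin 3 → Bool × Bool) : ℕ :=
  (f 0).1.toNat + 2 * (f 1).1.toNat + 4 * (f 2).1.toNat + 8 * (f 0).2.toNat + 16 * (f 1).2.toNat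
    + 32 * (f 2).2.toNat

lemma encode_coordOf : ∀ n < 64, encode (coordOf n) = n := by decide +kernel

lemma encode_lt (f : Fin 3 → Bool × Bool) : encode f < 64 := by
  have h := fun b : Bool => b.toNat_le
  have := h (f 0).1; have := h (f 1).1; have := h (f 2).1
  have := h (f 0).2; have := h (f 1).2; have := h (f 2).2
  unfold encode
  omega

lemma coordOf_encode (f : Fin 3 → Bool × Bool) : coordOf (encode f) = f := by
  have key : ∀ a b c a' b' c' : Bool, ∀ i : Fin 3,
      coordOf (a.toNat + 2 * b.toNat + 4 * c.toNat + 8 * a'.toNat + 16 * b'.toNat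
        + 32 * c'.toNat) i = ![(a, a'), (b, b'), (c, c')] i := by decide +kernel
  funext i
  refine (key _ _ _ _ _ _ i).trans ?_
  fin_cases i <;> rfl

lemma sum_range_coordOf (f : (Fin 3 → Bool × Bool) → ℂ) :
    ∑ n ∈ Finset.range 64, f (coordOf n) = ∑ c, f c := by
  refine Finset.sum_bij' (fun n _ => coordOf n) (fun c _ => encode c) (fun _ _ => Finset.mem_univ _)
    (fun c _ => Finset.mem_range.2 (encode_lt c))
    (fun n hn => encode_coordOf n (Finset.mem_range.1 hn))
    (fun c _ => coordOf_encode c) (fun _ _ => rfl)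

abbrev Quad := ((Fin 3 → ℤ) × (Fin 3 → ℤ)) × ((Fin 3 → ℤ) × (Fin 3 → ℤ))

noncomputable def charWeight4 (n d e : ℕ) (Y : Quad) : ℂ :=
  charWeight n Y.1.1 * charWeight (n ^^^ d) Y.1.2 *
    (charWeight (n ^^^ e) Y.2.1 * charWeight (n ^^^ d ^^^ e) Y.2.2)

noncomputable def latticeTerm4 (τ : Matrix (Fin 3) (Fin 3) ℂ) (u1 u2 u3 u4 : Fin 3 → ℂ)
    (Y : Quad) : ℂ :=
  latticeTerm τ u1 Y.1.1 * latticeTerm τ u2 Y.1.2 *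
    (latticeTerm τ u3 Y.2.1 * latticeTerm τ u4 Y.2.2)

lemma charWeight4_eq (n d e : ℕ) (Y : Quad) : charWeight4 n d e Y =
    ∏ i, quadWeight (coordOf n i) (coordOf d i) (coordOf e i)
      (Y.1.1 i) (Y.1.2 i) (Y.2.1 i) (Y.2.2 i) := by
  simp only [charWeight4, charWeight, quadWeight, coordOf_xor, Finset.prod_mul_distrib]

lemma hasSum_thetaN4 {τ : Matrix (Fin 3) (Fin 3) ℂ} (hτ : IsSiegel τ) (n d e : ℕ)
    (u1 u2 u3 u4 : Fin 3 → ℂ) :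
    HasSum (fun Y : Quad => charWeight4 n d e Y * latticeTerm4 τ u1 u2 u3 u4 Y)
      (thetaN τ n u1 * thetaN τ (n ^^^ d) u2 *
        (thetaN τ (n ^^^ e) u3 * thetaN τ (n ^^^ d ^^^ e) u4)) := by
  have S := fun k u => summable_norm_weighted hτ (norm_charWeight_le k) u
  have h12 := (S n u1).mul_norm (S (n ^^^ d) u2)
  have h34 := (S (n ^^^ e) u3).mul_norm (S (n ^^^ d ^^^ e) u4)
  have h := (h12.mul_norm h34).of_norm.hasSum
  have e12 := tsum_mul_tsum_of_summable_norm (S n u1) (S (n ^^^ d) u2)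
  have e34 := tsum_mul_tsum_of_summable_norm (S (n ^^^ e) u3) (S (n ^^^ d ^^^ e) u4)
  rw [← tsum_mul_tsum_of_summable_norm h12 h34, ← e12, ← e34] at h
  refine h.congr_fun fun Y => ?_
  simp only [charWeight4, latticeTerm4]
  ring

/-- The columns of a quadruple of lattice points have even sums. -/
def EvenColumns (Y : Quad) : Prop := ∀ i, (Y.1.1 i + Y.1.2 i + Y.2.1 i + Y.2.2 i) % 2 = 0

instance (Y : Quad) : Decidable (EvenColumns Y) := by unfold EvenColumns; infer_instance

/-- Half the Hadamard transform of a quadruple of lattice points. -/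
def halfHadamard (Y : Quad) : Quad :=
  let t : Fin 3 → ℤ := fun i => (Y.1.1 i + Y.1.2 i + Y.2.1 i + Y.2.2 i) / 2
  ((t, fun i => Y.1.1 i + Y.1.2 i - t i), (fun i => Y.1.1 i + Y.2.1 i - t i,
    fun i => t i - Y.1.2 i - Y.2.1 i))

def hadamardFlip (Y : Quad) : Quad := if EvenColumns Y then halfHadamard Y else Y

lemma evenColumns_halfHadamard {Y : Quad} (h : EvenColumns Y) : EvenColumns (halfHadamard Y) := by
  intro i
  have := h i
  simp only [halfHadamard]
  omega

lemma hadamardFlip_involutive : Function.Involutive hadamardFlip := by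
  intro Y
  by_cases h : EvenColumns Y
  · rw [hadamardFlip, hadamardFlip, if_pos h, if_pos (evenColumns_halfHadamard h)]
    refine Prod.ext (Prod.ext (funext fun i => ?_) (funext fun i => ?_))
      (Prod.ext (funext fun i => ?_) (funext fun i => ?_)) <;>
    · have := h i
      simp only [halfHadamard]
      omega
  · rw [hadamardFlip, hadamardFlip, if_neg h, if_neg h]

lemma quadWeight_eq_zero (n d e : Bool × Bool) {x1 x2 x3 x4 : ℤ} (h : (x1 + x2 + x3 + x4) % 2 ≠ 0) :
    quadWeight n d e x1 x2 x3 x4 = 0 := by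
  have key : ∀ (c : Bool × Bool) (x : ℤ), coordWeight c x ≠ 0 → x % 2 = c.1.toNat :=
    fun c x hc => by
      by_contra h'
      exact hc (if_neg h')
  by_contra hne
  obtain ⟨h12, h34⟩ := mul_ne_zero_iff.1 hne
  have h1 := key _ _ (left_ne_zero_of_mul h12)
  have h2 := key _ _ (right_ne_zero_of_mul h12)
  have h3 := key _ _ (left_ne_zero_of_mul h34)
  have h4 := key _ _ (right_ne_zero_of_mul h34)
  simp only [badd] at h1 h2 h3 h4
  revert h1 h2 h3 h4
  cases n.1 <;> cases d.1 <;> cases e.1 <;> simp <;> omega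

lemma sum_charWeight4_hadamardFlip (m d e : ℕ) (Y : Quad) :
    ∑ n ∈ Finset.range 64, (boolSign (riemannSign m n d e) : ℂ) * charWeight4 n d e (hadamardFlip Y)
      = 8 * charWeight4 m d e Y := by
  by_cases h : EvenColumns Y
  · rw [hadamardFlip, if_pos h]
    have hq : ∀ i, 2 * quadWeight (coordOf m i) (coordOf d i) (coordOf e i) (Y.1.1 i) (Y.1.2 i)
        (Y.2.1 i) (Y.2.2 i) = _ := fun i =>
      two_mul_quadWeight (coordOf m i) (coordOf d i) (coordOf e i) (Y.1.1 i) (Y.1.2 i)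
        (Y.2.1 i) (Y.2.2 i) ((halfHadamard Y).1.1 i)
        (by have := h i; simp only [halfHadamard]; omega)
    have h8 : (8 : ℂ) * charWeight4 m d e Y = ∏ i, 2 * quadWeight (coordOf m i) (coordOf d i)
        (coordOf e i)
      (Y.1.1 i) (Y.1.2 i) (Y.2.1 i) (Y.2.2 i) := by
      rw [charWeight4_eq, Finset.prod_mul_distrib]
      norm_num
    rw [h8, Finset.prod_congr rfl fun i _ => hq i, Finset.prod_univ_sum, Fintype.piFinset_univ,
      ← sum_range_coordOf]
    refine Finset.sum_congr rfl fun n _ => ?_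
    rw [charWeight4_eq, boolSign_riemannSign, Finset.prod_mul_distrib]
    push_cast
    rfl
  · rw [hadamardFlip, if_neg h]
    obtain ⟨i, hi⟩ := not_forall.1 h
    have : ∀ n, charWeight4 n d e Y = 0 := fun n => by
      rw [charWeight4_eq]
      exact Finset.prod_eq_zero (Finset.mem_univ i) (quadWeight_eq_zero _ _ _ hi)
    simp [this]

lemma latticeTerm4_halfHadamard (τ : Matrix (Fin 3) (Fin 3) ℂ) (hτ : τ.IsSymm)
    (u1 u2 u3 u4 : Fin 3 → ℂ)
    {Y : Quad} (h : EvenColumns Y) :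
    latticeTerm4 τ ((1 / 2 : ℂ) • (u1 + u2 + u3 + u4)) ((1 / 2 : ℂ) • (u1 + u2 - u3 - u4))
      ((1 / 2 : ℂ) • (u1 - u2 + u3 - u4)) ((1 / 2 : ℂ) • (u1 - u2 - u3 + u4)) (halfHadamard Y)
      = latticeTerm4 τ u1 u2 u3 u4 Y := by
  obtain ⟨⟨x1, x2⟩, ⟨x3, x4⟩⟩ := Y
  have ht : ∃ t : Fin 3 → ℤ, ∀ i, x1 i + x2 i + x3 i + x4 i = 2 * t i :=
    ⟨fun i => (x1 i + x2 i + x3 i + x4 i) / 2, fun i => by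
      have h' : (x1 i + x2 i + x3 i + x4 i) % 2 = 0 := h i
      show _ = 2 * ((x1 i + x2 i + x3 i + x4 i) / 2)
      omega⟩
  obtain ⟨t, ht⟩ := ht
  have e : halfHadamard ((x1, x2), (x3, x4)) = ((t, fun i => x1 i + x2 i - t i),
      (fun i => x1 i + x3 i - t i, fun i => t i - x2 i - x3 i)) := by
    have : ∀ i, (x1 i + x2 i + x3 i + x4 i) / 2 = t i := fun i => by
      rw [ht i]
      omega
    simp only [halfHadamard, this]
  have h4 : x4 = fun i => 2 * t i - x1 i - x2 i - x3 i := funext fun i => by linarith [ht i]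
  subst h4
  rw [e]
  simp only [latticeTerm4, latticeTerm, ← Complex.exp_add]
  congr 1
  simp only [Fin.sum_univ_three, Pi.smul_apply, Pi.add_apply, Pi.sub_apply, smul_eq_mul]
  have s1 := hτ.apply 0 1
  have s2 := hτ.apply 0 2
  have s3 := hτ.apply 1 2
  rw [s1, s2, s3]
  push_cast
  ring

/-- Riemann's theta formula. -/
theorem riemann_formula {τ : Matrix (Fin 3) (Fin 3) ℂ} (hτ : IsSiegel τ) (m d e : ℕ)
    (u1 u2 u3 u4 : Fin 3 → ℂ) :
    8 * (thetaN τ m u1 * thetaN τ (m ^^^ d) u2 *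
        (thetaN τ (m ^^^ e) u3 * thetaN τ (m ^^^ d ^^^ e) u4)) =
      ∑ n ∈ Finset.range 64, (boolSign (riemannSign m n d e) : ℂ) *
        (thetaN τ n ((1 / 2 : ℂ) • (u1 + u2 + u3 + u4)) *
          thetaN τ (n ^^^ d) ((1 / 2 : ℂ) • (u1 + u2 - u3 - u4)) *
          (thetaN τ (n ^^^ e) ((1 / 2 : ℂ) • (u1 - u2 + u3 - u4)) *
            thetaN τ (n ^^^ d ^^^ e) ((1 / 2 : ℂ) • (u1 - u2 - u3 + u4)))) := by
  have hl := (hasSum_thetaN4 hτ m d e u1 u2 u3 u4).mul_left 8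
  have hr := hasSum_sum fun n (_ : n ∈ Finset.range 64) =>
    (hasSum_thetaN4 hτ n d e ((1 / 2 : ℂ) • (u1 + u2 + u3 + u4)) ((1 / 2 : ℂ) • (u1 + u2 - u3 - u4))
      ((1 / 2 : ℂ) • (u1 - u2 + u3 - u4)) ((1 / 2 : ℂ) • (u1 - u2 - u3 + u4))).mul_left
        (boolSign (riemannSign m n d e) : ℂ)
  rw [← (Function.Involutive.toPerm _ hadamardFlip_involutive).hasSum_iff] at hr
  refine hl.unique (hr.congr_fun fun Y => ?_)
  simp only [Function.comp, Function.Involutive.coe_toPerm, ← mul_assoc, ← Finset.sum_mul]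
  rw [sum_charWeight4_hadamardFlip]
  by_cases h : EvenColumns Y
  · rw [hadamardFlip, if_pos h, latticeTerm4_halfHadamard τ hτ.1 u1 u2 u3 u4 h]
  · obtain ⟨i, hi⟩ := not_forall.1 h
    rw [charWeight4_eq, Finset.prod_eq_zero (Finset.mem_univ i) (quadWeight_eq_zero _ _ _ hi)]
    simp

lemma I_zpow_neg_eq (x : ℤ) : I ^ (-x) = (-1) ^ x * I ^ x := by
  rw [← mul_zpow, _root_.zpow_neg, ← _root_.inv_zpow]
  congr 1
  simp

lemma neg_one_zpow_of_emod {x : ℤ} {b : Bool} (h : x % 2 = b.toNat) :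
    (-1 : ℂ) ^ x = if b then -1 else 1 := by
  cases b
  · exact (Int.even_iff.2 (by simpa using h)).neg_one_zpow
  · exact (Int.odd_iff.2 (by simpa using h)).neg_one_zpow

lemma coordWeight_neg (c : Bool × Bool) (x : ℤ) :
    coordWeight c (-x) = (boolSign (c.1 && c.2) : ℂ) * coordWeight c x := by
  have h : (-x) % 2 = x % 2 := by omega
  rw [coordWeight, coordWeight, h, I_zpow_neg_eq]
  split_ifs with h1 h2
  · rw [neg_one_zpow_of_emod h1, h2, Bool.and_true]
    cases c.1 <;> simp [boolSign]
  · simp [h2, boolSign]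
  · simp

/-- The multiplier of the theta function with characteristic `k` for the lattice point `τ p + q`. -/
noncomputable def chi (k : ℕ) (p q : Fin 3 → ℤ) : ℂ :=
  ∏ i, (if (coordOf k i).1 then (-1) ^ q i else 1) * (if (coordOf k i).2 then (-1) ^ p i else 1)

lemma coordWeight_shift (c : Bool × Bool) (x p q : ℤ) :
    coordWeight c x * (-1) ^ (x * q) =
      ((if c.1 then (-1) ^ q else 1) * (if c.2 then (-1) ^ p else 1)) *
        coordWeight c (x + 2 * p) := by
  have h : (x + 2 * p) % 2 = x % 2 := by omega
  have h2 : I ^ (x + 2 * p) = I ^ x * (-1) ^ p := by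
    rw [zpow_add₀ I_ne_zero, _root_.zpow_mul]
    congr 2
    simp
  have h3 : ((-1 : ℂ) ^ p) * (-1) ^ p = 1 := by
    rw [← mul_zpow]
    simp
  rw [coordWeight, coordWeight, h, h2]
  by_cases h1 : x % 2 = c.1.toNat
  · rw [if_pos h1, if_pos h1, _root_.zpow_mul, neg_one_zpow_of_emod h1]
    cases c.1 <;> cases c.2 <;>
      simp only [if_true, if_false, _root_.one_zpow, Bool.false_eq_true, one_mul, mul_one]
    · linear_combination (-(I ^ x)) * h3
    · linear_combination (-(I ^ x * (-1) ^ q)) * h3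
  · rw [if_neg h1, if_neg h1, zero_mul, mul_zero]

lemma thetaN_neg (τ : Matrix (Fin 3) (Fin 3) ℂ) (k : ℕ) (z : Fin 3 → ℂ) :
    thetaN τ k (-z) = (boolSign (oddN k) : ℂ) * thetaN τ k z := by
  rw [thetaN, weightedTheta, weightedTheta, ← tsum_mul_left, ← (Equiv.neg (Fin 3 → ℤ)).tsum_eq]
  refine tsum_congr fun X => ?_
  have h1 : latticeTerm τ (-z) (-X) = latticeTerm τ z X := by
    simp [latticeTerm, Fin.sum_univ_three]
  have h2 : charWeight k (-X) = (boolSign (oddN k) : ℂ) * charWeight k X := by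
    rw [oddN, boolSign_parity3]
    simp only [charWeight, Pi.neg_apply, coordWeight_neg, Finset.prod_mul_distrib]
    push_cast
    simp only [Nat.testBit_and, Nat.testBit_shiftRight, coordOf]
  simp only [Equiv.neg_apply, h1, h2, mul_assoc]

/-- The lattice point `τ p + q`. -/
noncomputable def latticePoint (τ : Matrix (Fin 3) (Fin 3) ℂ) (p q : Fin 3 → ℤ) : Fin 3 → ℂ :=
  fun i => (∑ j, τ i j * p j) + q i

lemma thetaN_add_latticePoint {τ : Matrix (Fin 3) (Fin 3) ℂ} (hτ : τ.IsSymm) (k : ℕ)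
    (z : Fin 3 → ℂ) (p q : Fin 3 → ℤ) :
    thetaN τ k (z + latticePoint τ p q) =
      chi k p q * cexp (-((Real.pi : ℂ) * I * ∑ i, ∑ j, (p i : ℂ) * τ i j * p j)
        - 2 * (Real.pi : ℂ) * I * ∑ i, (p i : ℂ) * z i) * thetaN τ k z := by
  rw [thetaN, weightedTheta, weightedTheta, ← tsum_mul_left,
    ← (Equiv.addRight ((2 : ℤ) • p)).tsum_eq
      (fun X => _ * (charWeight k X * latticeTerm τ z X))]
  refine tsum_congr fun X => ?_
  have hE : ∏ i, (-1 : ℂ) ^ (X i * q i) = cexp ((Real.pi : ℂ) * I * ∑ i, (X i : ℂ) * q i) := by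
    rw [Finset.mul_sum, Complex.exp_sum]
    refine Finset.prod_congr rfl fun i _ => ?_
    rw [← Complex.exp_pi_mul_I, ← Complex.exp_int_mul]
    congr 1
    push_cast
    ring
  have hL : latticeTerm τ (z + latticePoint τ p q) X = (∏ i, (-1 : ℂ) ^ (X i * q i)) *
      (cexp (-((Real.pi : ℂ) * I * ∑ i, ∑ j, (p i : ℂ) * τ i j * p j)
        - 2 * (Real.pi : ℂ) * I * ∑ i, (p i : ℂ) * z i) * latticeTerm τ z (X + (2 : ℤ) • p)) := by
    rw [hE, latticeTerm, latticeTerm, ← Complex.exp_add, ← Complex.exp_add]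
    congr 1
    have s1 := hτ.apply 0 1
    have s2 := hτ.apply 0 2
    have s3 := hτ.apply 1 2
    simp only [Fin.sum_univ_three, Pi.add_apply, Pi.smul_apply, latticePoint, s1, s2, s3]
    simp only [smul_eq_mul]
    push_cast
    ring
  have hW : charWeight k X * ∏ i, (-1 : ℂ) ^ (X i * q i) =
      chi k p q * charWeight k (X + (2 : ℤ) • p) := by
    simp only [charWeight, chi, ← Finset.prod_mul_distrib]
    exact Finset.prod_congr rfl fun i _ => coordWeight_shift _ _ _ _
  rw [hL, ← mul_assoc, hW]
  simp only [Equiv.coe_addRight]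
  ring

/-- The mod-2 characteristic encoded by the bits of `k`. -/
def charOf (k : ℕ) : ThetaChar 3 :=
  (fun i => if (coordOf k i).1 then 1 else 0, fun i => if (coordOf k i).2 then 1 else 0)

lemma isEvenChar_charOf : ∀ k < 64, oddN k = false → IsEvenChar (charOf k) := by
  have : ∀ k < 64, oddN k = false → charParity (charOf k) = 1 := by decide +kernel
  exact this

lemma theta_charOf (τ : Matrix (Fin 3) (Fin 3) ℂ) (k : ℕ) (z : Fin 3 → ℂ) :
    theta (charLift (charOf k)) τ z = thetaN τ k z := by
  have hv : ∀ b : Bool, (((if b then 1 else 0 : ZMod 2).val : ℕ) : ℤ) = b.toNat := by decide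
  have hc : charLift (charOf k) = (fun i => ((coordOf k i).1.toNat : ℤ),
      fun i => ((coordOf k i).2.toNat : ℤ)) := by
    simp only [charLift, charOf, hv]
  rw [hc, theta, thetaN, weightedTheta]
  have hinj : Function.Injective fun (p : Fin 3 → ℤ) (i : Fin 3) =>
      2 * p i + (coordOf k i).1.toNat := by
    intro p p' h
    funext i
    have := congrFun h i
    simp only at this
    omega
  rw [← hinj.tsum_eq (f := fun X => charWeight k X * latticeTerm τ z X)]
  · refine tsum_congr fun p => ?_
    have hw : charWeight k (fun i => 2 * p i + (coordOf k i).1.toNat) =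
        cexp ((Real.pi : ℂ) * I / 2 * ∑ i, ((2 * p i + (coordOf k i).1.toNat : ℤ) : ℂ)
          * ((coordOf k i).2.toNat : ℤ)) := by
      rw [Finset.mul_sum, Complex.exp_sum, charWeight]
      refine Finset.prod_congr rfl fun i _ => ?_
      have : (2 * p i + ((coordOf k i).1.toNat : ℤ)) % 2 = ((coordOf k i).1.toNat : ℤ) := by
        have := (coordOf k i).1.toNat_le
        omega
      rw [coordWeight, if_pos this]
      cases (coordOf k i).2
      · simp
      · simp only [if_true, Bool.toNat_true, Nat.cast_one, Int.cast_one, mul_one]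
        generalize 2 * p i + ((coordOf k i).1.toNat : ℤ) = x
        rw [mul_comm, Complex.exp_int_mul, mul_div_right_comm, Complex.exp_pi_div_two_mul_I]
    rw [hw, thetaTerm, latticeTerm, ← Complex.exp_add]
    congr 1
    simp only [Fin.sum_univ_three]
    push_cast
    ring
  · intro X hX
    have hne : charWeight k X ≠ 0 := left_ne_zero_of_mul hX
    refine ⟨fun i => X i / 2, funext fun i => ?_⟩
    have hi : coordWeight (coordOf k i) (X i) ≠ 0 :=
      Finset.prod_ne_zero_iff.1 hne i (Finset.mem_univ i)
    have : X i % 2 = (coordOf k i).1.toNat := by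
      by_contra h'
      exact hi (if_neg h')
    simp only
    omega

/-- The product of the values of `c` on the coset of `m` under the group generated by `d`, `e`. -/
def quad (c : ℕ → ℂ) (d e m : ℕ) : ℂ := c m * c (m ^^^ d) * (c (m ^^^ e) * c (m ^^^ d ^^^ e))

/-- The sum of the values of `g` on the coset of `m` under the group generated by `d`, `e`. -/
def cosetSum {M : Type*} [Add M] (g : ℕ → M) (d e m : ℕ) : M :=
  g m + g (m ^^^ d) + (g (m ^^^ e) + g (m ^^^ d ^^^ e))

/-- The sum of the entries of a list of weighted indices which sit at `n`. -/
def pointSum (l : List (ℕ × ℤ)) (n : ℕ) : ℤ := (l.map fun t => if t.1 = n then t.2 else 0).sum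

/-- The coefficient of the `n`-th variable in a combination of rows of Riemann's formula. -/
def rowSum (rows : List (ℕ × ℤ)) (d e n : ℕ) : ℤ :=
  (rows.map fun r => r.2 * boolSign (riemannSign r.1 n d e)).sum

/-- Does the combination `rows` of Riemann relations give the relation `terms`? -/
def isConsequence (K : ℤ) (d e : ℕ) (good : ℕ → Bool) (rows terms : List (ℕ × ℤ)) : Bool :=
  (List.range 64).all fun n => !good n ||
    cosetSum (fun n => rowSum rows d e n - K * pointSum rows n - pointSum terms n) d e n == 0

lemma xor_lt_64 {m n : ℕ} (hm : m < 64) (hn : n < 64) : m ^^^ n < 64 :=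
  Nat.xor_lt_two_pow (n := 6) hm hn

lemma sum_range_xor {M : Type*} [AddCommMonoid M] (f : ℕ → M) {d : ℕ} (hd : d < 64) :
    ∑ n ∈ Finset.range 64, f (n ^^^ d) = ∑ n ∈ Finset.range 64, f n := by
  refine Finset.sum_bij' (fun n _ => n ^^^ d) (fun n _ => n ^^^ d) ?_ ?_ ?_ ?_ ?_ <;>
    simp only [Finset.mem_range, Nat.xor_assoc, Nat.xor_self, Nat.xor_zero, implies_true]
  all_goals exact fun n hn => xor_lt_64 hn hd

lemma sum_pointSum (l : List (ℕ × ℤ)) (hl : ∀ t ∈ l, t.1 < 64) (Z : ℕ → ℂ) :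
    ∑ n ∈ Finset.range 64, (pointSum l n : ℂ) * Z n = (l.map fun t => (t.2 : ℂ) * Z t.1).sum := by
  induction l with
  | nil => simp [pointSum]
  | cons t l ih =>
    have ht : t.1 < 64 := hl t (by simp)
    rw [List.map_cons, List.sum_cons, ← ih fun s hs => hl s (by simp [hs])]
    simp only [pointSum, List.map_cons, List.sum_cons, Int.cast_add, add_mul,
      Finset.sum_add_distrib]
    congr 1
    simp [Finset.sum_ite_eq, ht]

lemma sum_rowSum {K : ℤ} {d e : ℕ} {Z : ℕ → ℂ} (rows : List (ℕ × ℤ))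
    (h : ∀ r ∈ rows, (K : ℂ) * Z r.1
      = ∑ n ∈ Finset.range 64, (boolSign (riemannSign r.1 n d e) : ℂ) * Z n) :
    ∑ n ∈ Finset.range 64, (rowSum rows d e n : ℂ) * Z n
      = K * (rows.map fun t => (t.2 : ℂ) * Z t.1).sum := by
  induction rows with
  | nil => simp [rowSum]
  | cons t l ih =>
    rw [List.map_cons, List.sum_cons, mul_add, ← ih fun s hs => h s (by simp [hs])]
    simp only [rowSum, List.map_cons, List.sum_cons, Int.cast_add, add_mul,
      Finset.sum_add_distrib]
    congr 1
    rw [mul_left_comm, h t (by simp), Finset.mul_sum]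
    exact Finset.sum_congr rfl fun n _ => by push_cast; ring

/-- A checked combination of rows of Riemann's formula yields a linear relation. -/
lemma relation_of_isConsequence {K : ℤ} {d e : ℕ} (hd : d < 64) (he : e < 64) {Z : ℕ → ℂ}
    (hZd : ∀ n < 64, Z (n ^^^ d) = Z n) (hZe : ∀ n < 64, Z (n ^^^ e) = Z n) {good : ℕ → Bool}
    (hgood : ∀ n < 64, good n = false → Z n = 0) (rows terms : List (ℕ × ℤ))
    (hrows : ∀ r ∈ rows, r.1 < 64 ∧ (K : ℂ) * Z r.1
      = ∑ n ∈ Finset.range 64, (boolSign (riemannSign r.1 n d e) : ℂ) * Z n)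
    (hterms : ∀ r ∈ terms, r.1 < 64)
    (hcheck : isConsequence K d e good rows terms = true) :
    (terms.map fun t => (t.2 : ℂ) * Z t.1).sum = 0 := by
  set g : ℕ → ℤ := fun n => rowSum rows d e n - K * pointSum rows n - pointSum terms n with hg
  have h1 : ∑ n ∈ Finset.range 64, (g n : ℂ) * Z n
      = -(terms.map fun t => (t.2 : ℂ) * Z t.1).sum := by
    have : ∀ n, (g n : ℂ) * Z n = (rowSum rows d e n : ℂ) * Z n
        - K * ((pointSum rows n : ℂ) * Z n) - (pointSum terms n : ℂ) * Z n := fun n => by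
      rw [hg]; push_cast; ring
    simp only [this, Finset.sum_sub_distrib, ← Finset.mul_sum]
    rw [sum_rowSum rows fun r hr => (hrows r hr).2, sum_pointSum rows fun r hr => (hrows r hr).1,
      sum_pointSum terms hterms]
    ring
  have hshift : ∀ a < 64, (∀ n < 64, Z (n ^^^ a) = Z n) →
      ∑ n ∈ Finset.range 64, (g (n ^^^ a) : ℂ) * Z n = ∑ n ∈ Finset.range 64, (g n : ℂ) * Z n := by
    intro a ha hZa
    rw [← sum_range_xor (fun n => (g n : ℂ) * Z n) ha]
    exact Finset.sum_congr rfl fun n hn => by rw [hZa n (Finset.mem_range.1 hn)]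
  have h2 : ∑ n ∈ Finset.range 64, ((cosetSum g d e n : ℤ) : ℂ) * Z n
      = 4 * ∑ n ∈ Finset.range 64, (g n : ℂ) * Z n := by
    simp only [cosetSum, Int.cast_add, add_mul, Finset.sum_add_distrib]
    simp only [Nat.xor_assoc]
    rw [hshift d hd hZd, hshift e he hZe, hshift (d ^^^ e) (xor_lt_64 hd he) fun n hn => by
      rw [← Nat.xor_assoc, hZe _ (xor_lt_64 hn hd), hZd n hn]]
    ring
  have h3 : ∑ n ∈ Finset.range 64, ((cosetSum g d e n : ℤ) : ℂ) * Z n = 0 := by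
    refine Finset.sum_eq_zero fun n hn => ?_
    have hn' := Finset.mem_range.1 hn
    have := List.all_eq_true.1 hcheck n (List.mem_range.2 hn')
    cases hgn : good n with
    | false => rw [hgood n hn' hgn, mul_zero]
    | true =>
      rw [hgn, Bool.not_true, Bool.false_or, beq_iff_eq] at this
      rw [hg, this, Int.cast_zero, zero_mul]
  rw [h3, h1] at h2
  have h4 : (4 : ℂ) * (terms.map fun t => (t.2 : ℂ) * Z t.1).sum = 0 := by linear_combination h2
  simpa using h4

/-- Constants with the vanishing behaviour and the quartic relations of theta constants. -/
structure ConstSystem (c : ℕ → ℂ) : Prop where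
  odd : ∀ k < 64, oddN k = true → c k = 0
  even : ∀ k < 64, oddN k = false → c k ≠ 0
  rel : ∀ m < 64, ∀ d < 64, ∀ e < 64, 8 * quad c d e m
    = ∑ n ∈ Finset.range 64, (boolSign (riemannSign m n d e) : ℂ) * quad c d e n

lemma quad_xor_left (c : ℕ → ℂ) (d e m : ℕ) : quad c d e (m ^^^ d) = quad c d e m := by
  have h1 : m ^^^ d ^^^ d = m := by rw [Nat.xor_assoc, Nat.xor_self, Nat.xor_zero]
  have h2 : m ^^^ d ^^^ d ^^^ e = m ^^^ e := by rw [h1]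
  rw [quad, quad, h2, h1]
  ring

lemma quad_comm (c : ℕ → ℂ) (d e m : ℕ) : quad c d e m = quad c e d m := by
  rw [quad, quad, Nat.xor_right_comm]; ring

lemma quad_xor_right (c : ℕ → ℂ) (d e m : ℕ) : quad c d e (m ^^^ e) = quad c d e m := by
  rw [quad_comm, quad_xor_left, quad_comm]

/-- All four members of the coset of `n` are even. -/
def evenCoset (d e n : ℕ) : Bool :=
  !oddN n && !oddN (n ^^^ d) && !oddN (n ^^^ e) && !oddN (n ^^^ d ^^^ e)

lemma ConstSystem.quad_eq_zero {c : ℕ → ℂ} (hc : ConstSystem c) {d e n : ℕ} (hd : d < 64)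
    (he : e < 64) (hn : n < 64) (h : evenCoset d e n = false) : quad c d e n = 0 := by
  have hnd := xor_lt_64 hn hd
  simp only [evenCoset, Bool.and_eq_false_iff, Bool.not_eq_false'] at h
  rw [quad]
  rcases h with ((h | h) | h) | h
  · simp [hc.odd _ hn h]
  · simp [hc.odd _ hnd h]
  · simp [hc.odd _ (xor_lt_64 hn he) h]
  · simp [hc.odd _ (xor_lt_64 hnd he) h]

lemma ConstSystem.quad_ne_zero {c : ℕ → ℂ} (hc : ConstSystem c) {d e n : ℕ} (hd : d < 64)
    (he : e < 64) (hn : n < 64) (h : evenCoset d e n = true) : quad c d e n ≠ 0 := by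
  have hnd := xor_lt_64 hn hd
  simp only [evenCoset, Bool.and_eq_true, Bool.not_eq_true'] at h
  obtain ⟨⟨⟨h1, h2⟩, h3⟩, h4⟩ := h
  exact mul_ne_zero (mul_ne_zero (hc.even _ hn h1) (hc.even _ hnd h2))
    (mul_ne_zero (hc.even _ (xor_lt_64 hn he) h3) (hc.even _ (xor_lt_64 hnd he) h4))

lemma ConstSystem.relation {c : ℕ → ℂ} (hc : ConstSystem c) {d e : ℕ} (hd : d < 64) (he : e < 64)
    (rows terms : List (ℕ × ℤ)) (hrows : ∀ r ∈ rows, r.1 < 64) (hterms : ∀ r ∈ terms, r.1 < 64)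
    (hcheck : isConsequence 8 d e (evenCoset d e) rows terms = true) :
    (terms.map fun t => (t.2 : ℂ) * quad c d e t.1).sum = 0 :=
  relation_of_isConsequence hd he (fun n _ => quad_xor_left c d e n)
    (fun n _ => quad_xor_right c d e n) (fun _ hn h => hc.quad_eq_zero hd he hn h) rows terms
    (fun r hr => ⟨hrows r hr, by exact_mod_cast hc.rel r.1 (hrows r hr) d hd e he⟩) hterms hcheck

/-- Multipliers which preserve Riemann's quartic relations. -/
structure QuarticInvariant (δ : ℕ → ℂ) : Prop where
  ne_zero : ∀ m, δ m ≠ 0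
  quad_eq : ∀ d e m, quad δ d e m = quad δ d e 0

lemma quad_mul (c c' : ℕ → ℂ) (d e m : ℕ) :
    quad (fun m => c m * c' m) d e m = quad c d e m * quad c' d e m := by
  simp only [quad]; ring

lemma QuarticInvariant.mul {δ δ' : ℕ → ℂ} (h : QuarticInvariant δ) (h' : QuarticInvariant δ') :
    QuarticInvariant fun m => δ m * δ' m :=
  ⟨fun m => mul_ne_zero (h.ne_zero m) (h'.ne_zero m), fun d e m => by
    rw [quad_mul, quad_mul, h.quad_eq, h'.quad_eq]⟩

lemma quarticInvariant_const {κ : ℂ} (hκ : κ ≠ 0) : QuarticInvariant fun _ => κ :=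
  ⟨fun _ => hκ, fun _ _ _ => rfl⟩

lemma QuarticInvariant.inv {δ : ℕ → ℂ} (h : QuarticInvariant δ) :
    QuarticInvariant fun m => (δ m)⁻¹ := by
  refine ⟨fun m => inv_ne_zero (h.ne_zero m), fun d e m => ?_⟩
  have : ∀ m, quad (fun m => (δ m)⁻¹) d e m = (quad δ d e m)⁻¹ := fun m => by
    simp only [quad, mul_inv]
  rw [this, this, h.quad_eq]

lemma ConstSystem.mul {c δ : ℕ → ℂ} (hc : ConstSystem c) (h : QuarticInvariant δ) :
    ConstSystem fun m => δ m * c m where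
  odd k hk ho := by rw [hc.odd k hk ho, mul_zero]
  even k hk he := mul_ne_zero (h.ne_zero k) (hc.even k hk he)
  rel m hm d hd e he := by
    simp only [quad_mul]
    rw [h.quad_eq, mul_left_comm, hc.rel m hm d hd e he, Finset.mul_sum]
    exact Finset.sum_congr rfl fun n _ => by rw [h.quad_eq d e n]; ring

/-- A fourth root of unity raised to a bit of the characteristic. -/
lemma quarticInvariant_bit {t : ℂ} (ht : t ^ 4 = 1) (i : ℕ) :
    QuarticInvariant fun m => if m.testBit i then t else 1 := by
  have h0 : t ≠ 0 := by rintro rfl; norm_num at ht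
  refine ⟨fun m => ?_, fun d e m => ?_⟩
  · split_ifs <;> simp [h0]
  · simp only [quad, Nat.testBit_xor, Nat.zero_testBit, Bool.false_xor]
    cases m.testBit i <;> cases d.testBit i <;> cases e.testBit i <;> simp <;>
      linear_combination ht

/-- A sign raised to a product of two bits of the characteristic. -/
lemma quarticInvariant_pair {t : ℂ} (ht : t ^ 2 = 1) (i j : ℕ) :
    QuarticInvariant fun m => if m.testBit i && m.testBit j then t else 1 := by
  have h0 : t ≠ 0 := by rintro rfl; norm_num at ht
  refine ⟨fun m => ?_, fun d e m => ?_⟩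
  · split_ifs <;> simp [h0]
  · simp only [quad, Nat.testBit_xor, Nat.zero_testBit, Bool.false_xor]
    cases m.testBit i <;> cases d.testBit i <;> cases e.testBit i <;>
    cases m.testBit j <;> cases d.testBit j <;> cases e.testBit j <;> simp <;>
      first | linear_combination ht | linear_combination -ht | linear_combination (t ^ 2 + 1) * ht

/-- The set of indices occurring an odd number of times in a list, as a bit mask. -/
def bitsum (L : List ℕ) : ℕ := L.foldr (fun m x => 2 ^ m ^^^ x) 0

/-- The sum of the values of `h` over the bits of a mask. -/
def maskSum (h : ℕ → ZMod 2) (x : ℕ) : ZMod 2 :=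
  ∑ i ∈ Finset.range 64, if x.testBit i then h i else 0

lemma maskSum_xor (h : ℕ → ZMod 2) (x y : ℕ) : maskSum h (x ^^^ y) = maskSum h x + maskSum h y := by
  rw [maskSum, maskSum, maskSum, ← Finset.sum_add_distrib]
  refine Finset.sum_congr rfl fun i _ => ?_
  rw [Nat.testBit_xor]
  cases x.testBit i <;> cases y.testBit i <;> simp [CharTwo.add_self_eq_zero]

lemma maskSum_bitsum {h : ℕ → ZMod 2} (h64 : ∀ m, 64 ≤ m → h m = 0) (L : List ℕ) :
    maskSum h (bitsum L) = (L.map h).sum := by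
  induction L with
  | nil => simp [bitsum, maskSum]
  | cons m L ih =>
    have : maskSum h (2 ^ m) = h m := by
      simp only [maskSum, Nat.testBit_two_pow, decide_eq_true_eq, Finset.sum_ite_eq,
        Finset.mem_range]
      split_ifs with hm
      · rfl
      · exact (h64 m (not_lt.1 hm)).symm
    rw [List.map_cons, List.sum_cons, ← ih, ← this, ← maskSum_xor]
    rfl

/-- Addition of equations over the field with two elements. -/
lemma sum_eq_of_bitsum {h : ℕ → ZMod 2} {mask : ℕ} (hmask : mask < 2 ^ 64)
    (h0 : ∀ m, mask.testBit m = false → h m = 0) (eqs : List (List ℕ × ℕ)) (target : List ℕ)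
    (heqs : ∀ q ∈ eqs, (q.1.map h).sum = (q.2 : ZMod 2))
    (hbits : bitsum (eqs.flatMap Prod.fst ++ target) &&& mask = 0) :
    (target.map h).sum = ((eqs.map Prod.snd).sum : ℕ) := by
  have h64 : ∀ m, 64 ≤ m → h m = 0 := fun m hm => h0 m <|
    Nat.testBit_lt_two_pow (hmask.trans_le (Nat.pow_le_pow_right (by norm_num) hm))
  have h1 : ((eqs.flatMap Prod.fst ++ target).map h).sum = 0 := by
    rw [← maskSum_bitsum h64, maskSum]
    refine Finset.sum_eq_zero fun i _ => ?_
    have := congrArg (fun x => x.testBit i) hbits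
    simp only [Nat.testBit_and, Nat.zero_testBit, Bool.and_eq_false_iff] at this
    rcases this with this | this
    · simp [this]
    · simp [h0 i this]
  have h2 : ((eqs.flatMap Prod.fst).map h).sum = ((eqs.map Prod.snd).sum : ℕ) := by
    clear h1 hbits
    induction eqs with
    | nil => simp
    | cons q l ih =>
      rw [List.flatMap_cons, List.map_append, List.sum_append, heqs q (by simp),
        ih fun r hr => heqs r (by simp [hr])]
      simp
  rw [List.map_append, List.sum_append, h2] at h1
  rw [← sub_eq_zero, CharTwo.sub_eq_add, add_comm]
  exact h1

/-- The members of a coset. -/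
def cosetList (d e m : ℕ) : List ℕ := [m, m ^^^ d, m ^^^ e, m ^^^ d ^^^ e]

lemma quad_I_pow_mul (a : ℕ → ℕ) (c : ℕ → ℂ) (d e m : ℕ) :
    quad (fun m => I ^ a m * c m) d e m = I ^ ((cosetList d e m).map a).sum * quad c d e m := by
  simp only [quad, cosetList, List.map_cons, List.map_nil, List.sum_cons, List.sum_nil, pow_add,
    pow_zero]
  ring

lemma I_pow_eq_or {a b : ℕ} (h : a % 2 = b % 2) :
    (a % 4 = b % 4 ∧ I ^ a = I ^ b) ∨ ((a + 2) % 4 = b % 4 ∧ I ^ b = -I ^ a) := by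
  rcases (by omega : a % 4 = b % 4 ∨ (a + 2) % 4 = b % 4) with h | h
  · exact Or.inl ⟨h, by rw [I_pow_eq_pow_mod a, h, ← I_pow_eq_pow_mod]⟩
  · refine Or.inr ⟨h, ?_⟩
    rw [I_pow_eq_pow_mod b, ← h, ← I_pow_eq_pow_mod, pow_add]
    simp

lemma norm_eq_sqrt_two_mul {x y z u v : ℂ} (hu : u ≠ 0) (hv : v = I * u ∨ v = -(I * u))
    (h0 : x + y + z = 0) (h1 : u * x - u * y + v * z = 0) : ‖z‖ = √2 * ‖x‖ := by
  have key : ∀ s : ℂ, ‖1 + s‖ = √2 → ‖s‖ = 1 → x - y + s * z = 0 → ‖z‖ = √2 * ‖x‖ := by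
    intro s hs hs1 h
    have h2 : ‖(1 + s) * z‖ = ‖2 * x‖ := by
      rw [← norm_neg]; congr 1; linear_combination -h0 - h
    rw [norm_mul, norm_mul, hs] at h2
    have h3 : √2 * √2 = 2 := Real.mul_self_sqrt (by norm_num)
    norm_num at h2
    nlinarith [Real.sqrt_nonneg 2, norm_nonneg x, norm_nonneg z]
  rcases hv with rfl | rfl
  · refine key I ?_ (by simp) (mul_left_cancel₀ hu (by linear_combination h1))
    rw [Complex.norm_def, normSq_apply]; norm_num
  · refine key (-I) ?_ (by simp) (mul_left_cancel₀ hu (by linear_combination h1))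
    rw [Complex.norm_def, normSq_apply]; norm_num

lemma three_term {x y z : ℂ} (hx : x ≠ 0) (hy : y ≠ 0) (hz : z ≠ 0) (h0 : x + y + z = 0)
    {a b c : ℕ} (h1 : I ^ a * x + I ^ b * y + I ^ c * z = 0) (hab : a % 2 = b % 2) :
    (a + 2 * if a % 2 = c % 2 then 0 else 1) % 4 = b % 4 ∧
      (a % 2 ≠ c % 2 → ‖z‖ = √2 * ‖x‖) := by
  have hI : ∀ n : ℕ, I ^ n ≠ 0 := fun n => pow_ne_zero n I_ne_zero
  rcases I_pow_eq_or hab with ⟨h, hI1⟩ | ⟨h, hI1⟩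
  · have hc : I ^ c = I ^ a := by
      have : (I ^ c - I ^ a) * z = 0 := by
        rw [← hI1] at h1; linear_combination h1 - I ^ a * h0
      simpa [hz, sub_eq_zero] using this
    have : a % 2 = c % 2 := by
      by_contra hne
      rcases I_pow_eq_or (show c % 2 = (a + 1) % 2 by omega) with ⟨_, h'⟩ | ⟨_, h'⟩ <;>
      · rw [hc, pow_succ] at h'
        have h'' := congrArg (fun w => w / I ^ a) h'
        simp [hI a] at h''
        have := congrArg Complex.re h''
        norm_num at this
    simp [this, ← h]
  · rw [hI1] at h1
    by_cases hac : a % 2 = c % 2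
    · exfalso
      rcases I_pow_eq_or hac with ⟨_, hc⟩ | ⟨_, hc⟩
      · apply hy
        have : I ^ a * (2 * y) = 0 := by rw [← hc] at h1; linear_combination I ^ a * h0 - h1
        simpa [hI a] using this
      · apply hx
        have : I ^ a * (2 * x) = 0 := by rw [hc] at h1; linear_combination I ^ a * h0 + h1
        simpa [hI a] using this
    · simp only [hac, if_false, not_false_eq_true, ne_eq, forall_const]
      refine ⟨h, norm_eq_sqrt_two_mul (hI a) ?_ h0 (v := I ^ c) (by linear_combination h1)⟩
      rcases I_pow_eq_or (show (a + 1) % 2 = c % 2 by omega) with ⟨_, h'⟩ | ⟨_, h'⟩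
      · left; rw [← h']; ring
      · right; rw [h']; ring

/-- A relation between three cosets: the plane spanned by `d`, `e` and representatives. -/
structure TriRel where
  d : ℕ
  e : ℕ
  rep : ℕ → ℕ

/-- The coefficients of the relation given by the first coset. -/
def TriRel.coef (r : TriRel) (i : ℕ) : ℤ :=
  cosetSum (fun n => boolSign (riemannSign (r.rep 0) n r.d r.e)) r.d r.e (r.rep i)
    - if i = 0 then 8 else 0

/-- Validity of a three term relation. -/
def TriRel.valid (r : TriRel) : Bool :=
  r.d < 64 && r.e < 64 &&
  ((List.range 3).all fun i => r.rep i < 64 && evenCoset r.d r.e (r.rep i) && r.coef i ^ 2 == 16) &&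
  isConsequence 8 r.d r.e (evenCoset r.d r.e) [(r.rep 0, 1)]
    [(r.rep 0, r.coef 0), (r.rep 1, r.coef 1), (r.rep 2, r.coef 2)]

/-- The coset with index `i` of a relation. -/
def TriRel.coset (r : TriRel) (i : ℕ) : List ℕ := cosetList r.d r.e (r.rep i)

lemma TriRel.valid_iff {r : TriRel} (h : r.valid = true) : r.d < 64 ∧ r.e < 64 ∧
    (∀ i < 3, r.rep i < 64 ∧ evenCoset r.d r.e (r.rep i) = true ∧ r.coef i ^ 2 = 16) ∧
    isConsequence 8 r.d r.e (evenCoset r.d r.e) [(r.rep 0, 1)]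
      [(r.rep 0, r.coef 0), (r.rep 1, r.coef 1), (r.rep 2, r.coef 2)] = true := by
  simp only [valid, Bool.and_eq_true, List.all_eq_true, List.mem_range, decide_eq_true_eq,
    beq_iff_eq, and_assoc] at h
  exact h

lemma TriRel.relation {r : TriRel} (hr : r.valid = true) {c : ℕ → ℂ} (hc : ConstSystem c) :
    (r.coef 0 : ℂ) * quad c r.d r.e (r.rep 0) + r.coef 1 * quad c r.d r.e (r.rep 1)
      + r.coef 2 * quad c r.d r.e (r.rep 2) = 0 := by
  obtain ⟨hd, he, h3, hchk⟩ := TriRel.valid_iff hr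
  have := hc.relation hd he _ _ (by simpa using (h3 0 (by norm_num)).1)
    (by simpa using ⟨(h3 0 (by norm_num)).1, (h3 1 (by norm_num)).1, (h3 2 (by norm_num)).1⟩) hchk
  simpa [add_assoc] using this

lemma TriRel.relation_of_ne {r : TriRel} (hr : r.valid = true) {c : ℕ → ℂ} (hc : ConstSystem c)
    {i j k : ℕ} (hi : i < 3) (hj : j < 3) (hk : k < 3) (hij : i ≠ j) (hik : i ≠ k) (hjk : j ≠ k) :
    (r.coef i : ℂ) * quad c r.d r.e (r.rep i) + r.coef j * quad c r.d r.e (r.rep j)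
      + r.coef k * quad c r.d r.e (r.rep k) = 0 := by
  have := TriRel.relation hr hc
  interval_cases i <;> interval_cases j <;> interval_cases k <;>
    first | omega | linear_combination this

/-- `c` and its twist by powers of `I` both satisfy the relations. -/
structure Twist (c : ℕ → ℂ) (a : ℕ → ℕ) : Prop where
  base : ConstSystem c
  twist : ConstSystem fun m => I ^ a m * c m

lemma Twist.three_term {c : ℕ → ℂ} {a : ℕ → ℕ} (h : Twist c a) {r : TriRel} (hr : r.valid = true)
    {i j k : ℕ} (hi : i < 3) (hj : j < 3) (hk : k < 3) (hij : i ≠ j) (hik : i ≠ k) (hjk : j ≠ k)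
    (hpar : ((r.coset i).map a).sum % 2 = ((r.coset j).map a).sum % 2) :
    (((r.coset i).map a).sum +
        2 * if ((r.coset i).map a).sum % 2 = ((r.coset k).map a).sum % 2 then 0 else 1) % 4
      = ((r.coset j).map a).sum % 4 ∧
    (((r.coset i).map a).sum % 2 ≠ ((r.coset k).map a).sum % 2 →
      ‖quad c r.d r.e (r.rep k)‖ = √2 * ‖quad c r.d r.e (r.rep i)‖) := by
  obtain ⟨hd, he, h3, -⟩ := TriRel.valid_iff hr
  have hcoef : ∀ l < 3, (r.coef l : ℂ) ≠ 0 := fun l hl => by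
    have := (h3 l hl).2.2
    intro h0
    rw [Int.cast_eq_zero] at h0
    rw [h0] at this
    norm_num at this
  have hne : ∀ l < 3, (r.coef l : ℂ) * quad c r.d r.e (r.rep l) ≠ 0 := fun l hl =>
    mul_ne_zero (hcoef l hl) (h.base.quad_ne_zero hd he (h3 l hl).1 (h3 l hl).2.1)
  have hnorm : ∀ l < 3, ‖(r.coef l : ℂ)‖ = 4 := fun l hl => by
    have h16 : ‖(r.coef l : ℂ)‖ ^ 2 = 4 ^ 2 := by
      rw [← norm_pow]
      have := (h3 l hl).2.2
      have h' : (r.coef l : ℂ) ^ 2 = 16 := by exact_mod_cast this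
      rw [h']; norm_num
    exact (pow_left_inj₀ (norm_nonneg _) (by norm_num) two_ne_zero).1 h16
  have h1 := TriRel.relation_of_ne hr h.twist hi hj hk hij hik hjk
  simp only [quad_I_pow_mul] at h1
  have := _root_.three_term (hne i hi) (hne j hj) (hne k hk)
    (TriRel.relation_of_ne hr h.base hi hj hk hij hik hjk)
    (a := ((r.coset i).map a).sum) (b := ((r.coset j).map a).sum) (c := ((r.coset k).map a).sum)
    (by simp only [TriRel.coset]; linear_combination h1) hpar
  refine ⟨this.1, fun hne => ?_⟩
  have := this.2 hne
  rw [norm_mul, norm_mul, hnorm k hk, hnorm i hi] at this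
  linarith

/-- A vanishing sum of squares of products of pairs, given by rows of Riemann's formula. -/
structure PairRel where
  d : ℕ
  rows : List (ℕ × ℤ)
  terms : List (ℕ × ℤ)

/-- Validity of a relation between four squares. -/
def PairRel.valid (r : PairRel) : Bool :=
  r.d < 64 && (r.rows.all fun t => t.1 < 64) &&
  (r.terms.all fun t => t.1 < 64 && evenCoset r.d 0 t.1 && t.2 ^ 2 == 16) &&
  r.terms.length == 4 &&
  isConsequence 8 r.d 0 (evenCoset r.d 0) r.rows r.terms

/-- The characteristics in a relation between four squares. -/
def PairRel.chars (r : PairRel) : List ℕ := r.terms.flatMap fun t => [t.1, t.1 ^^^ r.d]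

lemma four_term {x y z w : ℂ} (hx : x ≠ 0) (hy : y ≠ 0) (hz : z ≠ 0) (hw : w ≠ 0)
    (h0 : x + y + z + w = 0) {a b c d : ℕ}
    (h1 : I ^ (2 * a) * x + I ^ (2 * b) * y + I ^ (2 * c) * z + I ^ (2 * d) * w = 0) :
    (a + b + c + d) % 2 = 0 := by
  simp only [pow_mul, I_sq] at h1
  rcases Nat.even_or_odd a with ha | ha <;> rcases Nat.even_or_odd b with hb | hb <;>
    rcases Nat.even_or_odd c with hc | hc <;> rcases Nat.even_or_odd d with hd | hd <;>
    rw [ha.neg_one_pow, hb.neg_one_pow, hc.neg_one_pow, hd.neg_one_pow] at h1 <;>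
    simp only [Nat.even_iff, Nat.odd_iff] at ha hb hc hd <;>
    first
    | omega
    | (exfalso; apply hx; linear_combination (h0 - h1) / 2)
    | (exfalso; apply hy; linear_combination (h0 - h1) / 2)
    | (exfalso; apply hz; linear_combination (h0 - h1) / 2)
    | (exfalso; apply hw; linear_combination (h0 - h1) / 2)
    | (exfalso; apply hx; linear_combination (h0 + h1) / 2)
    | (exfalso; apply hy; linear_combination (h0 + h1) / 2)
    | (exfalso; apply hz; linear_combination (h0 + h1) / 2)
    | (exfalso; apply hw; linear_combination (h0 + h1) / 2)

lemma Twist.four_term {c : ℕ → ℂ} {a : ℕ → ℕ} (h : Twist c a) {r : PairRel} (hr : r.valid = true) :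
    (r.chars.map a).sum % 2 = 0 := by
  obtain ⟨d, rows, terms⟩ := r
  simp only [PairRel.valid, Bool.and_eq_true, List.all_eq_true, decide_eq_true_eq, beq_iff_eq,
    and_assoc] at hr
  obtain ⟨hd, hrows, hterms, hlen, hchk⟩ := hr
  have h0 := h.base.relation hd (by norm_num) _ _ hrows (fun t ht => (hterms t ht).1) hchk
  have h1 := h.twist.relation hd (by norm_num) _ _ hrows (fun t ht => (hterms t ht).1) hchk
  have hne : ∀ t ∈ terms, (t.2 : ℂ) * quad c d 0 t.1 ≠ 0 := fun t ht => by
    obtain ⟨ht1, ht2, ht3⟩ := hterms t ht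
    refine mul_ne_zero ?_ (h.base.quad_ne_zero hd (by norm_num) ht1 ht2)
    intro h0
    rw [Int.cast_eq_zero] at h0
    rw [h0] at ht3
    norm_num at ht3
  obtain ⟨t₁, t₂, t₃, t₄, rfl⟩ := List.length_eq_four.1 hlen
  simp only [List.mem_cons, List.not_mem_nil, or_false, forall_eq_or_imp, forall_eq] at hne
  obtain ⟨n1, n2, n3, n4⟩ := hne
  have hexp : ∀ t : ℕ, ((cosetList d 0 t).map a).sum = 2 * (a t + a (t ^^^ d)) := fun t => by
    simp [cosetList]; ring
  simp only [List.map_cons, List.map_nil, List.sum_cons, List.sum_nil, quad_I_pow_mul,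
    hexp] at h0 h1
  have := _root_.four_term n1 n2 n3 n4 (by linear_combination h0)
    (a := a t₁.1 + a (t₁.1 ^^^ d)) (b := a t₂.1 + a (t₂.1 ^^^ d))
    (c := a t₃.1 + a (t₃.1 ^^^ d)) (d := a t₄.1 + a (t₄.1 ^^^ d)) (by linear_combination h1)
  simp only [PairRel.chars, List.flatMap_cons, List.flatMap_nil, List.map_append, List.map_cons,
    List.map_nil, List.sum_append, List.sum_cons, List.sum_nil]
  omega

/-- The relation with given plane and representatives. -/
def tri (d e m₀ m₁ m₂ : ℕ) : TriRel :=
  ⟨d, e, fun i => if i = 0 then m₀ else if i = 1 then m₁ else m₂⟩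

/-- The even characteristics other than the normalised ones, as a bit mask. -/
def nonBase : ℕ := 7621116476559348968

/-- Relations between four squares. -/
def pairTable : List PairRel := [
  ⟨20, [(1, 1), (46, 1)], [(1, -4), (4, 4), (8, -4), (34, -4)]⟩,
  ⟨6, [(1, 1), (58, -1)], [(1, -4), (2, 4), (8, -4), (48, 4)]⟩,
  ⟨60, [(1, 1), (18, 1)], [(1, -4), (4, 4), (10, -4), (28, -4)]⟩,
  ⟨8, [(0, 1), (38, 1)], [(0, -4), (2, 4), (20, 4), (48, 4)]⟩,
  ⟨34, [(0, 1), (9, 1)], [(0, -4), (2, 4), (20, -4), (31, -4)]⟩,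
  ⟨17, [(1, 1), (43, 1)], [(1, -4), (4, 4), (14, 4), (33, 4)]⟩,
  ⟨35, [(1, 1), (25, -1)], [(1, -4), (2, 4), (14, 4), (21, -4)]⟩,
  ⟨39, [(6, 1), (18, 1)], [(6, -4), (7, 4), (10, -4), (31, -4)]⟩,
  ⟨4, [(0, 1), (9, 1)], [(0, -4), (2, 4), (16, 4), (27, 4)]⟩,
  ⟨61, [(9, 1), (15, -1)], [(16, -4), (21, 4), (28, -4), (31, 4)]⟩,
  ⟨6, [(0, 1), (9, 1)], [(0, -4), (2, 4), (48, 4), (59, 4)]⟩,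
  ⟨39, [(8, 1), (9, -1)], [(8, -4), (10, 4), (28, -4), (31, 4)]⟩,
  ⟨24, [(3, 1), (44, -1)], [(3, -4), (4, 4), (8, -4), (32, 4)]⟩,
  ⟨16, [(9, 1), (13, -1)], [(32, 4), (33, -4), (40, -4), (45, 4)]⟩,
  ⟨32, [(0, 1), (11, 1)], [(0, -4), (2, 4), (17, 4), (24, 4)]⟩,
  ⟨22, [(3, 1), (11, -1)], [(3, -4), (7, 4), (33, -4), (45, 4)]⟩,
  ⟨16, [(1, 1), (9, -1)], [(1, -4), (5, 4), (33, 4), (45, -4)]⟩,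
  ⟨35, [(12, 1), (15, -1)], [(12, -4), (14, 4), (20, 4), (21, -4)]⟩,
  ⟨50, [(2, 1), (30, 1)], [(2, -4), (5, 4), (10, 4), (17, 4)]⟩,
  ⟨34, [(1, 1), (30, 1)], [(1, -4), (2, 4), (8, -4), (20, -4)]⟩,
  ⟨17, [(1, 1), (11, 1)], [(1, -4), (5, 4), (33, 4), (47, 4)]⟩]

/-- For each characteristic, the relations of `pairTable` expressing its parity. -/
def pairCerts : List (ℕ × List ℕ) := [
  (3, [1, 3, 6, 7, 8, 12]), (5, [6, 14, 16]), (6, [0, 1, 3, 4, 6, 7]), (7, [1]), (10, [0, 2]),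
  (12, [0, 7, 8, 9, 11, 12, 13, 14, 15, 17]), (17, [0, 2, 3, 4, 9, 13, 14]), (20, [2, 3]),
  (27, [0, 1, 3, 6, 7, 8]), (28, [0]), (31, [2, 3, 4]), (33, [2, 3, 4, 5]),
  (35, [1, 2, 4, 8, 10, 12, 14, 15, 16, 18]), (40, [0, 2, 3, 4, 6, 9]),
  (42, [1, 3, 4, 8, 10, 12, 14, 15, 16, 18, 19]), (45, [2, 3, 4, 5, 6]),
  (47, [0, 1, 2, 3, 4, 5, 7, 10, 11]), (49, [0, 2, 3, 4, 9, 13]),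
  (55, [1, 2, 3, 6, 8, 9, 10, 12, 13, 14, 15]), (59, [0, 1, 3, 4, 6, 7, 10]),
  (62, [0, 1, 2, 3, 6, 7, 10, 11, 14, 16, 20])]

/-- The free characteristics, numbered, with the parity vectors they generate. -/
def parityBasis : List (ℕ × ℕ × ℕ) := [
  (0, 14, 5540507832480), (1, 21, 4647715923818447880), (2, 24, 4647719247869513760),
  (3, 34, 5224738545888924744), (4, 48, 576743363300036736), (5, 54, 5206900041457991840),
  (6, 56, 4720335359437706280), (7, 61, 6954265910149518432)]

/-- Three term relations. -/
def triTable : List TriRel := [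
  tri 2 12 0 4 33, tri 2 13 1 5 32, tri 2 36 4 5 12, tri 2 37 4 5 8, tri 2 40 0 5 8,
  tri 3 4 0 1 24, tri 3 5 0 1 56, tri 3 24 0 4 32, tri 3 25 1 5 33, tri 3 32 0 1 24,
  tri 3 36 4 5 28, tri 3 56 0 5 24, tri 3 60 1 4 28, tri 4 9 1 3 17, tri 4 11 1 3 16,
  tri 4 17 0 1 10, tri 4 18 2 3 10, tri 4 25 1 2 8, tri 5 41 1 3 17, tri 5 56 0 3 16,
  tri 6 9 1 3 49, tri 6 50 2 3 10, tri 6 58 1 2 10, tri 7 41 1 3 24, tri 8 18 2 6 34,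
  tri 8 34 0 2 20, tri 9 20 1 5 35, tri 9 36 5 7 21, tri 9 52 3 5 21, tri 9 54 1 7 21,
  tri 10 49 0 6 17, tri 10 51 2 4 17, tri 11 17 1 5 33, tri 12 49 0 6 16, tri 12 51 2 4 16,
  tri 13 20 1 5 34, tri 13 37 5 7 21, tri 13 51 3 5 17, tri 14 21 0 4 35, tri 14 54 0 6 21,
  tri 15 17 1 5 32, tri 15 33 1 3 16, tri 15 52 3 5 20, tri 16 32 0 1 8, tri 16 37 4 5 8,
  tri 17 47 0 5 14, tri 18 32 2 3 10, tri 19 37 6 7 8, tri 19 42 2 7 8, tri 19 46 3 6 12,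
  tri 19 47 2 7 12, tri 20 39 4 5 8, tri 21 38 4 5 14, tri 21 41 1 4 10, tri 22 39 6 7 10,
  tri 23 45 2 7 12, tri 24 36 4 7 12, tri 24 39 4 7 8, tri 25 32 1 2 8, tri 25 39 5 6 8,
  tri 26 35 1 2 14, tri 26 43 1 6 10, tri 26 47 2 5 14, tri 27 35 0 3 14, tri 27 42 0 7 10,
  tri 27 46 3 4 14, tri 28 37 4 7 8, tri 28 38 4 7 12, tri 28 42 0 7 8, tri 28 45 0 7 12,
  tri 29 34 1 2 8, tri 29 37 5 6 8, tri 29 38 5 6 12, tri 29 40 2 5 8, tri 29 43 1 6 8,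
  tri 29 44 1 6 12, tri 29 47 2 5 12, tri 30 33 1 2 14, tri 30 42 2 5 10, tri 31 40 0 7 10]

/-- Contradictory combinations of three term relations, one for each nonzero parity vector. -/
def parityCerts : List (List ℕ) := [
  [446, 299, 653, 668, 38, 551, 452], [262, 374, 380, 671, 82, 145, 407],
  [352, 50, 586, 248, 199, 641, 83], [101, 266, 190, 320, 37, 662, 470],
  [713, 389, 176, 419, 455, 653, 437], [239, 311, 209, 128, 221, 434, 191],
  [604, 344, 326, 239, 1, 218, 487], [137, 218, 622, 572, 532, 397, 145],
  [437, 515, 569, 361, 379, 64, 317], [172, 362, 293, 578, 536, 131, 200],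
  [119, 226, 433, 424, 568, 667, 379], [388, 57, 93, 417], [140, 525, 412, 420],
  [559, 222, 347, 471], [271, 627, 560, 219], [221, 658, 317, 442, 473, 380, 110],
  [695, 245, 587, 172, 2, 154, 473], [563, 426, 28, 592], [410, 608, 204, 361],
  [374, 542, 127, 509, 302, 644, 245], [56, 623, 320, 212, 650, 91, 518], [685, 88, 95, 667],
  [136, 263, 408, 313], [390, 55, 91, 415], [565, 424, 30, 590],
  [433, 479, 668, 14, 590, 308, 460], [523, 659, 569, 479, 293, 32, 712],
  [632, 245, 302, 707, 505, 131, 208], [380, 217, 595, 100, 307, 14, 299], [466, 285, 50, 213],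
  [687, 86, 97, 669], [326, 2, 320, 392, 694, 352, 446], [1, 524, 100, 290, 470, 658, 443],
  [596, 451, 343, 362, 38, 608, 317], [338, 361, 424, 569, 524, 554, 712], [33, 137, 411, 644],
  [82, 57, 462, 487], [29, 141, 407, 646], [138, 444, 406, 210],
  [101, 73, 446, 226, 392, 149, 23], [23, 203, 644, 325, 208, 523, 587],
  [635, 415, 617, 649, 136, 676, 64], [361, 149, 590, 182, 614, 101, 469],
  [662, 311, 416, 254, 59, 370, 23], [532, 487, 149, 650, 203, 415, 590],
  [239, 298, 533, 496, 122, 415, 352], [244, 326, 416, 713, 623, 694, 182], [412, 610, 200, 363],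
  [140, 678, 412, 492], [554, 172, 149, 361, 74, 713, 451], [316, 365, 451, 635, 551, 623, 712],
  [388, 2, 149, 271, 110, 176, 712], [113, 640, 140, 1, 389, 704, 200], [138, 267, 406, 311],
  [687, 676, 142, 146], [632, 479, 514, 572, 398, 194, 23], [154, 343, 164, 299, 446, 416, 293],
  [563, 397, 343, 582], [561, 218, 349, 469], [244, 221, 298, 41, 478, 461, 388],
  [596, 119, 532, 496, 605, 433, 209], [685, 678, 140, 150], [142, 523, 410, 416],
  [446, 428, 524, 640, 397, 200, 347], [581, 506, 356, 262, 289, 469, 446],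
  [707, 434, 149, 662, 221, 100, 37], [299, 329, 461, 194, 572, 352, 28],
  [208, 460, 344, 383, 221, 388, 254], [73, 419, 68, 577, 338, 38, 208],
  [380, 533, 352, 47, 20, 455, 689], [434, 227, 167, 311, 182, 473, 55],
  [298, 146, 64, 455, 469, 281, 334], [68, 253, 425, 551, 487, 212, 155],
  [11, 266, 290, 5, 599, 442, 506], [253, 425, 416, 659, 83, 173, 446], [33, 425, 203, 501],
  [48, 397, 388, 147], [29, 429, 205, 497], [136, 263, 408, 313], [565, 424, 30, 590],
  [392, 402, 201, 453], [104, 272, 677, 10, 572, 352, 266], [533, 398, 605, 694, 388, 455, 37],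
  [412, 610, 200, 363], [140, 678, 412, 492], [586, 689, 289, 59, 569, 271, 145],
  [551, 653, 146, 568, 335, 542, 2], [245, 271, 290, 176, 334, 236, 569],
  [329, 182, 203, 257, 545, 478, 338], [392, 402, 201, 453], [563, 426, 28, 592],
  [119, 425, 52, 452], [588, 253, 349, 239], [416, 632, 128, 497, 320, 686, 560],
  [92, 389, 203, 23, 86, 614, 128], [266, 484, 124, 212], [29, 429, 205, 497],
  [563, 397, 343, 582], [33, 425, 203, 501], [334, 658, 362, 632, 83, 497, 623],
  [497, 110, 437, 164, 590, 320, 23], [487, 203, 55, 524, 623, 254, 401],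
  [190, 56, 20, 299, 389, 614, 560], [565, 399, 345, 578], [140, 525, 412, 420],
  [685, 88, 95, 667], [388, 57, 93, 417], [6, 317, 525, 353], [33, 137, 411, 644],
  [138, 267, 406, 311], [29, 141, 407, 646], [394, 398, 199, 451], [46, 399, 390, 145],
  [569, 334, 91, 560, 145, 284, 389], [478, 344, 437, 686, 590, 200, 38],
  [32, 479, 262, 398, 389, 407, 469], [704, 32, 560, 407, 122, 334, 713], [142, 676, 410, 488],
  [410, 608, 204, 361], [208, 452, 91, 290, 383, 446, 145], [104, 119, 74, 347, 446, 398, 704],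
  [460, 626, 93, 682], [559, 222, 347, 471], [362, 29, 587, 632, 47, 578, 487],
  [119, 244, 302, 145, 542, 434, 419], [523, 156, 30, 514], [138, 444, 406, 210],
  [19, 551, 509, 176, 317, 586, 365], [412, 610, 200, 363], [48, 453, 406, 210],
  [434, 686, 14, 128, 200, 230, 698], [83, 704, 200, 164, 623, 595, 415], [561, 218, 349, 469],
  [1, 663, 345, 680], [415, 599, 505, 659, 442, 667, 164], [263, 379, 2, 326, 416, 335, 388],
  [141, 124, 92, 101], [46, 451, 408, 208], [118, 716, 28, 392, 248, 167, 506],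
  [388, 57, 93, 417], [325, 136, 176, 461, 704, 82, 487], [154, 203, 614, 329, 136, 653, 518],
  [690, 191, 33, 536], [590, 667, 491, 317, 298, 284, 712], [140, 678, 412, 492],
  [470, 500, 248, 95, 158, 703, 461], [523, 156, 30, 514], [380, 415, 635, 515, 164, 446, 676],
  [33, 137, 411, 644], [626, 452, 182, 218, 398, 479, 284], [29, 141, 407, 646],
  [390, 55, 91, 415], [452, 137, 614, 281, 266, 491, 506], [136, 263, 408, 313],
  [389, 605, 631, 119, 284, 658, 353], [419, 329, 127, 388, 29, 20, 173], [51, 329, 137, 335],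
  [167, 10, 59, 298, 599, 470, 37], [142, 523, 410, 416], [478, 226, 680, 707, 370, 190, 352],
  [137, 122, 96, 105], [410, 608, 204, 361], [551, 329, 131, 299, 209, 227, 176],
  [48, 397, 388, 147], [113, 1, 496, 56, 155, 419, 371], [365, 434, 46, 352, 200, 370, 478],
  [691, 595, 30, 680], [416, 83, 149, 469, 662, 280, 613], [685, 420, 32, 520],
  [138, 444, 406, 210], [190, 491, 38, 388, 91, 236, 442], [536, 515, 191, 149, 560, 176, 509],
  [140, 525, 412, 420], [425, 326, 52, 110], [560, 145, 37, 308, 392, 668, 172],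
  [559, 222, 347, 471], [554, 416, 253, 599, 410, 149, 158], [565, 424, 30, 590],
  [65, 478, 281, 365, 55, 604, 29], [253, 505, 334, 284, 437, 704, 686], [142, 511, 200, 473],
  [176, 455, 460, 559, 122, 20, 230], [565, 399, 345, 578], [443, 500, 164, 650, 455, 190, 523],
  [563, 426, 28, 592], [650, 181, 365, 335, 667, 641, 424], [138, 267, 406, 311],
  [707, 455, 581, 532, 2, 434, 352], [563, 397, 343, 582], [635, 217, 254, 118, 487, 650, 479],
  [48, 442, 136, 453], [104, 248, 392, 563, 635, 451, 550], [2, 259, 348, 705],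
  [136, 263, 408, 313], [398, 311, 704, 587, 173, 379, 2], [623, 128, 185, 92, 284, 82, 433],
  [559, 222, 347, 471], [410, 608, 204, 361], [65, 461, 131, 650, 221, 19, 407],
  [491, 145, 599, 236, 190, 19, 551], [140, 525, 412, 420], [525, 154, 28, 516],
  [518, 335, 632, 199, 218, 482, 587], [687, 86, 97, 669], [158, 64, 632, 640, 199, 185, 272],
  [203, 362, 587, 415, 2, 137, 86], [123, 281, 245, 541], [29, 429, 205, 497],
  [707, 623, 146, 631, 532, 353, 317], [33, 425, 203, 501], [289, 451, 443, 55, 158, 713, 307],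
  [685, 420, 32, 520], [56, 416, 550, 443, 689, 578, 694], [142, 676, 410, 488],
  [572, 145, 635, 614, 595, 554, 137], [406, 626, 532, 317, 343, 146, 109], [687, 676, 142, 146],
  [515, 559, 694, 587, 127, 716, 605], [691, 595, 30, 680], [33, 137, 411, 644],
  [316, 416, 626, 425, 469, 199, 554], [29, 141, 407, 646], [695, 397, 425, 217, 482, 74, 464],
  [525, 676, 687, 534], [713, 509, 653, 172, 401, 599, 419], [554, 28, 482, 605, 119, 199, 659],
  [138, 267, 406, 311], [325, 424, 334, 83, 560, 497, 271], [412, 610, 200, 363],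
  [464, 281, 52, 209], [587, 419, 68, 280, 658, 155, 200], [277, 456, 559, 104],
  [317, 569, 496, 181, 272, 641, 415], [392, 149, 272, 514, 407, 356, 163], [388, 57, 93, 417],
  [277, 456, 559, 104], [50, 100, 473, 113, 433, 572, 136], [280, 167, 320, 428, 64, 559, 352],
  [565, 399, 345, 578], [561, 218, 349, 469], [263, 281, 416, 361, 122, 455, 194],
  [138, 444, 406, 210], [581, 19, 2, 227, 167, 253, 307], [167, 194, 263, 473, 131, 122, 209],
  [140, 678, 412, 492], [596, 14, 713, 388, 658, 163, 145], [271, 129, 48, 282],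
  [118, 190, 604, 407, 209, 653, 226], [123, 429, 50, 456], [38, 46, 694, 559, 254, 5, 716],
  [565, 424, 30, 590], [473, 365, 118, 514, 320, 478, 443], [33, 425, 203, 501],
  [302, 361, 689, 209, 577, 433, 2], [29, 429, 205, 497]]

/-- The pairs of bits, with the characteristics whose signs determine the sign of the pair. -/
def bitPairs : List (ℕ × ℕ × List ℕ) := [
  (0, 1, [3]), (0, 2, [5]), (0, 3, []), (0, 4, [17]), (0, 5, [33]), (1, 2, [6]), (1, 3, [10]),
  (1, 4, [27, 3, 17, 10, 24]), (1, 5, [34]), (2, 3, [12]), (2, 4, [20]),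
  (2, 5, [45, 5, 33, 12, 40]), (3, 4, [24]), (3, 5, [40]), (4, 5, [48])]

/-- For each characteristic, the three term relations expressing its sign. -/
def signCerts : List (ℕ × List ℕ) := [
  (7, [55]), (14, [1]), (21, [136]), (28, [389, 506]), (31, [518, 380, 55]), (35, [82]),
  (42, [38]), (47, [163, 38]), (49, [388]), (54, [119, 676, 254, 227]),
  (55, [361, 559, 446, 590]), (56, [389]), (59, [38, 551]), (61, [388, 398]),
  (62, [415, 383, 5])]
/-- The parity vector generated by the free parities recorded in `t`. -/
def parityWord (t : ℕ) : ℕ :=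
  parityBasis.foldr (fun g x => (if t.testBit g.1 then g.2.2 else 0) ^^^ x) 0

/-- The equation expressing the parity at `m` through the free ones. -/
def parityTarget (m : ℕ) : List ℕ :=
  m :: (parityBasis.filter fun g => g.2.2.testBit m).map fun g => g.2.1

/-- The relations of `pairTable` certifying `parityTarget`. -/
def parityEqs (m : ℕ) : List (List ℕ × ℕ) :=
  (((pairCerts.lookup m).getD []).filterMap fun k => pairTable[k]?).map fun r => (r.chars, 0)

/-- The relations and the two cosets encoded by a list of numbers. -/
def decode (l : List ℕ) : List (TriRel × ℕ × ℕ) :=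
  l.filterMap fun x => (triTable[x / 9]?).map fun r => (r, x / 3 % 3, x % 3)

/-- The sum of the parities in a coset. -/
def cosetCount (u : ℕ) (r : TriRel) (i : ℕ) : ℕ := (r.coset i).countP u.testBit

/-- The equation between signs given by two cosets of equal parity. -/
def signEq (u : ℕ) (q : TriRel × ℕ × ℕ) : List ℕ × ℕ :=
  (q.1.coset q.2.1 ++ q.1.coset q.2.2,
    (cosetCount u q.1 q.2.1 + 3 * cosetCount u q.1 q.2.2) / 2 +
      if cosetCount u q.1 q.2.1 % 2 = cosetCount u q.1 (3 - q.2.1 - q.2.2) % 2 then 0 else 1)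

/-- Two distinct cosets of equal parity. -/
def isSignItem (u : ℕ) (q : TriRel × ℕ × ℕ) : Bool :=
  q.2.1 != q.2.2 && q.2.1 < 3 && q.2.2 < 3 &&
    cosetCount u q.1 q.2.1 % 2 == cosetCount u q.1 q.2.2 % 2

/-- A coset whose parity differs from those of the two others, and one of the latter. -/
def isNormItem (u : ℕ) (q : TriRel × ℕ × ℕ) : Bool :=
  q.2.1 != q.2.2 && q.2.1 < 3 && q.2.2 < 3 &&
    cosetCount u q.1 q.2.1 % 2 != cosetCount u q.1 q.2.2 % 2 &&
    cosetCount u q.1 (3 - q.2.1 - q.2.2) % 2 == cosetCount u q.1 q.2.2 % 2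

/-- A combination of sign equations with sum `0 = 1`. -/
def signContradiction (u : ℕ) (l : List (TriRel × ℕ × ℕ)) : Bool :=
  l.all (isSignItem u) && bitsum ((l.map (signEq u)).flatMap Prod.fst ++ []) &&& nonBase == 0 &&
    ((l.map (signEq u)).map Prod.snd).sum % 2 == 1

/-- A combination of norm equations with contradictory sum. -/
def normContradiction (u : ℕ) (l : List (TriRel × ℕ × ℕ)) : Bool :=
  !l.isEmpty && l.all (isNormItem u) &&
    (l.flatMap fun q => q.1.coset q.2.1).isPerm (l.flatMap fun q => q.1.coset q.2.2)

lemma triTable_valid : ∀ r ∈ triTable, r.valid = true := by decide +kernel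

lemma pairTable_valid : ∀ r ∈ pairTable, r.valid = true := by decide +kernel

lemma parityEqs_bitsum : ∀ m < 64,
    bitsum ((parityEqs m).flatMap Prod.fst ++ parityTarget m) &&& nonBase = 0 := by decide +kernel

lemma parityWord_testBit : ∀ t < 256, ∀ m < 64, (parityWord t).testBit m =
    ((parityBasis.filter fun g => g.2.2.testBit m).foldr
      (fun g x => t.testBit g.1 ^^ x) false) := by
  decide +kernel

lemma parityCerts_valid : ∀ t < 255,
    (signContradiction (parityWord (t + 1)) (decode (parityCerts.getD t [])) ||
      normContradiction (parityWord (t + 1)) (decode (parityCerts.getD t []))) = true := by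
  decide +kernel

/-- The equation expressing the sign at `m` through those of pairs of bits. -/
def signTarget (m : ℕ) : List ℕ :=
  m :: (bitPairs.filter fun q => m.testBit q.1 && m.testBit q.2.1).flatMap fun q => q.2.2

lemma signEqs_valid : ∀ m < 64, oddN m = false →
    ((decode ((signCerts.lookup m).getD [])).all (isSignItem 0) &&
    (((decode ((signCerts.lookup m).getD [])).map (signEq 0)).map Prod.snd).sum % 2 == 0 &&
    bitsum (((decode ((signCerts.lookup m).getD [])).map (signEq 0)).flatMap Prod.fst
      ++ signTarget m) &&& nonBase == 0) = true := by
  decide +kernel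

lemma mem_triTable_of_mem_decode {l : List ℕ} {q : TriRel × ℕ × ℕ} (hq : q ∈ decode l) :
    q.1.valid = true := by
  simp only [decode, List.mem_filterMap, Option.map_eq_some_iff] at hq
  obtain ⟨x, -, r, hr, rfl⟩ := hq
  exact triTable_valid r (List.mem_of_getElem? hr)

lemma TriRel.mem_coset_lt {r : TriRel} (hr : r.valid = true) {i : ℕ} (hi : i < 3) {m : ℕ}
    (hm : m ∈ r.coset i) : m < 64 := by
  obtain ⟨hd, he, h3, -⟩ := TriRel.valid_iff hr
  have h := (h3 i hi).1
  simp only [TriRel.coset, cosetList, List.mem_cons, List.not_mem_nil, or_false] at hm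
  rcases hm with rfl | rfl | rfl | rfl
  · exact h
  · exact xor_lt_64 h hd
  · exact xor_lt_64 h he
  · exact xor_lt_64 (xor_lt_64 h hd) he

lemma sum_eq_countP_add {a : ℕ → ℕ} {u : ℕ} (L : List ℕ)
    (h : ∀ m ∈ L, a m % 2 = (u.testBit m).toNat) :
    (L.map a).sum = L.countP u.testBit + 2 * (L.map fun m => a m / 2).sum := by
  induction L with
  | nil => simp
  | cons m L ih =>
    have h1 := h m (by simp)
    simp only [List.map_cons, List.sum_cons, ih fun k hk => h k (by simp [hk]), List.countP_cons]
    cases hb : u.testBit m <;> simp only [hb, Bool.toNat_false, Bool.toNat_true] at h1 <;>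
      simp <;> omega

lemma sum_map_natCast (f : ℕ → ℕ) (L : List ℕ) :
    (L.map fun m => ((f m : ℕ) : ZMod 2)).sum = (((L.map f).sum : ℕ) : ZMod 2) := by
  induction L with
  | nil => simp
  | cons m L ih => simp [ih]

lemma nonBase_lt : nonBase < 2 ^ 64 := by decide +kernel

section

variable {c : ℕ → ℂ} {a : ℕ → ℕ} {u : ℕ}

lemma coset_sum_eq (hu : ∀ m < 64, a m % 2 = (u.testBit m).toNat)
    {r : TriRel} (hr : r.valid = true) {i : ℕ} (hi : i < 3) :
    ((r.coset i).map a).sum = cosetCount u r i + 2 * ((r.coset i).map fun m => a m / 2).sum :=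
  sum_eq_countP_add _ fun m hm => hu m (TriRel.mem_coset_lt hr hi hm)

lemma Twist.signEq_holds (h : Twist c a) (hu : ∀ m < 64, a m % 2 = (u.testBit m).toNat)
    {q : TriRel × ℕ × ℕ} (hr : q.1.valid = true)
    (hq : isSignItem u q = true) :
    ((signEq u q).1.map fun m => ((a m / 2 : ℕ) : ZMod 2)).sum = ((signEq u q).2 : ZMod 2) := by
  obtain ⟨r, i, j⟩ := q
  simp only [isSignItem, Bool.and_eq_true, bne_iff_ne, decide_eq_true_eq, beq_iff_eq] at hq
  obtain ⟨⟨⟨hij, hi⟩, hj⟩, hpar⟩ := hq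
  dsimp only at hr hpar
  have hk : 3 - i - j < 3 := by omega
  have ei := coset_sum_eq hu hr hi
  have ej := coset_sum_eq hu hr hj
  have ek := coset_sum_eq hu hr hk
  have := (h.three_term hr hi hj hk hij (by omega) (by omega) (by omega)).1
  rw [sum_map_natCast, ZMod.natCast_eq_natCast_iff, Nat.ModEq]
  simp only [signEq, List.map_append, List.sum_append]
  have e1 : ∀ l l' : ℕ, (cosetCount u r l + 2 * l') % 2 = cosetCount u r l % 2 := fun l l' => by
    omega
  rw [ei, ej, ek, e1, e1] at this
  split_ifs at this ⊢ <;> omega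

lemma Twist.norm_eq (h : Twist c a) (hu : ∀ m < 64, a m % 2 = (u.testBit m).toNat)
    {q : TriRel × ℕ × ℕ} (hr : q.1.valid = true)
    (hq : isNormItem u q = true) :
    ((q.1.coset q.2.1).map fun m => Real.log ‖c m‖).sum
      = ((q.1.coset q.2.2).map fun m => Real.log ‖c m‖).sum + Real.log √2 := by
  obtain ⟨r, i, j⟩ := q
  simp only [isNormItem, Bool.and_eq_true, bne_iff_ne, decide_eq_true_eq, beq_iff_eq] at hq
  obtain ⟨⟨⟨⟨hij, hi⟩, hj⟩, hpar⟩, hpar'⟩ := hq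
  dsimp only at hr hpar hpar'
  have hk : 3 - i - j < 3 := by omega
  have ei := coset_sum_eq hu hr hi
  have ej := coset_sum_eq hu hr hj
  have ek := coset_sum_eq hu hr hk
  have := (h.three_term hr hj hk hi (by omega) hij.symm (by omega) (by omega)).2 (by omega)
  obtain ⟨hd, he, h3, -⟩ := TriRel.valid_iff hr
  have key : ∀ l < 3, ((r.coset l).map fun m => Real.log ‖c m‖).sum
      = Real.log ‖quad c r.d r.e (r.rep l)‖ ∧ ‖quad c r.d r.e (r.rep l)‖ ≠ 0 := fun l hl => by
    have hne := h.base.quad_ne_zero hd he (h3 l hl).1 (h3 l hl).2.1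
    refine ⟨?_, norm_ne_zero_iff.2 hne⟩
    simp only [quad, mul_ne_zero_iff] at hne
    obtain ⟨⟨h1, h2⟩, h3, h4⟩ := hne
    simp only [TriRel.coset, cosetList, List.map_cons, List.map_nil, List.sum_cons, List.sum_nil,
      quad, norm_mul]
    rw [Real.log_mul (by simp [h1, h2]) (by simp [h3, h4]), Real.log_mul (by simpa) (by simpa),
      Real.log_mul (by simpa) (by simpa)]
    ring
  dsimp only
  rw [(key i hi).1, (key j hj).1, this, Real.log_mul (by simp) (key j hj).2, add_comm]

lemma Twist.not_normContradiction (h : Twist c a) (hu : ∀ m < 64, a m % 2 = (u.testBit m).toNat)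
    {l : List (TriRel × ℕ × ℕ)} (hl : ∀ q ∈ l, q.1.valid = true) :
    ¬ normContradiction u l = true := by
  intro hc
  simp only [normContradiction, Bool.and_eq_true, List.all_eq_true, List.isPerm_iff] at hc
  obtain ⟨⟨hne, hitem⟩, hperm⟩ := hc
  have h1 := (hperm.map fun m => Real.log ‖c m‖).sum_eq
  have h2 : ((l.flatMap fun q => q.1.coset q.2.1).map fun m => Real.log ‖c m‖).sum
      = ((l.flatMap fun q => q.1.coset q.2.2).map fun m => Real.log ‖c m‖).sum
        + l.length * Real.log √2 := by
    clear hne hperm h1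
    induction l with
    | nil => simp
    | cons q l ih =>
      simp only [List.flatMap_cons, List.map_append, List.sum_append, List.length_cons]
      rw [ih (fun r hr => hl r (by simp [hr])) (fun r hr => hitem r (by simp [hr])),
        h.norm_eq hu (hl q (by simp)) (hitem q (by simp))]
      push_cast; ring
  have h3 : 0 < Real.log √2 := Real.log_pos (by
    rw [Real.lt_sqrt (by norm_num)]; norm_num)
  have h4 : (0 : ℝ) < l.length := by
    have : l ≠ [] := by simpa using hne
    exact_mod_cast List.length_pos_iff.2 this
  nlinarith [mul_pos h4 h3]

lemma Twist.sum_signs (h : Twist c a) (hu : ∀ m < 64, a m % 2 = (u.testBit m).toNat)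
    (ha : ∀ m, nonBase.testBit m = false → a m = 0)
    {l : List (TriRel × ℕ × ℕ)} (hl : ∀ q ∈ l, q.1.valid = true)
    (hitem : l.all (isSignItem u) = true) (target : List ℕ)
    (hbits : bitsum ((l.map (signEq u)).flatMap Prod.fst ++ target) &&& nonBase = 0) :
    (target.map fun m => ((a m / 2 : ℕ) : ZMod 2)).sum
      = ((((l.map (signEq u)).map Prod.snd).sum : ℕ) : ZMod 2) := by
  refine sum_eq_of_bitsum nonBase_lt (fun m hm => by simp [ha m hm]) _ _ ?_ hbits
  intro q hq
  obtain ⟨p, hp, rfl⟩ := List.mem_map.1 hq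
  exact h.signEq_holds hu (hl p hp) (List.all_eq_true.1 hitem p hp)

lemma Twist.not_signContradiction (h : Twist c a) (hu : ∀ m < 64, a m % 2 = (u.testBit m).toNat)
    (ha : ∀ m, nonBase.testBit m = false → a m = 0)
    {l : List (TriRel × ℕ × ℕ)} (hl : ∀ q ∈ l, q.1.valid = true) :
    ¬ signContradiction u l = true := by
  intro hc
  simp only [signContradiction, Bool.and_eq_true, beq_iff_eq] at hc
  obtain ⟨⟨hitem, hbits⟩, hodd⟩ := hc
  have := h.sum_signs hu ha hl hitem [] hbits
  rw [List.map_nil, List.sum_nil, eq_comm, ZMod.natCast_eq_zero_iff] at this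
  omega

end

lemma Twist.parity_eq {c : ℕ → ℂ} {a : ℕ → ℕ} (h : Twist c a)
    (ha : ∀ m, nonBase.testBit m = false → a m = 0) :
    ∃ t < 256, ∀ m < 64, a m % 2 = ((parityWord t).testBit m).toNat := by
  have hfree : ∀ g ∈ parityBasis, g.1 < 8 ∧ (parityBasis.getD g.1 0).2.1 = g.2.1 := by
    decide +kernel
  let t := Nat.ofBits fun k : Fin 8 => decide (a (parityBasis.getD k 0).2.1 % 2 = 1)
  have ht : ∀ g ∈ parityBasis, t.testBit g.1 = decide (a g.2.1 % 2 = 1) := fun g hg => by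
    obtain ⟨h1, h2⟩ := hfree g hg
    rw [Nat.testBit_ofBits_lt _ _ h1, ← h2]
  refine ⟨t, Nat.ofBits_lt_two_pow _, fun m hm => ?_⟩
  rw [parityWord_testBit t (Nat.ofBits_lt_two_pow _) m hm]
  have h1 := sum_eq_of_bitsum nonBase_lt (h := fun m => ((a m : ℕ) : ZMod 2))
    (fun m hm => by simp [ha m hm]) _ (parityTarget m) (by
      intro q hq
      obtain ⟨r, hr, rfl⟩ := List.mem_map.1 hq
      obtain ⟨k, -, hk⟩ := List.mem_filterMap.1 hr
      have := h.four_term (pairTable_valid r (List.mem_of_getElem? hk))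
      rw [sum_map_natCast, Nat.cast_zero, ZMod.natCast_eq_zero_iff]
      exact Nat.dvd_of_mod_eq_zero this) (parityEqs_bitsum m hm)
  have h2 : ((parityEqs m).map Prod.snd).sum = 0 := by simp [parityEqs, Function.comp_def]
  rw [h2, parityTarget, List.map_cons, List.sum_cons, Nat.cast_zero, ← CharTwo.sub_eq_add,
    sub_eq_zero, List.map_map] at h1
  have h3 : ∀ l : List (ℕ × ℕ × ℕ), (∀ g ∈ l, t.testBit g.1 = decide (a g.2.1 % 2 = 1)) →
      (l.map ((fun m => ((a m : ℕ) : ZMod 2)) ∘ fun g => g.2.1)).sum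
        = (((l.foldr (fun g x => t.testBit g.1 ^^ x) false).toNat : ℕ) : ZMod 2) := by
    intro l hl
    induction l with
    | nil => simp
    | cons g l ih =>
      rw [List.map_cons, List.sum_cons, ih fun r hr => hl r (by simp [hr]), List.foldr_cons,
        hl g (by simp)]
      have : (a g.2.1 : ZMod 2) = ((decide (a g.2.1 % 2 = 1)).toNat : ℕ) := by
        rw [ZMod.natCast_eq_natCast_iff, Nat.ModEq]
        by_cases hh : a g.2.1 % 2 = 1
        · simp [hh]
        · simp [hh]; omega
      simp only [Function.comp_apply, this]
      generalize decide (a g.2.1 % 2 = 1) = x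
      generalize List.foldr _ _ l = y
      revert x y
      decide
  rw [h3 _ fun g hg => ht g (List.mem_of_mem_filter hg), ZMod.natCast_eq_natCast_iff,
    Nat.ModEq] at h1
  rw [h1]
  generalize List.foldr _ _ _ = y
  cases y <;> rfl

lemma Twist.even_exponent {c : ℕ → ℂ} {a : ℕ → ℕ} (h : Twist c a)
    (ha : ∀ m, nonBase.testBit m = false → a m = 0) : ∀ m < 64, a m % 2 = 0 := by
  obtain ⟨t, ht, hu⟩ := h.parity_eq ha
  obtain _ | t := t
  · intro m hm
    rw [hu m hm]
    have : parityWord 0 = 0 := by decide +kernel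
    simp [this]
  · exfalso
    have := parityCerts_valid t (by omega)
    rw [Bool.or_eq_true] at this
    rcases this with h' | h'
    · exact h.not_signContradiction hu ha (fun q hq => mem_triTable_of_mem_decode hq) h'
    · exact h.not_normContradiction hu (fun q hq => mem_triTable_of_mem_decode hq) h'

/-- The quadratic sign determined by exponents at pairs of bits. -/
noncomputable def pairSign (a : ℕ → ℕ) (m : ℕ) : ℂ :=
  (bitPairs.map fun q => if m.testBit q.1 && m.testBit q.2.1 then
    (-1 : ℂ) ^ (q.2.2.map fun k => a k / 2).sum else 1).prod

lemma quarticInvariant_list {ι : Type*} (δ : ι → ℕ → ℂ) (l : List ι)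
    (h : ∀ i, QuarticInvariant (δ i)) : QuarticInvariant fun m => (l.map fun i => δ i m).prod := by
  induction l with
  | nil => simpa using quarticInvariant_const one_ne_zero
  | cons i l ih => simpa using (h i).mul ih

lemma quarticInvariant_pairSign (a : ℕ → ℕ) : QuarticInvariant (pairSign a) :=
  quarticInvariant_list (fun (q : ℕ × ℕ × List ℕ) m => if m.testBit q.1 && m.testBit q.2.1 then
    (-1 : ℂ) ^ (q.2.2.map fun k => a k / 2).sum else 1) bitPairs fun q =>
    quarticInvariant_pair (by rw [← pow_mul, mul_comm, pow_mul]; simp) q.1 q.2.1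

lemma pairSign_eq (a : ℕ → ℕ) (m : ℕ) : pairSign a m = (-1) ^
    (((bitPairs.filter fun q => m.testBit q.1 && m.testBit q.2.1).flatMap fun q => q.2.2).map
      fun k => a k / 2).sum := by
  rw [pairSign]
  induction bitPairs with
  | nil => simp
  | cons q l ih =>
    rw [List.map_cons, List.prod_cons, ih]
    cases hq : m.testBit q.1 && m.testBit q.2.1
    · rw [List.filter_cons_of_neg (by simp [hq])]; simp
    · rw [List.filter_cons_of_pos (by simp [hq])]; simp [pow_add]

lemma Twist.eq_pairSign {c : ℕ → ℂ} {a : ℕ → ℕ} (h : Twist c a)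
    (ha : ∀ m, nonBase.testBit m = false → a m = 0) {m : ℕ} (hm : m < 64) (ho : oddN m = false) :
    I ^ a m = pairSign a m := by
  have heven := h.even_exponent ha
  have hu : ∀ m < 64, a m % 2 = ((0 : ℕ).testBit m).toNat := fun m hm => by simp [heven m hm]
  have hv := signEqs_valid m hm ho
  simp only [Bool.and_eq_true, beq_iff_eq] at hv
  obtain ⟨⟨h1, h2⟩, h3⟩ := hv
  have := h.sum_signs hu ha (fun q hq => mem_triTable_of_mem_decode hq) h1 _ h3
  rw [signTarget, List.map_cons, List.sum_cons, sum_map_natCast,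
    (ZMod.natCast_eq_zero_iff _ 2).2 (Nat.dvd_of_mod_eq_zero h2), ← CharTwo.sub_eq_add, sub_eq_zero,
    ZMod.natCast_eq_natCast_iff, Nat.ModEq] at this
  rw [pairSign_eq, neg_one_pow_eq_pow_mod_two, ← this, ← neg_one_pow_eq_pow_mod_two]
  conv_lhs => rw [show a m = 2 * (a m / 2) by have := heven m hm; omega, pow_mul, I_sq]

lemma ConstSystem.congr {c c' : ℕ → ℂ} (hc : ConstSystem c) (h : ∀ m < 64, c' m = c m) :
    ConstSystem c' := by
  have hq : ∀ m < 64, ∀ d < 64, ∀ e < 64, quad c' d e m = quad c d e m := fun m hm d hd e he => by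
    have h1 := xor_lt_64 hm hd
    rw [quad, quad, h m hm, h _ h1, h _ (xor_lt_64 hm he), h _ (xor_lt_64 h1 he)]
  refine ⟨fun k hk ho => by rw [h k hk, hc.odd k hk ho],
    fun k hk ho => by rw [h k hk]; exact hc.even k hk ho, fun m hm d hd e he => ?_⟩
  rw [hq m hm d hd e he, hc.rel m hm d hd e he]
  exact Finset.sum_congr rfl fun n hn => by rw [hq n (Finset.mem_range.1 hn) d hd e he]

lemma exists_I_pow {z : ℂ} (hz : z ^ 4 = 1) : ∃ n : ℕ, I ^ n = z := by
  have : (z - 1) * ((z + 1) * ((z - I) * (z + I))) = 0 := by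
    linear_combination hz - (z ^ 2 - 1) * I_sq
  simp only [mul_eq_zero, sub_eq_zero, add_eq_zero_iff_eq_neg] at this
  rcases this with rfl | rfl | rfl | rfl
  · exact ⟨0, by simp⟩
  · exact ⟨2, by simp⟩
  · exact ⟨1, by simp⟩
  · exact ⟨3, by rw [pow_succ, I_sq]; simp⟩

/-- Systems of constants with proportional fourth powers differ by a quartic multiplier. -/
theorem ConstSystem.exists_quarticInvariant {c c' : ℕ → ℂ} (hc : ConstSystem c)
    (hc' : ConstSystem c') {κ : ℂ} (hκ : κ ≠ 0) (h4 : ∀ m < 64, c' m ^ 4 = κ * c m ^ 4) :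
    ∃ δ, QuarticInvariant δ ∧ ∀ m < 64, c' m = δ m * c m := by
  have heven : ∀ i < 6, 2 ^ i < 64 ∧ oddN (2 ^ i) = false := by decide
  set ε : ℕ → ℂ := fun m => c' m / c m
  have hε4 : ∀ m < 64, oddN m = false → ε m ^ 4 = κ := fun m hm ho => by
    have := hc.even m hm ho
    rw [div_pow, h4 m hm]
    field_simp
  have hε0 : ε 0 ≠ 0 := by
    intro h
    have := hε4 0 (by norm_num) rfl
    rw [h] at this
    exact hκ (by rw [← this]; norm_num)
  have ht4 : ∀ i < 6, (ε (2 ^ i) / ε 0) ^ 4 = 1 := fun i hi => by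
    rw [div_pow, hε4 _ (heven i hi).1 (heven i hi).2, hε4 0 (by norm_num) rfl, div_self hκ]
  set t : ℕ → ℂ := fun i => if i < 6 then ε (2 ^ i) / ε 0 else 1 with ht
  have ht4' : ∀ i, t i ^ 4 = 1 := fun i => by
    rw [ht]; dsimp only; split_ifs with hi
    · exact ht4 i hi
    · simp
  set δ : ℕ → ℂ := fun m =>
    ε 0 * ((List.range 6).map fun i => if m.testBit i then t i else 1).prod with hδ
  have hδq : QuarticInvariant δ := (quarticInvariant_const hε0).mul
    (quarticInvariant_list (fun i m => if m.testBit i then t i else 1) _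
      fun i => quarticInvariant_bit (ht4' i) i)
  have hδ4 : ∀ m, δ m ^ 4 = κ := fun m => by
    rw [hδ]; dsimp only
    rw [mul_pow, hε4 0 (by norm_num) rfl]
    have : ∀ l : List ℕ, (l.map fun i => if m.testBit i then t i else 1).prod ^ 4 = 1 := fun l => by
      induction l with
      | nil => simp
      | cons i l ih =>
        rw [List.map_cons, List.prod_cons, mul_pow, ih]
        split_ifs
        · rw [ht4', one_mul]
        · simp
    rw [this, mul_one]
  have hbase : ∀ m < 64, oddN m = false → nonBase.testBit m = false → ε m = δ m := by
    have : ∀ m < 64, oddN m = false → nonBase.testBit m = false →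
        m = 0 ∨ ∃ i < 6, m = 2 ^ i := by decide +kernel
    intro m hm ho hb
    have hl : List.range 6 = [0, 1, 2, 3, 4, 5] := by decide
    have e : ∀ i < 6, t i * ε 0 = ε (2 ^ i) := fun i hi => by
      rw [ht]; simp only [hi, if_true]; field_simp
    obtain rfl | ⟨i, hi, rfl⟩ := this m hm ho hb
    · simp [hδ]
    · simp only [hδ, hl, ← e i hi, Nat.testBit_two_pow]
      interval_cases i <;> simp <;> ring
  have hexp : ∀ m, ∃ n : ℕ, if nonBase.testBit m then (m < 64 → oddN m = false →
      I ^ n = ε m / δ m) else n = 0 := by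
    intro m
    split_ifs with hb
    · by_cases hm : m < 64 ∧ oddN m = false
      · obtain ⟨n, hn⟩ := exists_I_pow (z := ε m / δ m) (by
          rw [div_pow, hε4 m hm.1 hm.2, hδ4, div_self hκ])
        exact ⟨n, fun _ _ => hn⟩
      · exact ⟨0, fun h1 h2 => absurd ⟨h1, h2⟩ hm⟩
    · exact ⟨0, rfl⟩
  choose a ha using hexp
  have ha0 : ∀ m, nonBase.testBit m = false → a m = 0 := fun m hb => by simpa [hb] using ha m
  have hI : ∀ m < 64, oddN m = false → I ^ a m = ε m / δ m := fun m hm ho => by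
    cases hb : nonBase.testBit m with
    | false => rw [ha0 m hb, pow_zero, hbase m hm ho hb, div_self (hδq.ne_zero m)]
    | true => exact (by simpa [hb] using ha m : m < 64 → oddN m = false → _) hm ho
  have htw : ∀ m < 64, I ^ a m * c m = (δ m)⁻¹ * c' m := fun m hm => by
    cases ho : oddN m with
    | true => rw [hc.odd m hm ho, hc'.odd m hm ho, mul_zero, mul_zero]
    | false =>
      have := hc.even m hm ho
      have := hδq.ne_zero m
      rw [hI m hm ho]
      simp only [ε]
      field_simp
  have hT : Twist c a := ⟨hc, (hc'.mul hδq.inv).congr htw⟩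
  refine ⟨fun m => δ m * pairSign a m, hδq.mul (quarticInvariant_pairSign a), fun m hm => ?_⟩
  cases ho : oddN m with
  | true => rw [hc.odd m hm ho, hc'.odd m hm ho, mul_zero]
  | false =>
    dsimp only
    rw [← hT.eq_pairSign ha0 hm ho, mul_assoc, htw m hm, mul_inv_cancel_left₀ (hδq.ne_zero m)]

/-- Entire functions satisfying Riemann's formula, with nonvanishing even constants. -/
structure ThetaSystem (F : ℕ → (Fin 3 → ℂ) → ℂ) : Prop where
  diff : ∀ k, Differentiable ℂ (F k)
  neg : ∀ k z, F k (-z) = (boolSign (oddN k) : ℂ) * F k z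
  riemann : ∀ m < 64, ∀ d < 64, ∀ e < 64, ∀ u1 u2 u3 u4 : Fin 3 → ℂ,
    8 * (F m u1 * F (m ^^^ d) u2 * (F (m ^^^ e) u3 * F (m ^^^ d ^^^ e) u4))
      = ∑ n ∈ Finset.range 64, (boolSign (riemannSign m n d e) : ℂ) *
        (F n ((1 / 2 : ℂ) • (u1 + u2 + u3 + u4)) * F (n ^^^ d) ((1 / 2 : ℂ) • (u1 + u2 - u3 - u4)) *
          (F (n ^^^ e) ((1 / 2 : ℂ) • (u1 - u2 + u3 - u4)) *
            F (n ^^^ d ^^^ e) ((1 / 2 : ℂ) • (u1 - u2 - u3 + u4))))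
  ne_zero : ∀ k < 64, oddN k = false → F k 0 ≠ 0

lemma thetaSystem_thetaN {τ : Matrix (Fin 3) (Fin 3) ℂ} (hτ : IsSiegel τ)
    (h0 : ∀ k < 64, oddN k = false → thetaN τ k 0 ≠ 0) : ThetaSystem (thetaN τ) where
  diff := differentiable_thetaN hτ
  neg := thetaN_neg τ
  riemann m _ d _ e _ := riemann_formula hτ m d e
  ne_zero := h0

lemma ThetaSystem.twist {F : ℕ → (Fin 3 → ℂ) → ℂ} (hF : ThetaSystem F) {δ : ℕ → ℂ}
    (hδ : QuarticInvariant δ) : ThetaSystem fun k z => δ k * F k z where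
  diff k := (hF.diff k).const_mul _
  neg k z := by rw [hF.neg]; ring
  riemann m hm d hd e he u1 u2 u3 u4 := by
    have h1 := hF.riemann m hm d hd e he u1 u2 u3 u4
    have h2 : ∀ n (a b c d' : ℂ), δ n * a * (δ (n ^^^ d) * b) * (δ (n ^^^ e) * c *
        (δ (n ^^^ d ^^^ e) * d')) = quad δ d e 0 * (a * b * (c * d')) := fun n a b c d' => by
      rw [← hδ.quad_eq d e n, quad]; ring
    simp only [h2]
    rw [mul_left_comm, h1, Finset.mul_sum]
    exact Finset.sum_congr rfl fun n _ => by ring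
  ne_zero k hk he := mul_ne_zero (hδ.ne_zero k) (hF.ne_zero k hk he)

lemma ThetaSystem.comp {F : ℕ → (Fin 3 → ℂ) → ℂ} (hF : ThetaSystem F)
    (A : (Fin 3 → ℂ) →L[ℂ] (Fin 3 → ℂ)) : ThetaSystem fun k z => F k (A z) where
  diff k := (hF.diff k).comp A.differentiable
  neg k z := by rw [map_neg, hF.neg]
  riemann m hm d hd e he u1 u2 u3 u4 := by
    simp only [map_smul, map_add, map_sub]
    exact hF.riemann m hm d hd e he _ _ _ _
  ne_zero k hk he := by rw [map_zero]; exact hF.ne_zero k hk he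

section

variable {F : ℕ → (Fin 3 → ℂ) → ℂ}

lemma ThetaSystem.odd_zero (hF : ThetaSystem F) {k : ℕ} (ho : oddN k = true) : F k 0 = 0 := by
  have := hF.neg k 0
  rw [neg_zero, ho] at this
  simp only [boolSign, if_true, Int.cast_neg, Int.cast_one] at this
  have h2 : (2 : ℂ) * F k 0 = 0 := by linear_combination this
  simpa using h2

lemma ThetaSystem.constSystem (hF : ThetaSystem F) : ConstSystem fun k => F k 0 where
  odd k _ ho := hF.odd_zero ho
  even := hF.ne_zero
  rel m hm d hd e he := by simpa [quad] using hF.riemann m hm d hd e he 0 0 0 0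

lemma ThetaSystem.hasDerivAt (hF : ThetaSystem F) (k : ℕ) (x v : Fin 3 → ℂ) :
    HasDerivAt (fun t : ℂ => F k (x + t • v)) (fderiv ℂ (F k) x v) 0 := by
  have h1 : HasDerivAt (fun t : ℂ => x + t • v) v 0 := by
    simpa using ((hasDerivAt_id (0 : ℂ)).smul_const v).const_add x
  have h2 : HasFDerivAt (F k) (fderiv ℂ (F k) x) (x + (0 : ℂ) • v) := by
    simpa using (hF.diff k x).hasFDerivAt
  exact h2.comp_hasDerivAt 0 h1

lemma ThetaSystem.grad_even (hF : ThetaSystem F) {k : ℕ} (he : oddN k = false) :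
    fderiv ℂ (F k) 0 = 0 := by
  ext1 v
  have h1 := hF.hasDerivAt k 0 v
  have h2 := hF.hasDerivAt k 0 (-v)
  have h3 : (fun t : ℂ => F k (0 + t • -v)) = fun t => F k (0 + t • v) := by
    funext t
    rw [smul_neg, zero_add, zero_add, hF.neg, he]
    simp [boolSign]
  rw [h3] at h2
  have := h1.unique h2
  rw [map_neg] at this
  have h4 : (2 : ℂ) * fderiv ℂ (F k) 0 v = 0 := by linear_combination this
  simpa using h4

/-- The derivative of the product over a coset in all of its factors. -/
def gradQuad (c y : ℕ → ℂ) (d e n : ℕ) : ℂ :=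
  (y n * c (n ^^^ d) + c n * y (n ^^^ d)) * (c (n ^^^ e) * c (n ^^^ d ^^^ e)) +
    c n * c (n ^^^ d) * (y (n ^^^ e) * c (n ^^^ d ^^^ e) + c (n ^^^ e) * y (n ^^^ d ^^^ e))

lemma ThetaSystem.grad_rel (hF : ThetaSystem F) {m d e : ℕ} (hm : m < 64) (hd : d < 64)
    (he : e < 64) (v : Fin 3 → ℂ) :
    16 * (fderiv ℂ (F m) 0 v * F (m ^^^ d) 0 * (F (m ^^^ e) 0 * F (m ^^^ d ^^^ e) 0))
      = ∑ n ∈ Finset.range 64, (boolSign (riemannSign m n d e) : ℂ) *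
        gradQuad (fun k => F k 0) (fun k => fderiv ℂ (F k) 0 v) d e n := by
  have h0 : ∀ k, HasDerivAt (fun t : ℂ => F k ((1 / 2 : ℂ) • (t • v)))
      ((1 / 2 : ℂ) * fderiv ℂ (F k) 0 v) 0 := fun k => by
    have := hF.hasDerivAt k 0 ((1 / 2 : ℂ) • v)
    simp only [zero_add, map_smul, smul_eq_mul] at this
    have h : (fun t : ℂ => F k ((1 / 2 : ℂ) • (t • v))) =
        fun t => F k (t • ((1 / 2 : ℂ) • v)) := by
      funext t
      rw [smul_comm]
    rwa [h]
  have h1 : HasDerivAt (fun t : ℂ => F m (t • v)) (fderiv ℂ (F m) 0 v) 0 := by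
    simpa using hF.hasDerivAt m 0 v
  have hl := (((h1.mul_const (F (m ^^^ d) 0)).mul_const
    (F (m ^^^ e) 0 * F (m ^^^ d ^^^ e) 0)).const_mul 8)
  have hr := HasDerivAt.fun_sum (u := Finset.range 64) fun n _ =>
    ((((h0 n).fun_mul (h0 (n ^^^ d))).fun_mul ((h0 (n ^^^ e)).fun_mul
      (h0 (n ^^^ d ^^^ e)))).const_mul
      (boolSign (riemannSign m n d e) : ℂ))
  have heq : (fun t : ℂ => 8 * (F m (t • v) * F (m ^^^ d) 0 *
      (F (m ^^^ e) 0 * F (m ^^^ d ^^^ e) 0))) = fun t => ∑ n ∈ Finset.range 64,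
      (boolSign (riemannSign m n d e) : ℂ) * (F n ((1 / 2 : ℂ) • (t • v)) *
        F (n ^^^ d) ((1 / 2 : ℂ) • (t • v)) * (F (n ^^^ e) ((1 / 2 : ℂ) • (t • v)) *
          F (n ^^^ d ^^^ e) ((1 / 2 : ℂ) • (t • v)))) := by
    funext t
    simpa only [add_zero, sub_zero] using hF.riemann m hm d hd e he (t • v) 0 0 0
  rw [heq] at hl
  have := hl.unique hr
  simp only [zero_smul, smul_zero] at this
  calc _ = 2 * _ := by ring
    _ = 2 * _ := congrArg _ this
    _ = _ := by
      rw [Finset.mul_sum]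
      exact Finset.sum_congr rfl fun n _ => by rw [gradQuad]; ring

lemma ThetaSystem.deriv_rel (hF : ThetaSystem F) {m d e : ℕ} (hm : m < 64) (hd : d < 64)
    (he : e < 64)
    (x v : Fin 3 → ℂ) :
    8 * ((fderiv ℂ (F m) x v * F (m ^^^ d) x - F m x * fderiv ℂ (F (m ^^^ d)) x v) *
        (F (m ^^^ e) 0 * F (m ^^^ d ^^^ e) 0))
      = ∑ n ∈ Finset.range 64, (boolSign (riemannSign m n d e) : ℂ) *
        (F n x * F (n ^^^ d) x * (fderiv ℂ (F (n ^^^ e)) 0 v * F (n ^^^ d ^^^ e) 0 +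
          F (n ^^^ e) 0 * fderiv ℂ (F (n ^^^ d ^^^ e)) 0 v)) := by
  have h0 : ∀ k, HasDerivAt (fun t : ℂ => F k (t • v)) (fderiv ℂ (F k) 0 v) 0 := fun k => by
    simpa using hF.hasDerivAt k 0 v
  have h1 := hF.hasDerivAt m x v
  have h2 := hF.hasDerivAt (m ^^^ d) x (-v)
  have hl := ((h1.fun_mul h2).mul_const (F (m ^^^ e) 0 * F (m ^^^ d ^^^ e) 0)).const_mul 8
  have hr := HasDerivAt.fun_sum (u := Finset.range 64) fun n _ =>
    ((((h0 (n ^^^ e)).fun_mul (h0 (n ^^^ d ^^^ e))).const_mul (F n x * F (n ^^^ d) x)).const_mul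
      (boolSign (riemannSign m n d e) : ℂ))
  have heq : (fun t : ℂ => 8 * (F m (x + t • v) * F (m ^^^ d) (x + t • -v) *
      (F (m ^^^ e) 0 * F (m ^^^ d ^^^ e) 0))) = fun t => ∑ n ∈ Finset.range 64,
      (boolSign (riemannSign m n d e) : ℂ) * (F n x * F (n ^^^ d) x *
        (F (n ^^^ e) (t • v) * F (n ^^^ d ^^^ e) (t • v))) := by
    funext t
    have := hF.riemann m hm d hd e he (x + t • v) (x + t • -v) 0 0
    have e1 : (1 / 2 : ℂ) • (x + t • v + (x + t • -v)) = x := by module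
    have e2 : (1 / 2 : ℂ) • (x + t • v - (x + t • -v)) = t • v := by module
    simpa only [add_zero, sub_zero, e1, e2] using this
  rw [heq] at hl
  have := hl.unique hr
  simp only [zero_smul, map_neg, add_zero] at this
  rw [← this]
  ring

end

lemma gradQuad_xor_left (c y : ℕ → ℂ) (d e n : ℕ) :
    gradQuad c y d e (n ^^^ d) = gradQuad c y d e n := by
  simp only [gradQuad, Nat.xor_assoc, Nat.xor_self, Nat.xor_zero]
  ring

lemma gradQuad_xor_right (c y : ℕ → ℂ) (d e n : ℕ) :
    gradQuad c y d e (n ^^^ e) = gradQuad c y d e n := by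
  have h : n ^^^ e ^^^ d ^^^ e = n ^^^ d := by
    rw [Nat.xor_right_comm n e d, Nat.xor_assoc, Nat.xor_self, Nat.xor_zero]
  simp only [gradQuad, h]
  rw [Nat.xor_right_comm n e d, Nat.xor_assoc n e e, Nat.xor_self, Nat.xor_zero]
  ring

/-- Exactly one member of the coset of `n` is odd. -/
def oneOdd (d e n : ℕ) : Bool :=
  (oddN n).toNat + (oddN (n ^^^ d)).toNat + (oddN (n ^^^ e)).toNat +
    (oddN (n ^^^ d ^^^ e)).toNat == 1

/-- The linear relations satisfied by derivatives at the origin, relative to the constants `c`. -/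
structure GradSystem (c y : ℕ → ℂ) : Prop where
  even : ∀ k < 64, oddN k = false → y k = 0
  rel : ∀ m < 64, ∀ d < 64, ∀ e < 64,
    16 * (y m * c (m ^^^ d) * (c (m ^^^ e) * c (m ^^^ d ^^^ e)))
      = ∑ n ∈ Finset.range 64, (boolSign (riemannSign m n d e) : ℂ) * gradQuad c y d e n

lemma ThetaSystem.gradSystem {F : ℕ → (Fin 3 → ℂ) → ℂ} (hF : ThetaSystem F) (v : Fin 3 → ℂ) :
    GradSystem (fun k => F k 0) (fun k => fderiv ℂ (F k) 0 v) where
  even k _ he := by rw [hF.grad_even he]; rfl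
  rel _ hm _ hd _ he := hF.grad_rel hm hd he v

section

variable {c y : ℕ → ℂ}

lemma ConstSystem.gradQuad_of_odd (hc : ConstSystem c) {m : ℕ} (hm : m < 64)
    (ho : oddN m = true) (d e : ℕ) :
    gradQuad c y d e m = y m * c (m ^^^ d) * (c (m ^^^ e) * c (m ^^^ d ^^^ e)) := by
  simp [gradQuad, hc.odd m hm ho]

lemma GradSystem.gradQuad_eq_zero (hc : ConstSystem c) (hy : GradSystem c y)
    {d e n : ℕ} (hd : d < 64) (he : e < 64) (hn : n < 64)
    (h : oneOdd d e n = false) : gradQuad c y d e n = 0 := by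
  have key : ∀ k < 64, (oddN k = true ∧ c k = 0) ∨ (oddN k = false ∧ y k = 0) := fun k hk => by
    cases ho : oddN k with
    | true => exact .inl ⟨rfl, hc.odd k hk ho⟩
    | false => exact .inr ⟨rfl, hy.even k hk ho⟩
  rw [oneOdd] at h
  rw [gradQuad]
  rcases key n hn with ⟨h1, e1⟩ | ⟨h1, e1⟩ <;>
    rcases key _ (xor_lt_64 hn hd) with ⟨h2, e2⟩ | ⟨h2, e2⟩ <;>
    rcases key _ (xor_lt_64 hn he) with ⟨h3, e3⟩ | ⟨h3, e3⟩ <;>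
    rcases key _ (xor_lt_64 (xor_lt_64 hn hd) he) with ⟨h4, e4⟩ | ⟨h4, e4⟩ <;>
    first
    | (rw [h1, h2, h3, h4] at h; exact absurd h (by decide))
    | simp [e1, e2, e3, e4]

/-- The step `(d, e, x, l)` deduces the vanishing of `y x` from that of `y` on `l`. -/
def isGradStep (known : List ℕ) (s : ℕ × ℕ × ℕ × List (ℕ × ℤ)) : Bool :=
  s.1 < 64 && s.2.1 < 64 && s.2.2.1 < 64 && oddN s.2.2.1 && oneOdd s.1 s.2.1 s.2.2.1 &&
  (s.2.2.2.all fun t => t.1 < 64 && oddN t.1 && known.contains t.1) &&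
  isConsequence 16 s.1 s.2.1 (oneOdd s.1 s.2.1) ((s.2.2.1, 1) :: s.2.2.2)
    ((s.2.2.1, -24) :: s.2.2.2.map fun t => (t.1, -24 * t.2))

lemma GradSystem.eq_zero_of_isGradStep (hc : ConstSystem c) (hy : GradSystem c y)
    {known : List ℕ} {s : ℕ × ℕ × ℕ × List (ℕ × ℤ)}
    (hs : isGradStep known s = true) (hk : ∀ k ∈ known, y k = 0) : y s.2.2.1 = 0 := by
  obtain ⟨d, e, x, l⟩ := s
  simp only [isGradStep, Bool.and_eq_true, decide_eq_true_eq, List.all_eq_true, and_assoc,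
    List.contains_iff_mem] at hs
  obtain ⟨hd, he, hx, hxo, hx1, hl, hchk⟩ := hs
  have hrow : ∀ m < 64, oddN m = true → ((16 : ℤ) : ℂ) * gradQuad c y d e m
      = ∑ n ∈ Finset.range 64, (boolSign (riemannSign m n d e) : ℂ) * gradQuad c y d e n :=
    fun m hm ho => by
      rw [← hy.rel m hm d hd e he, hc.gradQuad_of_odd hm ho]
      norm_num
  have h := relation_of_isConsequence hd he (fun n _ => gradQuad_xor_left c y d e n)
    (fun n _ => gradQuad_xor_right c y d e n)
    (fun _ hn h => hy.gradQuad_eq_zero hc hd he hn h) _ _ (fun r hr => ?_) (fun r hr => ?_) hchk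
  · have hl0 : ((l.map fun t => (t.1, -24 * t.2)).map fun t : ℕ × ℤ =>
        (t.2 : ℂ) * gradQuad c y d e t.1).sum = 0 := by
      refine List.sum_eq_zero fun z hz => ?_
      simp only [List.map_map, List.mem_map, Function.comp] at hz
      obtain ⟨t, ht, rfl⟩ := hz
      obtain ⟨ht1, ht2, ht3⟩ := hl t ht
      simp [hc.gradQuad_of_odd ht1 ht2, hk _ ht3]
    rw [List.map_cons, List.sum_cons, hl0, add_zero, hc.gradQuad_of_odd hx hxo] at h
    have hev : ∀ k < 64, oddN k = false → c k ≠ 0 := hc.even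
    rw [oneOdd, hxo, beq_iff_eq] at hx1
    have hz : ∀ b : Bool, b.toNat = 0 → b = false := by decide
    simp only [Bool.toNat_true] at hx1
    have h2 := hev _ (xor_lt_64 hx hd) (hz _ (by omega))
    have h3 := hev _ (xor_lt_64 hx he) (hz _ (by omega))
    have h4 := hev _ (xor_lt_64 (xor_lt_64 hx hd) he) (hz _ (by omega))
    simpa [h2, h3, h4] using h
  · rcases List.mem_cons.1 hr with rfl | hr
    · exact ⟨hx, hrow x hx hxo⟩
    · exact ⟨(hl r hr).1, hrow _ (hl r hr).1 (hl r hr).2.1⟩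
  · rcases List.mem_cons.1 hr with rfl | hr
    · exact hx
    · obtain ⟨t, ht, rfl⟩ := List.mem_map.1 hr
      exact (hl t ht).1

end

/-- Checks that each step only uses what is known before it. -/
def isGradChain : List ℕ → List (ℕ × ℕ × ℕ × List (ℕ × ℤ)) → Bool
  | _, [] => true
  | known, s :: l => isGradStep known s && isGradChain (s.2.2.1 :: known) l

lemma GradSystem.eq_zero_of_isGradChain {c y : ℕ → ℂ} (hc : ConstSystem c) (hy : GradSystem c y)
    (l : List (ℕ × ℕ × ℕ × List (ℕ × ℤ))) (known : List ℕ) (hl : isGradChain known l = true)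
    (hk : ∀ k ∈ known, y k = 0) : ∀ k ∈ l.map (fun s => s.2.2.1), y k = 0 := by
  induction l generalizing known with
  | nil => simp
  | cons s l ih =>
    rw [isGradChain, Bool.and_eq_true] at hl
    have h0 := hy.eq_zero_of_isGradStep hc hl.1 hk
    rw [List.map_cons, List.forall_mem_cons]
    refine ⟨h0, ih _ hl.2 ?_⟩
    rw [List.forall_mem_cons]
    exact ⟨h0, hk⟩

/-- Relations between odd gradients, starting from the characteristics `9`, `11`, `18`. -/
def gradChain : List (ℕ × ℕ × ℕ × List (ℕ × ℤ)) :=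
  [(3, 9, 52, [(9, -1), (11, 1), (18, 1)]),
   (3, 12, 23, [(9, -1), (11, 1), (52, 1)]),
   (3, 13, 51, [(9, -1), (11, 1), (18, 1)]),
   (5, 8, 25, [(9, -1), (11, 1), (51, 1)]),
   (5, 9, 50, [(9, -1), (11, 1), (25, 1)]),
   (5, 9, 29, [(9, -1), (11, 1), (52, 1)]),
   (5, 10, 26, [(9, -1), (11, 1), (50, 1)]),
   (5, 10, 30, [(9, -1), (11, 1), (52, 1)]),
   (5, 11, 53, [(9, -1), (11, 1), (30, 1)]),
   (5, 24, 13, [(9, -1), (50, -1), (53, 1)]),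
   (5, 24, 38, [(9, 1), (25, -1), (30, 1)]),
   (5, 24, 37, [(9, -1), (26, -1), (29, 1)]),
   (5, 25, 39, [(9, 1), (25, -1), (30, 1)]),
   (5, 25, 36, [(9, -1), (26, -1), (29, 1)]),
   (5, 26, 15, [(11, -1), (36, -1), (39, 1)]),
   (6, 24, 22, [(18, -1), (37, -1), (38, 1)]),
   (6, 24, 41, [(18, 1), (25, 1), (26, -1)]),
   (6, 24, 46, [(18, -1), (29, -1), (30, 1)]),
   (6, 25, 19, [(23, -1), (36, 1), (39, -1)]),
   (6, 26, 43, [(18, 1), (25, 1), (26, -1)]),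
   (6, 26, 44, [(18, -1), (29, -1), (30, 1)]),
   (7, 8, 57, [(9, -1), (11, 1), (19, 1)]),
   (7, 8, 63, [(9, -1), (11, 1), (23, 1)]),
   (7, 10, 58, [(9, -1), (11, 1), (18, 1)]),
   (7, 10, 60, [(9, -1), (11, 1), (22, 1)])]

lemma gradChain_isGradChain : isGradChain [9, 11, 18] gradChain = true := by decide +kernel

lemma gradChain_covers : ∀ k < 64, oddN k = true →
    k ∈ [9, 11, 18] ∨ k ∈ gradChain.map fun s => s.2.2.1 := by decide +kernel

/-- The three base odd characteristics. -/
def baseOdd : Fin 3 → ℕ := ![9, 11, 18]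

lemma GradSystem.eq_zero {c y : ℕ → ℂ} (hc : ConstSystem c) (hy : GradSystem c y)
    (h0 : ∀ i, y (baseOdd i) = 0) {k : ℕ} (hk : k < 64) : y k = 0 := by
  have hb : ∀ k ∈ [9, 11, 18], y k = 0 := by
    simpa [Fin.forall_fin_succ, baseOdd] using h0
  cases ho : oddN k with
  | false => exact hy.even k hk ho
  | true =>
    rcases gradChain_covers k hk ho with h | h
    · exact hb k h
    · exact hy.eq_zero_of_isGradChain hc _ _ gradChain_isGradChain hb k h

lemma GradSystem.sub {c y y' : ℕ → ℂ} (hy : GradSystem c y) (hy' : GradSystem c y') :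
    GradSystem c fun k => y k - y' k where
  even k hk he := by rw [hy.even k hk he, hy'.even k hk he, sub_zero]
  rel m hm d hd e he := by
    have h : ∀ n, gradQuad c (fun k => y k - y' k) d e n
        = gradQuad c y d e n - gradQuad c y' d e n := fun n => by simp only [gradQuad]; ring
    simp only [h, mul_sub, Finset.sum_sub_distrib]
    rw [← hy.rel m hm d hd e he, ← hy'.rel m hm d hd e he]
    ring

lemma GradSystem.congr {c c' y : ℕ → ℂ} (hy : GradSystem c y) (h : ∀ k < 64, c' k = c k) :
    GradSystem c' y where
  even := hy.even
  rel m hm d hd e he := by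
    have hx : ∀ n < 64, gradQuad c' y d e n = gradQuad c y d e n := fun n hn => by
      simp only [gradQuad, h n hn, h _ (xor_lt_64 hn hd), h _ (xor_lt_64 hn he),
        h _ (xor_lt_64 (xor_lt_64 hn hd) he)]
    rw [h _ (xor_lt_64 hm hd), h _ (xor_lt_64 hm he), h _ (xor_lt_64 (xor_lt_64 hm hd) he),
      hy.rel m hm d hd e he]
    exact Finset.sum_congr rfl fun n hn => by rw [hx n (Finset.mem_range.1 hn)]

lemma eq_zero_of_mul_eq_zero_of_differentiable {f g : (Fin 3 → ℂ) → ℂ} (hf : Differentiable ℂ f)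
    (hg : Differentiable ℂ g) (h : ∀ z, f z * g z = 0) {x : Fin 3 → ℂ} (hx : g x ≠ 0)
    (z : Fin 3 → ℂ) : f z = 0 := by
  have hline : Differentiable ℂ fun t : ℂ => x + t • (z - x) := by fun_prop
  have an : ∀ k : (Fin 3 → ℂ) → ℂ, Differentiable ℂ k →
      AnalyticOnNhd ℂ (fun t : ℂ => k (x + t • (z - x))) Set.univ := fun k hk =>
    (hk.comp hline).differentiableOn.analyticOnNhd isOpen_univ
  rcases (an f hf).eq_zero_or_eq_zero_of_mul_eq_zero (an g hg) (fun t _ => h _)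
    isPreconnected_univ with h1 | h1
  · simpa using h1 1 trivial
  · exact absurd (by simpa using h1 0 trivial) hx

lemma ThetaSystem.zero_ne_zero {F : ℕ → (Fin 3 → ℂ) → ℂ} (hF : ThetaSystem F) : F 0 0 ≠ 0 :=
  hF.ne_zero 0 (by norm_num) (by decide)

lemma ThetaSystem.exists_ne_zero {F : ℕ → (Fin 3 → ℂ) → ℂ} (hF : ThetaSystem F) (z : Fin 3 → ℂ) :
    ∃ n < 64, F n z ≠ 0 := by
  by_contra! hz
  have h : ∀ y, F 0 (z + y) * F 0 (z - y) = 0 := fun y => by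
    have := hF.riemann 0 (by norm_num) 0 (by norm_num) 0 (by norm_num) (z + y) (z - y) 0 0
    have e1 : (1 / 2 : ℂ) • (z + y + (z - y)) = z := by module
    have hz' : ∀ n ∈ Finset.range 64, F n z = 0 := fun n hn => hz n (Finset.mem_range.1 hn)
    simp only [add_zero, sub_zero, Nat.xor_zero, e1] at this
    rw [Finset.sum_eq_zero fun n hn => by rw [hz' n hn]; ring] at this
    simpa [hF.zero_ne_zero] using this
  have d0 := hF.diff 0
  refine hF.zero_ne_zero ?_
  have := eq_zero_of_mul_eq_zero_of_differentiable (f := fun y => F 0 (z + y))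
    (g := fun y => F 0 (z - y)) (by fun_prop) (by fun_prop) h (x := z)
    (by simpa using hF.zero_ne_zero) (-z)
  simpa using this

/-- The quadratic vector field satisfied by the quotients of theta functions along a line. -/
noncomputable def quotientField (w : ℕ → ℂ) (K : ℕ → ℕ → ℂ) (φ : Fin 64 → ℂ) (m : Fin 64) : ℂ :=
  w m * ∑ n : Fin 64, K m n * (φ n * φ ⟨n ^^^ m, xor_lt_64 n.2 m.2⟩)

lemma contDiff_quotientField (w : ℕ → ℂ) (K : ℕ → ℕ → ℂ) :
    ContDiff ℝ 1 (quotientField w K) := by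
  unfold quotientField
  fun_prop

lemma exists_even_pair : ∀ m < 64, ∃ e < 64, oddN e = false ∧ oddN (m ^^^ e) = false := by
  decide +kernel

/-- An auxiliary even characteristic whose translate by `m` is even. -/
noncomputable def evenPartner (m : ℕ) : ℕ :=
  if h : m < 64 then (exists_even_pair m h).choose else 0

lemma evenPartner_spec {m : ℕ} (hm : m < 64) :
    evenPartner m < 64 ∧ oddN (evenPartner m) = false ∧ oddN (m ^^^ evenPartner m) = false := by
  rw [evenPartner, dif_pos hm]
  exact (exists_even_pair m hm).choose_spec

/-- Coefficient of the quotient field in direction `v`. -/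
noncomputable def quotientWeight (F : ℕ → (Fin 3 → ℂ) → ℂ) (m : ℕ) : ℂ :=
  (8 * (F (m ^^^ evenPartner m) 0 * F (evenPartner m) 0))⁻¹

/-- Coefficients of the quotient field in direction `v`. -/
noncomputable def quotientCoeff (F : ℕ → (Fin 3 → ℂ) → ℂ) (v : Fin 3 → ℂ) (m n : ℕ) : ℂ :=
  (boolSign (riemannSign m n m (evenPartner m)) : ℂ) *
    (fderiv ℂ (F (n ^^^ evenPartner m)) 0 v * F (n ^^^ m ^^^ evenPartner m) 0 +
      F (n ^^^ evenPartner m) 0 * fderiv ℂ (F (n ^^^ m ^^^ evenPartner m)) 0 v)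

lemma ThetaSystem.hasDerivAt_quotient {F : ℕ → (Fin 3 → ℂ) → ℂ} (hF : ThetaSystem F)
    (v : Fin 3 → ℂ) (t : ℝ) (ht : F 0 ((t : ℂ) • v) ≠ 0) :
    HasDerivAt (fun s : ℝ => fun m : Fin 64 => F m ((s : ℂ) • v) / F 0 ((s : ℂ) • v))
      (quotientField (quotientWeight F) (quotientCoeff F v)
        fun m : Fin 64 => F m ((t : ℂ) • v) / F 0 ((t : ℂ) • v)) t := by
  rw [hasDerivAt_pi]
  intro m
  have hd : ∀ k, HasDerivAt (fun s : ℂ => F k (s • v)) (fderiv ℂ (F k) ((t : ℂ) • v) v) (t : ℂ) :=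
    fun k => by
      have h1 : HasDerivAt (fun s : ℂ => s • v) v (t : ℂ) := by
        simpa using (hasDerivAt_id (t : ℂ)).smul_const v
      exact ((hF.diff k _).hasFDerivAt.comp_hasDerivAt (t : ℂ) h1)
  have hq := ((hd m).fun_div (hd 0) ht).comp_ofReal
  refine hq.congr_deriv ?_
  obtain ⟨he, he1, he2⟩ := evenPartner_spec m.2
  have hrel := hF.deriv_rel m.2 m.2 he ((t : ℂ) • v) v
  have hc := mul_ne_zero (hF.ne_zero _ (xor_lt_64 m.2 he) he2) (hF.ne_zero _ he he1)
  rw [quotientField, quotientWeight]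
  simp only [Nat.xor_self, Nat.zero_xor] at hrel
  have hsum : ∑ n : Fin 64, quotientCoeff F v m n * (F n ((t : ℂ) • v) / F 0 ((t : ℂ) • v) *
      (F (n ^^^ m : ℕ) ((t : ℂ) • v) / F 0 ((t : ℂ) • v))) = (F 0 ((t : ℂ) • v) ^ 2)⁻¹ *
      ∑ n ∈ Finset.range 64, (boolSign (riemannSign m n m (evenPartner m)) : ℂ) *
        (F n ((t : ℂ) • v) * F (n ^^^ m) ((t : ℂ) • v) *
          (fderiv ℂ (F (n ^^^ evenPartner m)) 0 v * F (n ^^^ m ^^^ evenPartner m) 0 +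
            F (n ^^^ evenPartner m) 0 * fderiv ℂ (F (n ^^^ m ^^^ evenPartner m)) 0 v)) := by
    rw [Finset.mul_sum, ← Fin.sum_univ_eq_sum_range (fun n => (F 0 ((t : ℂ) • v) ^ 2)⁻¹ *
      ((boolSign (riemannSign m n m (evenPartner m)) : ℂ) *
        (F n ((t : ℂ) • v) * F (n ^^^ m) ((t : ℂ) • v) *
          (fderiv ℂ (F (n ^^^ evenPartner m)) 0 v * F (n ^^^ m ^^^ evenPartner m) 0 +
            F (n ^^^ evenPartner m) 0 * fderiv ℂ (F (n ^^^ m ^^^ evenPartner m)) 0 v)))) 64]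
    refine Finset.sum_congr rfl fun n _ => ?_
    rw [quotientCoeff]
    ring
  rw [hsum, ← hrel]
  have h8 : F (m ^^^ evenPartner m : ℕ) 0 ≠ 0 := left_ne_zero_of_mul hc
  have h9 : F (evenPartner m : ℕ) 0 ≠ 0 := right_ne_zero_of_mul hc
  field_simp

lemma ThetaSystem.mul_zero_eq {F H : ℕ → (Fin 3 → ℂ) → ℂ} (hF : ThetaSystem F)
    (hH : ThetaSystem H) (hc : ∀ k < 64, H k 0 = F k 0)
    (hg : ∀ k < 64, fderiv ℂ (H k) 0 = fderiv ℂ (F k) 0) {m : ℕ} (hm : m < 64) (z : Fin 3 → ℂ) :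
    F m z * H 0 z = H m z * F 0 z := by
  have hfield : ∀ φ : Fin 64 → ℂ, quotientField (quotientWeight H) (quotientCoeff H z) φ =
      quotientField (quotientWeight F) (quotientCoeff F z) φ := fun φ => by
    funext m
    have he := (evenPartner_spec m.2).1
    have h1 : quotientWeight H m = quotientWeight F m := by
      rw [quotientWeight, quotientWeight, hc _ he, hc _ (xor_lt_64 m.2 he)]
    have h2 : ∀ n : Fin 64, quotientCoeff H z m n = quotientCoeff F z m n := fun n => by
      have e1 := xor_lt_64 n.2 he
      have e2 := xor_lt_64 (xor_lt_64 n.2 m.2) he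
      rw [quotientCoeff, quotientCoeff, hc _ e1, hc _ e2, hg _ e1, hg _ e2]
    simp only [quotientField, h1, h2]
  let φ : ((ℕ → (Fin 3 → ℂ) → ℂ)) → ℝ → Fin 64 → ℂ := fun F s m =>
    F m ((s : ℂ) • z) / F 0 ((s : ℂ) • z)
  obtain ⟨K, S, hS, hK⟩ := (contDiff_quotientField (quotientWeight F)
    (quotientCoeff F z)).contDiffAt (x := φ F 0).exists_lipschitzOnWith
  have hev : ∀ G : ℕ → (Fin 3 → ℂ) → ℂ, ThetaSystem G → φ G 0 = φ F 0 →
      ∀ᶠ t : ℝ in nhds 0, G 0 ((t : ℂ) • z) ≠ 0 ∧ φ G t ∈ S := fun G hG h0 => by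
    have h1 : Continuous fun t : ℝ => G 0 ((t : ℂ) • z) :=
      (hG.diff 0).continuous.comp (by fun_prop)
    have hne : G 0 (((0 : ℝ) : ℂ) • z) ≠ 0 := by simpa using hG.zero_ne_zero
    refine (h1.continuousAt.eventually_ne hne).and ?_
    have h2 := (hG.hasDerivAt_quotient z 0 hne).continuousAt
    exact h2.eventually (by rw [← h0] at hS; exact hS)
  have h0 : φ H 0 = φ F 0 := by
    funext m
    simp [φ, hc m m.2, hc 0 (by norm_num)]
  have huniq : φ F =ᶠ[nhds 0] φ H := by
    refine ODE_solution_unique_of_eventually (t₀ := 0) (f := φ F) (g := φ H) (K := K)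
      (v := fun _ => quotientField (quotientWeight F) (quotientCoeff F z)) (s := fun _ => S)
      (.of_forall fun _ => hK) ?_ ?_ h0.symm
    · exact (hev F hF rfl).mono fun t ht => ⟨hF.hasDerivAt_quotient z t ht.1, ht.2⟩
    · exact (hev H hH h0).mono fun t ht =>
        ⟨hfield _ ▸ hH.hasDerivAt_quotient z t ht.1, ht.2⟩
  have an : ∀ k : (Fin 3 → ℂ) → ℂ, Differentiable ℂ k →
      AnalyticOnNhd ℂ (fun t : ℂ => k (t • z)) Set.univ := fun k hk =>
    (hk.comp (by fun_prop : Differentiable ℂ fun t : ℂ => t • z)).differentiableOn.analyticOnNhd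
      isOpen_univ
  have hreal : ∀ᶠ t : ℝ in nhds 0,
      F m ((t : ℂ) • z) * H 0 ((t : ℂ) • z) = H m ((t : ℂ) • z) * F 0 ((t : ℂ) • z) := by
    filter_upwards [huniq, hev F hF rfl, hev H hH h0] with t h1 h2 h3
    have := congrFun h1 ⟨m, hm⟩
    simp only [φ] at this
    rwa [div_eq_div_iff h2.1 h3.1] at this
  have hfreq : ∃ᶠ t : ℂ in nhdsWithin 0 {0}ᶜ,
      F m (t • z) * H 0 (t • z) = H m (t • z) * F 0 (t • z) := by
    have ht : Filter.Tendsto (fun t : ℝ => (t : ℂ)) (nhdsWithin 0 {0}ᶜ) (nhdsWithin 0 {0}ᶜ) :=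
      tendsto_nhdsWithin_of_tendsto_nhds_of_eventually_within _
        ((Complex.continuous_ofReal.tendsto' 0 0 rfl).mono_left nhdsWithin_le_nhds)
        (eventually_mem_nhdsWithin.mono fun t ht => by simpa using ht)
    exact ht.frequently (hreal.filter_mono nhdsWithin_le_nhds).frequently
  have := congrFun (((an _ (hF.diff m)).mul (an _ (hH.diff 0))).eq_of_frequently_eq
    ((an _ (hH.diff m)).mul (an _ (hF.diff 0))) hfreq) 1
  simpa using this

/-- Two families without common zeros and with the same quotients differ by an entire factor. -/
lemma exists_factor {F H : ℕ → (Fin 3 → ℂ) → ℂ} (dF : ∀ k, Differentiable ℂ (F k))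
    (dH : ∀ k, Differentiable ℂ (H k)) (hF : ∀ z, ∃ n < 64, F n z ≠ 0)
    (hH : ∀ z, ∃ n < 64, H n z ≠ 0) {x : Fin 3 → ℂ} (hx : F 0 x ≠ 0)
    (h0 : ∀ k < 64, ∀ z, F k z * H 0 z = H k z * F 0 z) :
    ∃ h : (Fin 3 → ℂ) → ℂ, Differentiable ℂ h ∧ (∀ z, h z ≠ 0) ∧
      ∀ k < 64, ∀ z, H k z = h z * F k z := by
  have hmn : ∀ m < 64, ∀ n < 64, ∀ z, F m z * H n z = F n z * H m z := fun m hm n hn z => by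
    have dm := dF m
    have dn := dF n
    have em := dH m
    have en := dH n
    have := eq_zero_of_mul_eq_zero_of_differentiable (f := fun z => F m z * H n z - F n z * H m z)
      (g := F 0) (by fun_prop) (dF 0) (fun z => ?_) hx z
    · exact sub_eq_zero.1 this
    · linear_combination F n z * h0 m hm z - F m z * h0 n hn z
  choose n hn hnz using hF
  have hfac : ∀ k < 64, ∀ z, H k z = H (n z) z / F (n z) z * F k z := fun k hk z => by
    rw [div_mul_eq_mul_div, eq_div_iff (hnz z), mul_comm (H k z), hmn _ (hn z) k hk z, mul_comm]
  refine ⟨fun z => H (n z) z / F (n z) z, fun z => ?_, fun z h0 => ?_, hfac⟩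
  · have h1 : DifferentiableAt ℂ (fun x => H (n z) x / F (n z) x) z :=
      ((dH _ z).mul ((dF _ z).inv (hnz z))).congr_of_eventuallyEq
        (.of_forall fun x => div_eq_mul_inv _ _)
    refine h1.congr_of_eventuallyEq ?_
    filter_upwards [(dF (n z) z).continuousAt.eventually_ne (hnz z)] with x hx
    rw [eq_div_iff hx, ← hfac _ (hn z)]
  · obtain ⟨k, hk, hkz⟩ := hH z
    exact hkz (by rw [hfac k hk z, show H (n z) z / F (n z) z = 0 from h0, zero_mul])

/-- The point `τ a + b` with real coordinates `a`, `b`. -/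
noncomputable def realPoint (τ : Matrix (Fin 3) (Fin 3) ℂ) (a b : Fin 3 → ℝ) : Fin 3 → ℂ :=
  fun i => (∑ j, τ i j * a j) + b i

lemma realPoint_intCast (τ : Matrix (Fin 3) (Fin 3) ℂ) (p q : Fin 3 → ℤ) :
    realPoint τ (fun i => p i) (fun i => q i) = latticePoint τ p q := by
  funext i
  simp [realPoint, latticePoint]

lemma realPoint_add (τ : Matrix (Fin 3) (Fin 3) ℂ) (a b a' b' : Fin 3 → ℝ) :
    realPoint τ (a + a') (b + b') = realPoint τ a b + realPoint τ a' b' := by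
  funext i
  simp only [realPoint, Pi.add_apply, ofReal_add, mul_add, Finset.sum_add_distrib]
  ring

lemma IsSiegel.exists_realPoint {τ : Matrix (Fin 3) (Fin 3) ℂ} (hτ : IsSiegel τ) (z : Fin 3 → ℂ) :
    ∃ a b, realPoint τ a b = z := by
  set Y : Matrix (Fin 3) (Fin 3) ℝ := Matrix.of fun i j => (τ i j).im with hY
  have hdet : IsUnit Y.det := hτ.2.det_pos.ne'.isUnit
  set a : Fin 3 → ℝ := Y⁻¹ *ᵥ fun i => (z i).im with ha
  have hYa : Y *ᵥ a = fun i => (z i).im := by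
    rw [ha, Matrix.mulVec_mulVec, Matrix.mul_nonsing_inv _ hdet, Matrix.one_mulVec]
  refine ⟨a, fun i => (z i).re - ∑ j, (τ i j).re * a j, funext fun i => ?_⟩
  have him := congrFun hYa i
  simp only [Matrix.mulVec, dotProduct, hY, Matrix.of_apply] at him
  apply Complex.ext
  · simp [realPoint]
  · simpa [realPoint] using him

lemma chi_ne_zero (k : ℕ) (p q : Fin 3 → ℤ) : chi k p q ≠ 0 := by
  refine Finset.prod_ne_zero_iff.2 fun i _ => ?_
  have h : ∀ n : ℤ, ((-1 : ℂ)) ^ n ≠ 0 := fun n => zpow_ne_zero _ (by norm_num)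
  split_ifs <;> simp [h]

/-- A function whose absolute value is invariant under the lattice is constant. -/
lemma IsSiegel.eq_of_norm_periodic {τ : Matrix (Fin 3) (Fin 3) ℂ} (hτ : IsSiegel τ)
    {f : (Fin 3 → ℂ) → ℂ} (hf : Differentiable ℂ f)
    (hp : ∀ z p q, ‖f (z + latticePoint τ p q)‖ = ‖f z‖) (z w : Fin 3 → ℂ) : f z = f w := by
  have hcont : Continuous fun x : (Fin 3 → ℝ) × (Fin 3 → ℝ) => f (realPoint τ x.1 x.2) :=
    hf.continuous.comp (by unfold realPoint; fun_prop)
  obtain ⟨C, hC⟩ := ((isCompact_Icc (a := (0 : Fin 3 → ℝ)) (b := 1)).prod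
    (isCompact_Icc (a := (0 : Fin 3 → ℝ)) (b := 1))).exists_bound_of_continuousOn
      hcont.continuousOn
  refine hf.apply_eq_apply_of_bounded (isBounded_iff_forall_norm_le.2 ⟨C, ?_⟩) z w
  rintro _ ⟨z, rfl⟩
  obtain ⟨a, b, rfl⟩ := hτ.exists_realPoint z
  have hsplit : realPoint τ a b =
      realPoint τ (fun i => Int.fract (a i)) (fun i => Int.fract (b i)) +
      latticePoint τ (fun i => ⌊a i⌋) (fun i => ⌊b i⌋) := by
    rw [← realPoint_intCast, ← realPoint_add]
    congr 1 <;> funext i <;> simp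
  rw [hsplit, hp]
  exact hC (_, _) ⟨⟨fun i => Int.fract_nonneg _, fun i => (Int.fract_lt_one _).le⟩,
    ⟨fun i => Int.fract_nonneg _, fun i => (Int.fract_lt_one _).le⟩⟩

/-- The automorphy factor of theta functions for `τ p + q`, up to sign. -/
noncomputable def latticeFactor (τ : Matrix (Fin 3) (Fin 3) ℂ) (p : Fin 3 → ℤ)
    (z : Fin 3 → ℂ) : ℂ :=
  cexp (-((Real.pi : ℂ) * I * ∑ i, ∑ j, (p i : ℂ) * τ i j * p j)
        - 2 * (Real.pi : ℂ) * I * ∑ i, (p i : ℂ) * z i)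

lemma thetaN_add_lattice {τ : Matrix (Fin 3) (Fin 3) ℂ} (hτ : τ.IsSymm) (k : ℕ)
    (z : Fin 3 → ℂ) (p q : Fin 3 → ℤ) :
    thetaN τ k (z + latticePoint τ p q) = chi k p q * latticeFactor τ p z * thetaN τ k z :=
  thetaN_add_latticePoint hτ k z p q

lemma latticeFactor_add (τ : Matrix (Fin 3) (Fin 3) ℂ) (p : Fin 3 → ℤ) (z v : Fin 3 → ℂ) :
    latticeFactor τ p (z + v) =
      latticeFactor τ p z * cexp (-(2 * (Real.pi : ℂ) * I * ∑ i, (p i : ℂ) * v i)) := by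
  rw [latticeFactor, latticeFactor, ← Complex.exp_add]
  congr 1
  simp only [Pi.add_apply, mul_add, Finset.sum_add_distrib]
  ring

lemma exists_int_of_exp_two_pi {x : ℝ} (h : cexp (2 * (Real.pi : ℂ) * I * x) = 1) :
    ∃ n : ℤ, x = n := by
  obtain ⟨n, hn⟩ := Complex.exp_eq_one_iff.1 h
  refine ⟨n, ?_⟩
  have h2 : (2 * (Real.pi : ℂ) * I) ≠ 0 := Complex.two_pi_I_ne_zero
  have : (x : ℂ) = n := mul_left_cancel₀ h2 (by rw [hn]; ring)
  exact_mod_cast this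

lemma sum_mul_realPoint {τ : Matrix (Fin 3) (Fin 3) ℂ} (hτ : τ.IsSymm) (a b p q : Fin 3 → ℝ) :
    ∑ i, (a i : ℂ) * realPoint τ p q i - ∑ i, (p i : ℂ) * realPoint τ a b i =
      ((∑ i, a i * q i - ∑ i, p i * b i : ℝ) : ℂ) := by
  have s1 := hτ.apply 0 1
  have s2 := hτ.apply 0 2
  have s3 := hτ.apply 1 2
  simp only [Fin.sum_univ_three, realPoint, s1, s2, s3]
  push_cast
  ring

lemma eq_latticePoint_of_translate {τ : Matrix (Fin 3) (Fin 3) ℂ} (hτ : IsSiegel τ)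
    (hF : ThetaSystem (thetaN τ)) {σ : ℕ → ℂ} (hσ : ∀ k < 64, σ k ≠ 0)
    {h : (Fin 3 → ℂ) → ℂ} (hd : Differentiable ℂ h) {v : Fin 3 → ℂ}
    (hv : ∀ k < 64, ∀ z, thetaN τ k (z + v) = σ k * h z * thetaN τ k z) :
    ∃ p q, v = latticePoint τ p q ∧ ∀ z, ∀ k < 64, oddN k = false →
      σ k * h z = chi k p q * latticeFactor τ p z := by
  have hh : ∀ z p q, h (z + latticePoint τ p q) =
      h z * cexp (-(2 * (Real.pi : ℂ) * I * ∑ i, (p i : ℂ) * v i)) := fun z p q => by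
    obtain ⟨k, hk, hkz⟩ := hF.exists_ne_zero z
    have h1 := hv k hk (z + latticePoint τ p q)
    have h2 := thetaN_add_lattice hτ.1 k (z + v) p q
    rw [add_right_comm, h1, thetaN_add_lattice hτ.1, hv k hk z] at h2
    rw [latticeFactor_add] at h2
    have hne : σ k * chi k p q * latticeFactor τ p z * thetaN τ k z ≠ 0 :=
      mul_ne_zero (mul_ne_zero (mul_ne_zero (hσ k hk) (chi_ne_zero _ _ _))
        (Complex.exp_ne_zero _)) hkz
    exact mul_left_cancel₀ hne (by linear_combination h2)
  obtain ⟨a, b, hab⟩ := hτ.exists_realPoint v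
  set f : (Fin 3 → ℂ) → ℂ := fun z => h z * cexp (2 * (Real.pi : ℂ) * I * ∑ i, (a i : ℂ) * z i)
    with hf
  have hfp : ∀ z p q, f (z + latticePoint τ p q) = f z * cexp (2 * (Real.pi : ℂ) * I *
      ((∑ i, a i * q i - ∑ i, p i * b i : ℝ) : ℂ)) := fun z p q => by
    have hs := sum_mul_realPoint hτ.1 a b (fun i => p i) (fun i => q i)
    rw [realPoint_intCast, hab] at hs
    rw [← hs]
    simp only [hf, hh, mul_assoc (h z), ← Complex.exp_add, ofReal_intCast, Pi.add_apply, mul_add,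
      Finset.sum_add_distrib]
    congr 2
    ring
  have hfd : Differentiable ℂ f := by fun_prop
  have hconst := hτ.eq_of_norm_periodic hfd fun z p q => by
    have hn : ∀ r : ℝ, ‖cexp (2 * (Real.pi : ℂ) * I * r)‖ = 1 := fun r => by
      rw [show 2 * (Real.pi : ℂ) * I * r = ((2 * Real.pi * r : ℝ) : ℂ) * I by push_cast; ring,
        Complex.norm_exp_ofReal_mul_I]
    rw [hfp, norm_mul, hn, mul_one]
  have hf0 : f 0 ≠ 0 := fun h0 => by
    have := hv 0 (by norm_num) (-v)
    have h1 : h (-v) = 0 := by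
      have := hconst (-v) 0
      rw [h0] at this
      exact (mul_eq_zero.1 this).resolve_right (Complex.exp_ne_zero _)
    rw [neg_add_cancel, h1] at this
    exact hF.zero_ne_zero (by simpa using this)
  have hone : ∀ p q : Fin 3 → ℤ, ∃ n : ℤ, (∑ i, a i * q i - ∑ i, p i * b i : ℝ) = n := fun p q =>
    exists_int_of_exp_two_pi (mul_left_cancel₀ hf0 (by
      rw [mul_one, ← hfp 0 p q]; exact hconst _ _))
  have ha : ∀ i, ∃ n : ℤ, a i = n := fun i => by
    simpa [Pi.single_apply] using hone 0 (Pi.single i 1)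
  have hb : ∀ i, ∃ n : ℤ, b i = n := fun i => by
    obtain ⟨n, hn⟩ := hone (Pi.single i 1) 0
    exact ⟨-n, by simpa [Pi.single_apply, neg_eq_iff_eq_neg] using hn⟩
  choose p hp using ha
  choose q hq using hb
  have hvl : v = latticePoint τ p q := by
    rw [← hab, ← realPoint_intCast, funext hp, funext hq]
  refine ⟨p, q, hvl, fun z k hk he => ?_⟩
  have hz : ∀ z, h z = h 0 * cexp (-(2 * (Real.pi : ℂ) * I * ∑ i, (p i : ℂ) * z i)) := fun z => by
    have := hconst z 0
    simp only [hf, Pi.zero_apply, mul_zero, Finset.sum_const_zero, Complex.exp_zero, mul_one, hp,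
      ofReal_intCast] at this
    rw [← this, mul_assoc, ← Complex.exp_add, add_neg_cancel, Complex.exp_zero, mul_one]
  have h1 := hv k hk 0
  rw [hvl, thetaN_add_lattice hτ.1] at h1
  have h2 := mul_right_cancel₀ (hF.ne_zero k hk he) h1
  rw [hz, ← zero_add z, latticeFactor_add, ← mul_assoc, ← mul_assoc, h2, zero_add]

lemma ThetaSystem.translate_of_fderiv_eq_zero {F : ℕ → (Fin 3 → ℂ) → ℂ} (hF : ThetaSystem F)
    {v : Fin 3 → ℂ} (hv : ∀ k < 64, fderiv ℂ (F k) 0 v = 0) (t : ℂ) {k : ℕ} (hk : k < 64)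
    (z : Fin 3 → ℂ) : F k (z + t • v) * F 0 z = F k z * F 0 (z + t • v) := by
  have hw : ∀ x, fderiv ℂ (F k) x v * F 0 x - F k x * fderiv ℂ (F 0) x v = 0 := fun x => by
    obtain ⟨he, he1, he2⟩ := evenPartner_spec hk
    have h1 := hF.deriv_rel hk hk he x v
    rw [Finset.sum_eq_zero fun n hn => by
      have hn' := Finset.mem_range.1 hn
      rw [hv _ (xor_lt_64 hn' he), hv _ (xor_lt_64 (xor_lt_64 hn' hk) he)]
      ring] at h1
    simpa [hF.ne_zero _ he he1, hF.ne_zero _ (xor_lt_64 hk he) he2] using h1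
  have hdk := hF.diff k
  have hd0 := hF.diff 0
  have key : ∀ z, F 0 z ≠ 0 → F k (z + t • v) * F 0 z = F k z * F 0 (z + t • v) := fun z hz => by
    have hd : ∀ j (s : ℂ), HasDerivAt (fun s : ℂ => F j (z + s • v))
        (fderiv ℂ (F j) (z + s • v) v) s := fun j s => by
      have h1 : HasDerivAt (fun s : ℂ => z + s • v) v s := by
        simpa using ((hasDerivAt_id s).smul_const v).const_add z
      exact (hF.diff j _).hasFDerivAt.comp_hasDerivAt s h1
    have hne : F 0 (z + (0 : ℂ) • v) ≠ 0 := by simpa using hz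
    obtain ⟨ε, hε, hball⟩ := Metric.eventually_nhds_iff_ball.1
      ((hd 0 0).continuousAt.eventually_ne hne)
    have hq : ∀ s ∈ Metric.ball (0 : ℂ) ε,
        HasDerivAt (fun s => F k (z + s • v) / F 0 (z + s • v)) 0 s := fun s hs =>
      ((hd k s).fun_div (hd 0 s) (hball s hs)).congr_deriv (by rw [hw, zero_div])
    have hloc : ∀ s ∈ Metric.ball (0 : ℂ) ε,
        F k (z + s • v) * F 0 z = F k z * F 0 (z + s • v) := fun s hs => by
      have := Metric.isOpen_ball.is_const_of_deriv_eq_zero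
        (convex_ball (0 : ℂ) ε).isPreconnected
        (fun s hs => (hq s hs).differentiableAt.differentiableWithinAt)
        (fun s hs => (hq s hs).deriv) hs (Metric.mem_ball_self hε)
      simp only [zero_smul, add_zero] at this
      rwa [div_eq_div_iff (hball s hs) hz] at this
    have an : ∀ f : ℂ → ℂ, Differentiable ℂ f → AnalyticOnNhd ℂ f Set.univ := fun f hf =>
      hf.differentiableOn.analyticOnNhd isOpen_univ
    have := (an (fun s => F k (z + s • v) * F 0 z) (by fun_prop)).eq_of_eventuallyEq
      (an (fun s => F k z * F 0 (z + s • v)) (by fun_prop)) (z₀ := 0)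
      (Filter.eventually_of_mem (Metric.ball_mem_nhds 0 hε) hloc)
    exact congrFun this t
  refine sub_eq_zero.1 (eq_zero_of_mul_eq_zero_of_differentiable (g := F 0)
    (f := fun z => F k (z + t • v) * F 0 z - F k z * F 0 (z + t • v)) (by fun_prop) hd0
    (fun z => ?_) hF.zero_ne_zero z)
  by_cases hz : F 0 z = 0
  · rw [hz, mul_zero]
  · rw [key z hz, sub_self, zero_mul]

lemma eq_zero_of_fderiv_base_eq_zero {τ : Matrix (Fin 3) (Fin 3) ℂ} (hτ : IsSiegel τ)
    (hF : ThetaSystem (thetaN τ)) {v : Fin 3 → ℂ}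
    (hv : ∀ i, fderiv ℂ (thetaN τ (baseOdd i)) 0 v = 0) : v = 0 := by
  have hv' : ∀ k < 64, fderiv ℂ (thetaN τ k) 0 v = 0 := fun k hk =>
    (hF.gradSystem v).eq_zero hF.constSystem hv hk
  have hlat : ∀ t : ℂ, ∃ x : (Fin 3 → ℤ) × (Fin 3 → ℤ),
      t • v = latticePoint τ x.1 x.2 := fun t => by
    have hdiff : ∀ k, Differentiable ℂ fun z => thetaN τ k (z + t • v) := fun k => by
      have := hF.diff k
      fun_prop
    obtain ⟨h, hd, -, hh⟩ := exists_factor hF.diff hdiff hF.exists_ne_zero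
      (fun z => hF.exists_ne_zero _) hF.zero_ne_zero
      fun k hk z => (hF.translate_of_fderiv_eq_zero hv' t hk z).symm
    obtain ⟨p, q, hpq, -⟩ := eq_latticePoint_of_translate hτ hF (σ := fun _ => 1)
      (fun _ _ => one_ne_zero) hd fun k hk z => by rw [hh k hk z, one_mul]
    exact ⟨(p, q), hpq⟩
  by_contra hne
  choose x hx using hlat
  have hinj : Function.Injective x := fun s t hst => by
    refine smul_left_injective ℂ hne ?_
    simp only [hx, hst]
  exact not_countable_complex (Set.countable_univ_iff.2 hinj.countable)

lemma exists_linear_comparison {F H : ℕ → (Fin 3 → ℂ) → ℂ} (hF : ThetaSystem F)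
    (hH : ThetaSystem H) (hc : ∀ k < 64, H k 0 = F k 0)
    (iF : ∀ v, (∀ i, fderiv ℂ (F (baseOdd i)) 0 v = 0) → v = 0)
    (iH : ∀ v, (∀ i, fderiv ℂ (H (baseOdd i)) 0 v = 0) → v = 0) :
    ∃ (A : (Fin 3 → ℂ) ≃L[ℂ] (Fin 3 → ℂ)) (h : (Fin 3 → ℂ) → ℂ), Differentiable ℂ h ∧
      (∀ z, h z ≠ 0) ∧ ∀ k < 64, ∀ z, H k (A z) = h z * F k z := by
  have hequiv : ∀ G : ℕ → (Fin 3 → ℂ) → ℂ, (∀ v, (∀ i, fderiv ℂ (G (baseOdd i)) 0 v = 0) → v = 0) →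
      ∃ L : (Fin 3 → ℂ) ≃ₗ[ℂ] (Fin 3 → ℂ), ∀ v i, L v i = fderiv ℂ (G (baseOdd i)) 0 v :=
    fun G hG => by
      let f : (Fin 3 → ℂ) →ₗ[ℂ] (Fin 3 → ℂ) := LinearMap.pi fun i =>
        (fderiv ℂ (G (baseOdd i)) 0).toLinearMap
      have hf : Function.Injective f := (injective_iff_map_eq_zero f).2 fun v hv =>
        hG v fun i => congrFun hv i
      exact ⟨LinearEquiv.ofInjectiveEndo f hf, fun v i => rfl⟩
  obtain ⟨L, hL⟩ := hequiv F iF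
  obtain ⟨M, hM⟩ := hequiv H iH
  let A : (Fin 3 → ℂ) ≃L[ℂ] (Fin 3 → ℂ) := (L.trans M.symm).toContinuousLinearEquiv
  have hMA : ∀ v, M (A v) = L v := fun v => M.apply_symm_apply (L v)
  have hHA := hH.comp (A : (Fin 3 → ℂ) →L[ℂ] (Fin 3 → ℂ))
  have hderiv : ∀ k v, fderiv ℂ (fun z => H k (A z)) 0 v = fderiv ℂ (H k) 0 (A v) := fun k v => by
    have h1 : HasFDerivAt (H k) (fderiv ℂ (H k) 0) (A 0) := by
      rw [map_zero]; exact (hH.diff k 0).hasFDerivAt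
    have h2 : HasFDerivAt (fun z => H k (A z))
        ((fderiv ℂ (H k) 0).comp (A : (Fin 3 → ℂ) →L[ℂ] (Fin 3 → ℂ))) 0 :=
      h1.comp 0 A.hasFDerivAt
    rw [h2.fderiv]
    rfl
  have hgrad : ∀ k < 64, fderiv ℂ (fun z => H k (A z)) 0 = fderiv ℂ (F k) 0 := fun k hk => by
    ext1 v
    have hs := ((hHA.gradSystem v).congr (c' := fun k => F k 0) fun k hk => by
      simp [hc k hk]).sub (hF.gradSystem v)
    refine sub_eq_zero.1 (hs.eq_zero hF.constSystem (fun i => ?_) hk)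
    have h2 := hderiv (baseOdd i) v
    rw [← hM, hMA, hL] at h2
    exact sub_eq_zero.2 h2
  obtain ⟨h, hd, h0, hh⟩ := exists_factor hF.diff hHA.diff hF.exists_ne_zero hHA.exists_ne_zero
    hF.zero_ne_zero fun k hk z =>
      hF.mul_zero_eq hHA (fun k hk => by simp [hc k hk]) hgrad hk z
  exact ⟨A, h, hd, h0, hh⟩

/-- Multipliers of a nonvanishing function under two translations satisfy the cocycle symmetry. -/
lemma symm_of_translate {h : (Fin 3 → ℂ) → ℂ} (hh : Continuous h) (h0 : ∀ z, h z ≠ 0)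
    {u v : Fin 3 → ℂ} {a b : (Fin 3 → ℂ) →L[ℂ] ℂ} {c d : ℂ}
    (hu : ∀ z, h (z + u) = h z * cexp (a z + c)) (hv : ∀ z, h (z + v) = h z * cexp (b z + d)) :
    a v = b u := by
  obtain ⟨f, hf, hfe⟩ : ∃ f : (Fin 3 → ℂ) → ℂ, Continuous f ∧ ∀ z, cexp (f z) = h z := by
    obtain ⟨f, hf, hfe⟩ := exists_continuousOn_eqOn_exp_comp (U := Set.univ) (g := h)
      ((Homeomorph.Set.univ _).toHomotopyEquiv.simplyConnectedSpace) isOpen_univ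
      hh.continuousOn (by simpa using h0)
    exact ⟨f, continuousOn_univ.1 hf, fun z => hfe (Set.mem_univ z)⟩
  have key : ∀ (w : Fin 3 → ℂ) (l : (Fin 3 → ℂ) →L[ℂ] ℂ) (e : ℂ),
      (∀ z, h (z + w) = h z * cexp (l z + e)) → ∃ C, ∀ z, f (z + w) = f z + l z + C :=
    fun w l e hw => by
      refine ⟨f w - f 0, fun z => ?_⟩
      have h1 := isCoveringMap_exp.eq_of_comp_eq (A := Fin 3 → ℂ)
        (g₁ := fun z => f (z + w)) (g₂ := fun z => f z + l z + (f w - f 0))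
        (by fun_prop) (by fun_prop) (funext fun z => Subtype.ext ?_) 0 (by simp)
      · exact congrFun h1 z
      · have h2 := hw 0
        rw [zero_add, map_zero, zero_add] at h2
        simp only [Function.comp_apply, Complex.exp_add, Complex.exp_sub, hfe, hw, h2]
        field_simp [h0 0]
  obtain ⟨C, hC⟩ := key u a c hu
  obtain ⟨D, hD⟩ := key v b d hv
  have h1 := hC v
  have h2 := hD u
  have h3 := hC 0
  have h4 := hD 0
  rw [zero_add, map_zero] at h3 h4
  rw [add_comm] at h2
  linear_combination h2 - h1 - h4 + h3

lemma even_sub_of_neg_one_zpow {m n : ℤ} (h : ((-1 : ℂ)) ^ m = (-1) ^ n) : Even (m - n) := by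
  by_contra ho
  have h1 : ((-1 : ℂ)) ^ (m - n) = 1 := by
    rw [zpow_sub₀ (by norm_num), h, div_self (zpow_ne_zero _ (by norm_num))]
  rw [(Int.not_even_iff_odd.1 ho).neg_one_zpow] at h1
  norm_num at h1

lemma even_sub_of_chi_eq {p q p' q' : Fin 3 → ℤ}
    (h : ∀ k < 64, oddN k = false → chi k p q = chi k p' q') (i : Fin 3) :
    Even (p i - p' i) ∧ Even (q i - q' i) := by
  have e : ∀ i < 6, 2 ^ i < 64 ∧ oddN (2 ^ i) = false := by decide
  have h' : ∀ i < 6, chi (2 ^ i) p q = chi (2 ^ i) p' q' := fun i hi => h _ (e i hi).1 (e i hi).2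
  have hp : ∀ i : Fin 3, ∀ p q, chi (2 ^ (3 + i : ℕ)) p q = (-1) ^ p i := by
    intro i; fin_cases i <;> intro p q <;> simp [chi, coordOf, Fin.prod_univ_three, Nat.testBit]
  have hq : ∀ i : Fin 3, ∀ p q, chi (2 ^ (i : ℕ)) p q = (-1) ^ q i := by
    intro i; fin_cases i <;> intro p q <;> simp [chi, coordOf, Fin.prod_univ_three, Nat.testBit]
  exact ⟨even_sub_of_neg_one_zpow (by rw [← hp i p q, ← hp i p' q', h' _ (by omega)]),
    even_sub_of_neg_one_zpow (by rw [← hq i p q, ← hq i p' q', h' _ (by omega)])⟩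

section

variable {τ τ' : Matrix (Fin 3) (Fin 3) ℂ} {A : (Fin 3 → ℂ) ≃L[ℂ] (Fin 3 → ℂ)}
  {h : (Fin 3 → ℂ) → ℂ} {δ : ℕ → ℂ}

lemma exists_latticePoint_image (hτ : IsSiegel τ) (hτ' : IsSiegel τ')
    (hF' : ThetaSystem (thetaN τ')) (hδ : ∀ k, δ k ≠ 0) (hd : Differentiable ℂ h)
    (h0 : ∀ z, h z ≠ 0)
    (hh : ∀ k < 64, ∀ z, δ k * thetaN τ' k (A z) = h z * thetaN τ k z) (p q : Fin 3 → ℤ) :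
    ∃ p' q', A (latticePoint τ p q) = latticePoint τ' p' q' ∧
      (∀ i, Even (p i - p' i) ∧ Even (q i - q' i)) ∧
      ∀ z, h (z + latticePoint τ p q) * latticeFactor τ p z =
        h z * latticeFactor τ' p' (A z) := by
  set v := latticePoint τ p q
  have hlf : Differentiable ℂ fun z => latticeFactor τ p z := by
    unfold latticeFactor; fun_prop
  obtain ⟨p', q', hpq, hmul⟩ := eq_latticePoint_of_translate hτ' hF' (v := A v)
    (σ := fun k => chi k p q) (fun k _ => chi_ne_zero k p q)
    (h := fun w => h (A.symm w + v) * latticeFactor τ p (A.symm w) / h (A.symm w))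
    (by
      have hs : Differentiable ℂ fun w => A.symm w := A.symm.differentiable
      have h1 : Differentiable ℂ fun w => h (A.symm w) := hd.comp hs
      have h2 : Differentiable ℂ fun w => h (A.symm w + v) := hd.comp (hs.add_const v)
      have h3 : Differentiable ℂ fun w => latticeFactor τ p (A.symm w) := hlf.comp hs
      simp only [div_eq_mul_inv]
      exact (h2.mul h3).mul fun w => (h1 w).inv (h0 (A.symm w)))
    fun k hk w => by
      obtain ⟨z, rfl⟩ := A.surjective w
      rw [A.symm_apply_apply]
      have h1 := hh k hk (z + v)
      rw [thetaN_add_lattice hτ.1, map_add] at h1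
      have h2 := hh k hk z
      refine mul_left_cancel₀ (hδ k) ?_
      have := h0 z
      rw [h1]
      field_simp
      linear_combination (-(h (z + v) * chi k p q * latticeFactor τ p z)) * h2
  have hchi0 : ∀ p q, chi 0 p q = 1 := fun p q => by simp [chi, coordOf]
  have hm0 : ∀ w, h (A.symm w + v) * latticeFactor τ p (A.symm w) / h (A.symm w) =
      latticeFactor τ' p' w := fun w => by
    simpa [hchi0] using hmul w 0 (by norm_num) (by decide)
  refine ⟨p', q', hpq, even_sub_of_chi_eq fun k hk he => ?_, fun z => ?_⟩
  · have h1 := hmul 0 k hk he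
    rw [hm0] at h1
    exact mul_right_cancel₀ (Complex.exp_ne_zero _) h1
  · have h1 := hm0 (A z)
    rw [A.symm_apply_apply, div_eq_iff (h0 z)] at h1
    rw [h1, mul_comm]

/-- The symplectic form on the lattice `ℤ³ × ℤ³`. -/
def latticeForm (p q r s : Fin 3 → ℤ) : ℤ := ∑ i, p i * s i - ∑ i, r i * q i

lemma sum_mul_latticePoint (hτ : τ.IsSymm) (p q r s : Fin 3 → ℤ) :
    ∑ i, (p i : ℂ) * latticePoint τ r s i - ∑ i, (r i : ℂ) * latticePoint τ p q i =
      latticeForm p q r s := by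
  have := sum_mul_realPoint hτ (fun i => p i) (fun i => q i) (fun i => r i) (fun i => s i)
  rw [realPoint_intCast, realPoint_intCast] at this
  simpa [latticeForm] using this

lemma latticeForm_eq_of_factor (hτ : IsSiegel τ) (hτ' : IsSiegel τ') (hd : Differentiable ℂ h)
    (h0 : ∀ z, h z ≠ 0) {p q p' q' r s r' s' : Fin 3 → ℤ}
    (hA : A (latticePoint τ p q) = latticePoint τ' p' q')
    (hB : A (latticePoint τ r s) = latticePoint τ' r' s')
    (hp : ∀ z, h (z + latticePoint τ p q) * latticeFactor τ p z =
        h z * latticeFactor τ' p' (A z))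
    (hr : ∀ z, h (z + latticePoint τ r s) * latticeFactor τ r z =
        h z * latticeFactor τ' r' (A z)) :
    latticeForm p q r s = latticeForm p' q' r' s' := by
  let l : (Fin 3 → ℤ) → (Fin 3 → ℤ) → (Fin 3 → ℂ) →L[ℂ] ℂ := fun p p' =>
    (2 * (Real.pi : ℂ) * I) • (∑ i, (p i : ℂ) • ContinuousLinearMap.proj i
      - (∑ i, (p' i : ℂ) • ContinuousLinearMap.proj i).comp (A : (Fin 3 → ℂ) →L[ℂ] (Fin 3 → ℂ)))
  have hl : ∀ p p' z, l p p' z = 2 * (Real.pi : ℂ) * I *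
      (∑ i, (p i : ℂ) * z i - ∑ i, (p' i : ℂ) * A z i) := fun p p' z => by
    simp [l, _root_.sum_apply]
  have key : ∀ p q p', (∀ z, h (z + latticePoint τ p q) * latticeFactor τ p z =
        h z * latticeFactor τ' p' (A z)) →
      ∀ z, h (z + latticePoint τ p q) = h z * cexp (l p p' z +
        ((Real.pi : ℂ) * I * ∑ i, ∑ j, (p i : ℂ) * τ i j * p j -
          (Real.pi : ℂ) * I * ∑ i, ∑ j, (p' i : ℂ) * τ' i j * p' j)) := fun p q p' hp z => by
    refine mul_right_cancel₀ (b := latticeFactor τ p z) (Complex.exp_ne_zero _) ?_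
    rw [hp, mul_assoc, latticeFactor, latticeFactor, ← Complex.exp_add, hl]
    congr 2
    ring
  have h1 := symm_of_translate hd.continuous h0 (key p q p' hp) (key r s r' hr)
  rw [hl, hl, hA, hB] at h1
  have h2 := mul_left_cancel₀ two_pi_I_ne_zero h1
  have h3 := sum_mul_latticePoint hτ.1 p q r s
  have h4 := sum_mul_latticePoint hτ'.1 p' q' r' s'
  have h5 : (latticeForm p q r s : ℂ) = latticeForm p' q' r' s' := by
    rw [← h3, ← h4]; linear_combination h2
  exact_mod_cast h5

end

/-- A linear isomorphism of period lattices preserving the symplectic form comes from the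
symplectic group. -/
lemma exists_symplectic_of_lattice_map {τ τ' : Matrix (Fin 3) (Fin 3) ℂ}
    (A : (Fin 3 → ℂ) →ₗ[ℂ] (Fin 3 → ℂ)) (P Q : (Fin 3 → ℤ) → (Fin 3 → ℤ) → Fin 3 → ℤ)
    (hA : ∀ p q, A (latticePoint τ p q) = latticePoint τ' (P p q) (Q p q))
    (hpar : ∀ p q i, Even (p i - P p q i) ∧ Even (q i - Q p q i))
    (hform : ∀ p q r s, latticeForm p q r s = latticeForm (P p q) (Q p q) (P r s) (Q r s)) :
    ∃ a b c d : Matrix (Fin 3) (Fin 3) ℤ,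
      IsSymplectic a b c d ∧
      (Matrix.fromBlocks a b c d).map (Int.cast : ℤ → ZMod 2) = 1 ∧
      τ' = (a.map (Int.cast : ℤ → ℂ) * τ + b.map (Int.cast : ℤ → ℂ)) *
        (c.map (Int.cast : ℤ → ℂ) * τ + d.map (Int.cast : ℤ → ℂ))⁻¹ := by
  let e : Fin 3 → Fin 3 → ℤ := fun j => Pi.single j 1
  let α : Matrix (Fin 3) (Fin 3) ℤ := of fun i j => P (e j) 0 i
  let β : Matrix (Fin 3) (Fin 3) ℤ := of fun i j => Q (e j) 0 i
  let γ : Matrix (Fin 3) (Fin 3) ℤ := of fun i j => P 0 (e j) i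
  let δ : Matrix (Fin 3) (Fin 3) ℤ := of fun i j => Q 0 (e j) i
  have r1 : αᵀ * β - βᵀ * α = 0 := by
    ext i j
    have := hform (e i) 0 (e j) 0
    simpa [latticeForm, mul_apply, α, β, mul_comm] using this.symm
  have r2 : αᵀ * δ - βᵀ * γ = 1 := by
    ext i j
    have := hform (e i) 0 0 (e j)
    simpa [latticeForm, mul_apply, α, β, γ, δ, e, mul_comm, Pi.single_apply, one_apply,
      eq_comm] using this.symm
  have r3 : γᵀ * δ - δᵀ * γ = 0 := by
    ext i j
    have := hform 0 (e i) 0 (e j)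
    simpa [latticeForm, mul_apply, γ, δ, mul_comm] using this.symm
  have r2' : δᵀ * α - γᵀ * β = 1 := by
    simpa using congrArg transpose r2
  let B := LinearMap.toMatrix' A
  have hBτ : B * τ = τ' * α.map (Int.cast : ℤ → ℂ) + β.map (Int.cast : ℤ → ℂ) := by
    ext i j
    have := congrFun (hA (e j) 0) i
    rw [← LinearMap.toMatrix'_mulVec] at this
    simpa [mulVec, dotProduct, latticePoint, mul_apply, B, α, β, e, Pi.single_apply] using this
  have hB : B = τ' * γ.map (Int.cast : ℤ → ℂ) + δ.map (Int.cast : ℤ → ℂ) := by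
    ext i j
    have := congrFun (hA 0 (e j)) i
    rw [← LinearMap.toMatrix'_mulVec] at this
    simpa [mulVec, dotProduct, latticePoint, mul_apply, B, γ, δ, e, Pi.single_apply] using this
  have cast2 : ∀ {m n : ℤ}, Even (m - n) → ((n : ℤ) : ZMod 2) = m := fun {m n} h =>
    (ZMod.intCast_eq_intCast_iff_dvd_sub n m 2).2 (by exact_mod_cast h.two_dvd)
  refine ⟨δ, -β, -γ, α, ?_, ?_, ?_⟩
  · rw [IsSymplectic, Jmat, fromBlocks_transpose, fromBlocks_multiply, fromBlocks_multiply,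
      fromBlocks_inj]
    refine ⟨?_, ?_, ?_, ?_⟩
    · simpa [sub_eq_add_neg, add_comm] using r3
    · simpa [sub_eq_add_neg, add_comm] using r2'
    · simpa [sub_eq_add_neg, add_comm] using congrArg Neg.neg r2
    · simpa [sub_eq_add_neg, add_comm] using r1
  · rw [← fromBlocks_one, fromBlocks_map, fromBlocks_inj]
    refine ⟨?_, ?_, ?_, ?_⟩ <;> ext i j
    · simp [δ, cast2 (hpar 0 (e j) i).2, e, Pi.single_apply, one_apply]
    · simp [β, cast2 (hpar (e j) 0 i).2]
    · simp [γ, cast2 (hpar 0 (e j) i).1]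
    · simp [α, cast2 (hpar (e j) 0 i).1, e, Pi.single_apply, one_apply]
  · have hm : ∀ {X Y Z W V : Matrix (Fin 3) (Fin 3) ℤ}, Xᵀ * Y - Zᵀ * W = V →
        (X.map (Int.cast : ℤ → ℂ))ᵀ * Y.map Int.cast -
          (Z.map (Int.cast : ℤ → ℂ))ᵀ * W.map Int.cast =
          V.map Int.cast := fun {X Y Z W V} h => by
      rw [← h]
      ext i j
      simp [mul_apply]
    have c2 := hm r2'
    have c3 := hm r3
    rw [show (-β).map (Int.cast : ℤ → ℂ) = -β.map Int.cast from by ext; simp,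
      show (-γ).map (Int.cast : ℤ → ℂ) = -γ.map Int.cast from by ext; simp]
    generalize α.map (Int.cast : ℤ → ℂ) = α' at *
    generalize β.map (Int.cast : ℤ → ℂ) = β' at *
    generalize γ.map (Int.cast : ℤ → ℂ) = γ' at *
    generalize δ.map (Int.cast : ℤ → ℂ) = δ' at *
    have hnum : δ' * τ + -β' = τ' * (-γ' * τ + α') := by
      have h1 : (τ' * γ' + δ') * τ = τ' * α' + β' := by rw [← hB, hBτ]
      rw [add_mul, ← eq_sub_iff_add_eq'] at h1
      rw [h1, mul_add, neg_mul, mul_neg, mul_assoc]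
      abel
    have hone : (δ'ᵀ + γ'ᵀ * τ') * (-γ' * τ + α') = 1 := by
      rw [add_mul, mul_assoc γ'ᵀ, ← hnum]
      have h1 : δ'ᵀ * (-γ' * τ + α') + γ'ᵀ * (δ' * τ + -β') =
          (γ'ᵀ * δ' - δ'ᵀ * γ') * τ + (δ'ᵀ * α' - γ'ᵀ * β') := by noncomm_ring
      rw [h1, c2, c3]
      simp
    rw [hnum, mul_nonsing_inv_cancel_right _ _ (isUnit_det_of_left_inverse hone)]

/-- Points of the Siegel space with the same fourth powers of theta constants, up to a common
factor, are equivalent under the principal congruence subgroup of level two. -/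
lemma exists_symplectic_of_thetaN {τ τ' : Matrix (Fin 3) (Fin 3) ℂ} (hτ : IsSiegel τ)
    (hτ' : IsSiegel τ') (h0 : ∀ k < 64, oddN k = false → thetaN τ k 0 ≠ 0)
    (h0' : ∀ k < 64, oddN k = false → thetaN τ' k 0 ≠ 0) {κ : ℂ} (hκ : κ ≠ 0)
    (h4 : ∀ k < 64, oddN k = false → thetaN τ' k 0 ^ 4 = κ * thetaN τ k 0 ^ 4) :
    ∃ a b c d : Matrix (Fin 3) (Fin 3) ℤ,
      IsSymplectic a b c d ∧
      (Matrix.fromBlocks a b c d).map (Int.cast : ℤ → ZMod 2) = 1 ∧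
      τ' = (a.map (Int.cast : ℤ → ℂ) * τ + b.map (Int.cast : ℤ → ℂ)) *
        (c.map (Int.cast : ℤ → ℂ) * τ + d.map (Int.cast : ℤ → ℂ))⁻¹ := by
  have hF := thetaSystem_thetaN hτ h0
  have hF' := thetaSystem_thetaN hτ' h0'
  obtain ⟨δ, hδ, hδc⟩ := hF.constSystem.exists_quarticInvariant hF'.constSystem hκ fun k hk => by
    by_cases ho : oddN k = true
    · simp only [hF.odd_zero ho, hF'.odd_zero ho]
      ring
    · exact h4 k hk (by simpa using ho)
  obtain ⟨A, h, hd, hne, hh⟩ := exists_linear_comparison hF (hF'.twist hδ.inv)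
    (fun k hk => by simp only [hδc k hk]; rw [inv_mul_cancel_left₀ (hδ.ne_zero k)])
    (fun v => eq_zero_of_fderiv_base_eq_zero hτ hF) fun v hv =>
      eq_zero_of_fderiv_base_eq_zero hτ' hF' fun i => by
        have h1 := hv i
        rw [fderiv_const_mul (hF'.diff _ _)] at h1
        simpa [hδ.ne_zero] using h1
  choose P Q hPQ hpar hfac using exists_latticePoint_image hτ hτ' hF'
    (fun k => inv_ne_zero (hδ.ne_zero k)) hd hne hh
  exact exists_symplectic_of_lattice_map (A : (Fin 3 → ℂ) →ₗ[ℂ] (Fin 3 → ℂ)) P Q hPQ hpar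
    fun p q r s => latticeForm_eq_of_factor hτ hτ' hd hne (hPQ p q) (hPQ r s) (hfac p q) (hfac r s)

theorem theta_fourth_injective
    (τ τ' : Matrix (Fin 3) (Fin 3) ℂ) (hτ : IsSiegel τ) (hτ' : IsSiegel τ')
    (hev : ∀ m : ThetaChar 3, IsEvenChar m →
      theta (charLift m) τ 0 ≠ 0 ∧ theta (charLift m) τ' 0 ≠ 0)
    (hth : ∃ c : ℂ, c ≠ 0 ∧ ∀ m : ThetaChar 3, IsEvenChar m →
      theta (charLift m) τ' 0 ^ 4 = c * theta (charLift m) τ 0 ^ 4) :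
    ∃ a b c d : Matrix (Fin 3) (Fin 3) ℤ,
      IsSymplectic a b c d ∧
      (Matrix.fromBlocks a b c d).map (Int.cast : ℤ → ZMod 2) = 1 ∧
      τ' = (a.map (Int.cast : ℤ → ℂ) * τ + b.map (Int.cast : ℤ → ℂ)) *
        (c.map (Int.cast : ℤ → ℂ) * τ + d.map (Int.cast : ℤ → ℂ))⁻¹ := by
  obtain ⟨κ, hκ, h4⟩ := hth
  have hev' := fun k hk he => hev (charOf k) (isEvenChar_charOf k hk he)
  have h4' := fun k hk he => h4 (charOf k) (isEvenChar_charOf k hk he)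
  simp only [theta_charOf] at hev' h4'
  exact exists_symplectic_of_thetaN hτ hτ' (fun k hk he => (hev' k hk he).1)
    (fun k hk he => (hev' k hk he).2) hκ h4'
end

section
/- For every τ in the Siegel upper half-space H_g, every z ∈ ℂ^g and every m', m'' ∈ ℤ^g, the family p ↦ exp(π i · ᵗ(p + m'/2) τ (p + m'/2) + 2π i · (p + m'/2)·(z + m''/2)), indexed by p ∈ ℤ^g, is summable (the theta series converges absolutely). -/
open scoped BigOperators
open Complex Matrix

/-- A positive definite real quadratic form dominates a positive multiple of the
sum of squares of the coordinates. -/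
theorem Matrix.PosDef.exists_pos_mul_sum_sq_le {ι : Type*} [Fintype ι] {M : Matrix ι ι ℝ}
    (hM : M.PosDef) :
    ∃ c : ℝ, 0 < c ∧ ∀ x : ι → ℝ, c * ∑ i, x i ^ 2 ≤ ∑ i, ∑ j, x i * M i j * x j := by
  have hq : ∀ x : ι → ℝ, x ≠ 0 → 0 < ∑ i, ∑ j, x i * M i j * x j := fun x hx ↦ by
    simpa [dotProduct, mulVec, Finset.mul_sum, mul_assoc] using hM.dotProduct_mulVec_pos hx
  let S : Set (ι → ℝ) := {x | ∑ i, x i ^ 2 = 1}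
  have hS : IsCompact S := by
    refine Metric.isCompact_of_isClosed_isBounded
      (isClosed_eq (by fun_prop) continuous_const) ?_
    refine (Metric.isBounded_closedBall (x := (0 : ι → ℝ)) (r := 1)).subset fun x hx ↦ ?_
    rw [mem_closedBall_zero_iff, pi_norm_le_iff_of_nonneg zero_le_one]
    intro i
    rw [Real.norm_eq_abs, ← sq_le_one_iff_abs_le_one]
    exact (Finset.single_le_sum (f := fun i ↦ x i ^ 2) (fun j _ ↦ sq_nonneg (x j))
      (Finset.mem_univ i)).trans_eq hx
  have hpos : ∀ x : ι → ℝ, x ≠ 0 → 0 < ∑ i, x i ^ 2 := fun x hx ↦ by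
    obtain ⟨i, hi⟩ := Function.ne_iff.mp hx
    exact Finset.sum_pos' (fun j _ ↦ sq_nonneg (x j)) ⟨i, Finset.mem_univ i, sq_pos_of_ne_zero hi⟩
  obtain ⟨c, hc, hcS⟩ : ∃ c : ℝ, 0 < c ∧ ∀ x ∈ S, c ≤ ∑ i, ∑ j, x i * M i j * x j := by
    rcases S.eq_empty_or_nonempty with hE | hN
    · exact ⟨1, one_pos, by simp [hE]⟩
    · obtain ⟨y, hy, hmin⟩ := hS.exists_isMinOn hN
        (f := fun x : ι → ℝ ↦ ∑ i, ∑ j, x i * M i j * x j) (by fun_prop)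
      refine ⟨_, hq y ?_, fun x hx ↦ hmin hx⟩
      rintro rfl
      simp [S] at hy
  refine ⟨c, hc, fun x ↦ ?_⟩
  rcases eq_or_ne x 0 with rfl | hx
  · simp
  have hs := hpos x hx
  set s := ∑ i, x i ^ 2
  have hr : √s ^ 2 = s := Real.sq_sqrt hs.le
  have hr0 : √s ≠ 0 := (Real.sqrt_pos.mpr hs).ne'
  have h := hcS (fun i ↦ x i / √s) (by
    simp only [S, Set.mem_ofPred_eq, div_pow, hr, ← Finset.sum_div]
    exact div_self hs.ne')
  have hscale : ∑ i, ∑ j, x i / √s * M i j * (x j / √s)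
      = (∑ i, ∑ j, x i * M i j * x j) / s := by
    simp only [Finset.sum_div]
    refine Finset.sum_congr rfl fun i _ ↦ Finset.sum_congr rfl fun j _ ↦ ?_
    rw [show x i / √s * M i j * (x j / √s) = x i * M i j * x j / √s ^ 2 by field_simp, hr]
  rwa [hscale, le_div_iff₀ hs] at h

/-- A product of finitely many nonnegative summable families is summable over the
product of the index types. -/
theorem summable_pi_prod_of_nonneg {α : Type*} {n : ℕ} {f : Fin n → α → ℝ}
    (hf0 : ∀ i a, 0 ≤ f i a) (hf : ∀ i, Summable (f i)) :
    Summable fun p : Fin n → α ↦ ∏ i, f i (p i) := by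
  induction n with
  | zero => exact Summable.of_finite
  | succ n ih =>
    rw [← (Fin.consEquiv fun _ : Fin (n + 1) ↦ α).summable_iff]
    have h := (hf 0).mul_of_nonneg (ih (fun i ↦ hf0 i.succ) fun i ↦ hf i.succ) (hf0 0)
      fun p ↦ Finset.prod_nonneg fun i _ ↦ hf0 i.succ (p i)
    refine h.congr fun p ↦ ?_
    simp [Fin.prod_univ_succ, Fin.consEquiv]

/-- Shifted Gaussian sums over the integers converge. -/
theorem summable_exp_neg_shifted_sq {c : ℝ} (hc : 0 < c) (a b : ℝ) :
    Summable fun n : ℤ ↦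
      Real.exp (-Real.pi * (c * (n + a) ^ 2) - 2 * Real.pi * ((n + a) * b)) := by
  have h := ((summable_jacobiTheta₂_term_iff ((c * a + b : ℝ) * I) (c * I)).mpr
    (by simpa using hc)).norm.mul_left
      (Real.exp (-Real.pi * (c * a ^ 2) - 2 * Real.pi * (a * b)))
  refine h.congr fun n ↦ ?_
  rw [norm_jacobiTheta₂_term, ← Real.exp_add]
  congr 1
  simp only [im_ofReal_mul, I_im]
  ring

/-- The absolute value of a term of the theta series. -/
theorem norm_thetaTerm {g : ℕ} (m : (Fin g → ℤ) × (Fin g → ℤ))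
    (τ : Matrix (Fin g) (Fin g) ℂ) (z : Fin g → ℂ) (p : Fin g → ℤ) :
    ‖thetaTerm m τ z p‖ = Real.exp
      (-Real.pi * (∑ i, ∑ j, ((p i : ℝ) + m.1 i / 2) * (τ i j).im * ((p j : ℝ) + m.1 j / 2))
        - 2 * Real.pi * ∑ i, ((p i : ℝ) + m.1 i / 2) * (z i).im) := by
  have hx : ∀ i, (p i : ℂ) + (m.1 i : ℂ) / 2 = (((p i : ℝ) + m.1 i / 2 : ℝ) : ℂ) := by
    intro i; push_cast; rfl
  have hy : ∀ i, (z i + (m.2 i : ℂ) / 2).im = (z i).im := by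
    intro i
    have : (m.2 i : ℂ) / 2 = ((m.2 i / 2 : ℝ) : ℂ) := by push_cast; rfl
    rw [this, add_im, ofReal_im, add_zero]
  have hre : ∀ (r : ℝ) (w : ℂ), (r * I * w).re = -r * w.im := by
    intro r w; simp [mul_assoc]
  have h2 : 2 * (Real.pi : ℂ) = ((2 * Real.pi : ℝ) : ℂ) := by push_cast; rfl
  rw [thetaTerm, norm_exp, h2, add_re, hre, hre, neg_mul (2 * Real.pi), ← sub_eq_add_neg]
  simp only [im_sum, hx, im_ofReal_mul, im_mul_ofReal, hy]

/-- Absolute convergence of the theta series: the family of its terms is summable. -/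
theorem thetaTerm_summable {g : ℕ} (τ : Matrix (Fin g) (Fin g) ℂ) (hτ : IsSiegel τ)
    (z : Fin g → ℂ) (m : (Fin g → ℤ) × (Fin g → ℤ)) :
    Summable (thetaTerm m τ z) := by
  obtain ⟨c, hc, hcoer⟩ := hτ.2.exists_pos_mul_sum_sq_le
  refine Summable.of_norm_bounded (summable_pi_prod_of_nonneg (fun _ _ ↦ Real.exp_nonneg _)
    fun i ↦ summable_exp_neg_shifted_sq hc (m.1 i / 2) (z i).im) fun p ↦ ?_
  rw [norm_thetaTerm, ← Real.exp_sum, Real.exp_le_exp, Finset.sum_sub_distrib,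
    ← Finset.mul_sum, ← Finset.mul_sum, ← Finset.mul_sum]
  have h := hcoer fun i ↦ (p i : ℝ) + m.1 i / 2
  simp only [of_apply] at h
  nlinarith [mul_le_mul_of_nonneg_left h Real.pi_pos.le]
end
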